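/- Structure Theorem for Compact Connected Lie Groups: if G is a compact connected Lie group, then there exist natural numbers m and k, simple, connected and simply connected compact Lie groups L₁, …, L_k, and a continuous surjective group homomorphism p : 𝕋^m × L₁ × ⋯ × L_k → G with finite kernel, where 𝕋^m is the product of m copies of the circle group. -/

import Mathlib

open Topology

universe u

/-- A topological space `Z` has Lebesgue covering dimension at most `n`:
every finite open cover admits a finite open refinement in which each point
lies in at most `n + 1` members. -/
def CovDimLE (Z : Type u) [TopologicalSpace Z] (n : ℕ) : Prop :=
  ∀ 𝒰 : Finset (Set Z), (∀ U ∈ 𝒰, IsOpen U) → ⋃₀ (𝒰 : Set (Set Z)) = Set.univ →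
    ∃ 𝒱 : Finset (Set Z), (∀ V ∈ 𝒱, IsOpen V) ∧ ⋃₀ (𝒱 : Set (Set Z)) = Set.univ ∧
      (∀ V ∈ 𝒱, ∃ U ∈ 𝒰, V ⊆ U) ∧
      ∀ z : Z, Nat.card {V : Set Z // V ∈ 𝒱 ∧ z ∈ V} ≤ n + 1

/-- `X` is an absolute extensor in dimension `n` (an AE(n)-space): every continuous map
into `X` from a closed subspace of a compact Hausdorff space of covering dimension
at most `n` extends continuously over the whole space. -/
def IsAE (n : ℕ) (X : Type u) [TopologicalSpace X] : Prop :=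
  ∀ (Z : Type u) [TopologicalSpace Z], CompactSpace Z → T2Space Z → CovDimLE Z n →
    ∀ Z₀ : Set Z, IsClosed Z₀ → ∀ g₀ : C(Z₀, X),
      ∃ g : C(Z, X), ∀ z : Z₀, g (z : Z) = g₀ z

/-- `X` is an absolute neighborhood extensor in dimension `4` (an ANE(4)-space):
every continuous map into `X` from a closed subspace `Z₀` of a compact Hausdorff
space of covering dimension at most `4` extends continuously over some open
neighborhood of `Z₀`. -/
def IsANE4 (X : Type u) [TopologicalSpace X] : Prop :=
  ∀ (Z : Type u) [TopologicalSpace Z], CompactSpace Z → T2Space Z → CovDimLE Z 4 →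
    ∀ Z₀ : Set Z, IsClosed Z₀ → ∀ g₀ : C(Z₀, X),
      ∃ (U : Set Z) (_ : IsOpen U) (hZ₀U : Z₀ ⊆ U) (g : C(U, X)),
        ∀ (z : Z) (hz : z ∈ Z₀), g ⟨z, hZ₀U hz⟩ = g₀ ⟨z, hz⟩

/-- The underlying space of `X` is a topological manifold: every point has an open
neighborhood homeomorphic to an open subset of some Euclidean space. -/
def IsTopManifold (X : Type u) [TopologicalSpace X] : Prop :=
  ∀ x : X, ∃ (n : ℕ) (U : Set X) (V : Set (EuclideanSpace ℝ (Fin n))),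
    IsOpen U ∧ x ∈ U ∧ IsOpen V ∧ Nonempty (U ≃ₜ V)

/-- The multiplicative equivalence `e` is an isomorphism of topological groups,
i.e. it is continuous with continuous inverse. -/
def IsTopGroupIso {G H : Type*} [Group G] [Group H] [TopologicalSpace G]
    [TopologicalSpace H] (e : G ≃* H) : Prop :=
  Continuous e ∧ Continuous e.symm

/-- A package consisting of a compact Hausdorff topological group. -/
structure CompactGroupPkg : Type (u + 1) where
  carrier : Type u
  [topology : TopologicalSpace carrier]
  [group : Group carrier]
  [topGroup : IsTopologicalGroup carrier]
  [compact : CompactSpace carrier]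
  [t2 : T2Space carrier]

attribute [instance] CompactGroupPkg.topology CompactGroupPkg.group
  CompactGroupPkg.topGroup CompactGroupPkg.compact CompactGroupPkg.t2

/-- `L` is a simple, connected and simply connected compact Lie group: a compact
Hausdorff topological group whose underlying space is a topological manifold,
which is connected, simply connected, nonabelian, and all of whose closed
normal subgroups other than the whole group are finite. -/
def IsSimpleSCSCLieGroup (L : CompactGroupPkg.{u}) : Prop :=
  IsTopManifold L.carrier ∧ ConnectedSpace L.carrier ∧ SimplyConnectedSpace L.carrier ∧
    (∃ a b : L.carrier, a * b ≠ b * a) ∧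
    ∀ N : Subgroup L.carrier, N.Normal → IsClosed (N : Set L.carrier) → N ≠ ⊤ → Finite N

section PeterWeyl
open MeasureTheory

/-- The operator sending a vector `f` of a Hilbert space to the function `x ↦ ⟪u x, f⟫`. -/
noncomputable def matrixCoeff {X H : Type*} [TopologicalSpace X] [CompactSpace X]
    [NormedAddCommGroup H] [InnerProductSpace ℂ H] (u : C(X, H)) :
    H →L[ℂ] BoundedContinuousFunction X ℂ :=
  LinearMap.mkContinuous
    { toFun := fun f => BoundedContinuousFunction.mkOfCompact
        ⟨fun x => inner ℂ (u x) f, by fun_prop⟩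
      map_add' := fun f g => by ext x; simp
      map_smul' := fun c f => by ext x; simp }
    ‖BoundedContinuousFunction.mkOfCompact u‖ (fun f => by
      rw [BoundedContinuousFunction.norm_le (by positivity)]
      intro x
      refine (norm_inner_le_norm _ _).trans ?_
      gcongr
      exact (BoundedContinuousFunction.mkOfCompact u).norm_coe_le_norm x)

@[simp] lemma matrixCoeff_apply {X H : Type*} [TopologicalSpace X] [CompactSpace X]
    [NormedAddCommGroup H] [InnerProductSpace ℂ H] (u : C(X, H)) (f : H) (x : X) :
    matrixCoeff u f x = inner ℂ (u x) f := rfl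

lemma isCompactOperator_matrixCoeff {X H : Type*} [TopologicalSpace X] [CompactSpace X]
    [NormedAddCommGroup H] [InnerProductSpace ℂ H] (u : C(X, H)) :
    IsCompactOperator (matrixCoeff u) := by
  refine (isCompactOperator_iff_isCompact_closure_image_closedBall
    (matrixCoeff u : H →ₗ[ℂ] BoundedContinuousFunction X ℂ) zero_lt_one).2 ?_
  refine BoundedContinuousFunction.arzela_ascoli
    (Metric.closedBall 0 ‖matrixCoeff u‖) (isCompact_closedBall _ _) _ ?_ ?_
  · rintro _ x ⟨f, hf, rfl⟩
    rw [mem_closedBall_zero_iff] at hf ⊢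
    refine ((matrixCoeff u f).norm_coe_le_norm x).trans ?_
    refine ((matrixCoeff u).le_opNorm f).trans ?_
    exact mul_le_of_le_one_right (norm_nonneg _) hf
  · intro x₀
    rw [Metric.equicontinuousAt_iff_right]
    intro ε hε
    have := (u.continuous.tendsto x₀).eventually (Metric.ball_mem_nhds _ hε)
    filter_upwards [this] with x hx
    rintro ⟨_, f, hf, rfl⟩
    rw [mem_closedBall_zero_iff] at hf
    change dist (inner ℂ (u x₀) f) (inner ℂ (u x) f) < ε
    rw [dist_eq_norm, ← inner_sub_left]
    refine (norm_inner_le_norm _ _).trans_lt ?_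
    rw [dist_comm, dist_eq_norm] at hx
    exact (mul_le_of_le_one_right (norm_nonneg _) hf).trans_lt hx

/-- **Peter–Weyl**: the finite-dimensional continuous representations of a compact second countable
group separate points. -/
theorem exists_matrix_rep_ne_one {G : Type*} [Group G] [TopologicalSpace G] [IsTopologicalGroup G]
    [CompactSpace G] [T2Space G] [SecondCountableTopology G] {g : G} (hg : g ≠ 1) :
    ∃ (n : ℕ) (ρ : G →* Matrix (Fin n) (Fin n) ℂ), Continuous ρ ∧ ρ g ≠ 1 := by
  borelize G
  let μ : Measure G := Measure.haar
  have : Fact ((2 : ENNReal) ≠ ⊤) := ⟨by simp⟩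
  let H := Lp ℂ 2 μ
  let L : G → H →L[ℂ] H := fun a => LinearMap.mkContinuous
    { toFun := fun f => DomMulAct.mk a⁻¹ • f
      map_add' := fun f g => smul_add _ _ _
      map_smul' := fun c f => (smul_comm c (DomMulAct.mk a⁻¹) f).symm } 1
      (fun f => by rw [one_mul]; exact (DomMulAct.norm_smul_Lp _ f).le)
  have L_apply : ∀ a f, L a f = DomMulAct.mk a⁻¹ • f := fun a f => rfl
  have L_mul : ∀ a b, L (a * b) = L a * L b := by
    intro a b
    ext1 f
    rw [mul_apply_eq_comp, L_apply, L_apply, L_apply, smul_smul, mul_inv_rev]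
    rfl
  have L_one : L 1 = 1 := by
    ext1 f
    rw [L_apply, inv_one]
    exact one_smul _ f
  have L_norm : ∀ a f, ‖L a f‖ = ‖f‖ := fun a f => DomMulAct.norm_smul_Lp _ f
  have L_cont : ∀ f, Continuous fun a => L a f := by
    intro f
    have : Continuous fun a : G => DomMulAct.mk a⁻¹ • f := by
      have h1 : Continuous fun a : G => DomMulAct.mk a⁻¹ :=
        DomMulAct.continuous_mk.comp continuous_inv
      exact h1.smul continuous_const
    exact this
  have L_inner : ∀ a f h, inner ℂ (L a f) (L a h) = inner ℂ f h := by
    intro a f h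
    let l : H →ₗᵢ[ℂ] H := ⟨(L a : H →ₗ[ℂ] H), L_norm a⟩
    exact l.inner_map_map f h
  have L_adj : ∀ a f h, inner ℂ (L a f) h = inner ℂ f (L a⁻¹ h) := by
    intro a f h
    rw [← L_inner a f (L a⁻¹ h), ← mul_apply_eq_comp, ← L_mul, mul_inv_cancel, L_one,
      one_apply_eq_self]
  obtain ⟨ψ, hψ0, hψ1, -⟩ := exists_continuous_zero_one_of_isClosed (s := {(1 : G)}) (t := {g⁻¹})
    isClosed_singleton isClosed_singleton (by simpa using hg)
  let φ : C(G, ℂ) := ⟨fun x => (ψ x : ℂ), by fun_prop⟩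
  let v : H := ContinuousMap.toLp 2 μ ℂ φ
  let u : C(G, H) := ⟨fun x => L x v, L_cont v⟩
  let S : H →L[ℂ] H := (BoundedContinuousFunction.toLp 2 μ ℂ).comp (matrixCoeff u)
  have S_ae : ∀ f, S f =ᵐ[μ] fun x => inner ℂ (u x) f := fun f =>
    BoundedContinuousFunction.coeFn_toLp (p := 2) (𝕜 := ℂ) μ (matrixCoeff u f)
  have S_compact : IsCompactOperator S :=
    (isCompactOperator_matrixCoeff u).clm_comp (BoundedContinuousFunction.toLp 2 μ ℂ)
  have S_comm : ∀ a f, S (L a f) = L a (S f) := by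
    intro a f
    refine Lp.ext ?_
    have h1 : (L a (S f) : G → ℂ) =ᵐ[μ] fun x => (S f) (a⁻¹ • x) := DomMulAct.smul_Lp_ae_eq _ _
    have h2 := (measurePreserving_smul a⁻¹ μ).quasiMeasurePreserving.ae_eq_comp (S_ae f)
    refine (S_ae _).trans (Filter.EventuallyEq.trans ?_ (h1.trans h2).symm)
    refine Filter.Eventually.of_forall fun x => ?_
    change inner ℂ (L x v) (L a f) = inner ℂ (L (a⁻¹ • x) v) f
    rw [smul_eq_mul, L_mul, mul_apply_eq_comp, L_adj a⁻¹, inv_inv]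
  let T : H →L[ℂ] H := (ContinuousLinearMap.adjoint S).comp S
  have T_compact : IsCompactOperator T := S_compact.clm_comp (ContinuousLinearMap.adjoint S)
  have T_symm : (T : H →ₗ[ℂ] H).IsSymmetric := by
    intro f h
    change inner ℂ (ContinuousLinearMap.adjoint S (S f)) h =
      inner ℂ f (ContinuousLinearMap.adjoint S (S h))
    rw [ContinuousLinearMap.adjoint_inner_left, ContinuousLinearMap.adjoint_inner_right]
  have T_comm : ∀ a f, T (L a f) = L a (T f) := by
    intro a f
    refine ext_inner_right ℂ fun h => ?_
    rw [L_adj]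
    change inner ℂ (ContinuousLinearMap.adjoint S (S (L a f))) h =
      inner ℂ (ContinuousLinearMap.adjoint S (S f)) (L a⁻¹ h)
    rw [ContinuousLinearMap.adjoint_inner_left, ContinuousLinearMap.adjoint_inner_left, S_comm,
      L_adj, S_comm]
  -- some nonzero eigenspace is not fixed by `g`
  have key : ∃ c : ℂ, c ≠ 0 ∧ ∃ f ∈ Module.End.eigenspace (T : H →ₗ[ℂ] H) c, L g f ≠ f := by
    by_contra! hcon
    have h0 : ∀ f, T f = 0 → S f = 0 := by
      intro f hf
      have : inner ℂ (T f) f = (0 : ℂ) := by rw [hf, inner_zero_left]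
      change inner ℂ (ContinuousLinearMap.adjoint S (S f)) f = (0 : ℂ) at this
      rwa [ContinuousLinearMap.adjoint_inner_left, inner_self_eq_zero] at this
    have hu0 : ∀ f, T f = 0 → ∀ x, inner ℂ (u x) f = (0 : ℂ) := by
      intro f hf
      have h1 : (fun x => inner ℂ (u x) f) =ᵐ[μ] fun _ => (0 : ℂ) := by
        refine (S_ae f).symm.trans ?_
        rw [h0 f hf]
        exact Lp.coeFn_zero _ _ _
      have := (Continuous.ae_eq_iff_eq μ (by fun_prop) continuous_const).1 h1
      exact fun x => congrFun this x
    have hfix : ∀ w : H, L g w - w ∈ (⨆ c, Module.End.eigenspace (T : H →ₗ[ℂ] H) c)ᗮ →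
        L g w = w := by
      intro w hw
      rw [T.orthogonalComplement_iSup_eigenspaces_eq_bot T_compact T_symm] at hw
      exact sub_eq_zero.1 hw
    have hu1 : L g v = v := by
      apply hfix
      rw [Submodule.mem_orthogonal]
      intro f hf
      induction hf using Submodule.iSup_induction' with
      | mem c f hf =>
        by_cases hc : c = 0
        · have hTf : T f = 0 := by
            have := Module.End.mem_eigenspace_iff.1 hf
            simpa [hc] using this
          have ha := hu0 f hTf g
          have hb := hu0 f hTf 1
          change inner ℂ (L g v) f = 0 at ha
          change inner ℂ (L 1 v) f = 0 at hb
          rw [L_one, one_apply_eq_self] at hb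
          rw [← inner_conj_symm, inner_sub_left, ha, hb]
          simp
        · have h1 := hcon c hc f hf
          rw [inner_sub_right, ← inner_conj_symm, L_adj, inner_conj_symm]
          have h2 : L g⁻¹ f = f := by
            conv_lhs => rw [← h1]
            rw [← mul_apply_eq_comp, ← L_mul, inv_mul_cancel, L_one,
              one_apply_eq_self]
          rw [h2, sub_self]
      | zero => simp
      | add x y _ _ hx hy => rw [inner_add_left, hx, hy, add_zero]
    have hv : (v : G → ℂ) =ᵐ[μ] φ := ContinuousMap.coeFn_toLp (p := 2) (𝕜 := ℂ) μ φ
    have h3 : (L g v : G → ℂ) =ᵐ[μ] fun x => v (g⁻¹ • x) := DomMulAct.smul_Lp_ae_eq _ _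
    have h4 := (measurePreserving_smul g⁻¹ μ).quasiMeasurePreserving.ae_eq_comp hv
    have h5 : (fun x => φ (g⁻¹ * x)) =ᵐ[μ] φ := by
      refine Filter.EventuallyEq.trans ?_ hv
      rw [← hu1]
      exact (h3.trans h4).symm
    have h6 := (Continuous.ae_eq_iff_eq μ (by fun_prop) φ.continuous).1 h5
    have h7 := congrFun h6 1
    have h8 : ψ g⁻¹ = 1 := hψ1 rfl
    have h9 : ψ 1 = 0 := hψ0 rfl
    simp [φ, h8, h9] at h7
  obtain ⟨c, hc, f, hf, hfg⟩ := key
  have hfin : FiniteDimensional ℂ (Module.End.eigenspace (T : H →ₗ[ℂ] H) c) :=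
    T.finite_dimensional_eigenspace T_compact c hc
  set E := Module.End.eigenspace (T : H →ₗ[ℂ] H) c with hE
  have hinv : ∀ a, ∀ x ∈ E, (L a : H →ₗ[ℂ] H) x ∈ E := by
    intro a x hx
    rw [hE, Module.End.mem_eigenspace_iff] at hx ⊢
    change T (L a x) = c • L a x
    change T x = c • x at hx
    rw [T_comm, hx, map_smul]
  let R : G →* Module.End ℂ E :=
    { toFun := fun a => (L a : H →ₗ[ℂ] H).restrict (hinv a)
      map_one' := by ext x; simp [L_one]
      map_mul' := fun a b => by ext1 x; apply Subtype.ext; simp [L_mul] }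
  let b := Module.finBasis ℂ E
  let e := LinearMap.toMatrixAlgEquiv b
  let e' : Module.End ℂ E →* Matrix (Fin (Module.finrank ℂ E)) (Fin (Module.finrank ℂ E)) ℂ :=
    { toFun := e, map_one' := map_one e, map_mul' := map_mul e }
  refine ⟨Module.finrank ℂ E, e'.comp R, ?_, ?_⟩
  · refine continuous_matrix fun i j => ?_
    have h1 : ∀ a, (e'.comp R) a i j = b.coord i (R a (b j)) := by
      intro a
      simp [e', e, LinearMap.toMatrixAlgEquiv_apply]
    simp_rw [h1]
    refine (LinearMap.continuous_of_finiteDimensional (b.coord i)).comp ?_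
    exact Continuous.subtype_mk (L_cont (b j)) _
  · intro h
    have h1 : R g = 1 := by
      apply e.injective
      rw [map_one]
      exact h
    apply hfg
    have := congrArg Subtype.val (LinearMap.congr_fun h1 ⟨f, hf⟩)
    simpa [R] using this

end PeterWeyl

section ClosedSubgroup
open Filter

variable {A : Type*} [NormedRing A] [NormedAlgebra ℝ A] [FiniteDimensional ℝ A]

lemma nexp_continuous : Continuous (NormedSpace.exp : A → A) := by
  have : CompleteSpace A := FiniteDimensional.complete ℝ A
  let _ : NormedAlgebra ℚ A := NormedAlgebra.restrictScalars ℚ ℝ A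
  exact NormedSpace.exp_continuous

lemma nexp_add {x y : A} (h : Commute x y) :
    NormedSpace.exp (x + y) = NormedSpace.exp x * NormedSpace.exp y := by
  have : CompleteSpace A := FiniteDimensional.complete ℝ A
  let _ : NormedAlgebra ℚ A := NormedAlgebra.restrictScalars ℚ ℝ A
  exact NormedSpace.exp_add_of_commute h

lemma nexp_neg_mul (x : A) : NormedSpace.exp (-x) * NormedSpace.exp x = 1 := by
  rw [← nexp_add (Commute.refl x).neg_left]
  simp

lemma nexp_nsmul (n : ℕ) (x : A) : NormedSpace.exp (n • x) = NormedSpace.exp x ^ n := by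
  have : CompleteSpace A := FiniteDimensional.complete ℝ A
  let _ : NormedAlgebra ℚ A := NormedAlgebra.restrictScalars ℚ ℝ A
  exact NormedSpace.exp_nsmul n x

lemma nexp_conj {u v : A} (h : v * u = 1) (h' : u * v = 1) (x : A) :
    NormedSpace.exp (u * x * v) = u * NormedSpace.exp x * v := by
  have : CompleteSpace A := FiniteDimensional.complete ℝ A
  let _ : NormedAlgebra ℚ A := NormedAlgebra.restrictScalars ℚ ℝ A
  exact NormedSpace.exp_units_conj ⟨u, v, h', h⟩ x

lemma nexp_hasStrictFDerivAt_zero :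
    HasStrictFDerivAt (NormedSpace.exp : A → A)
      ((ContinuousLinearEquiv.refl ℝ A : A ≃L[ℝ] A) : A →L[ℝ] A) 0 := by
  have : CompleteSpace A := FiniteDimensional.complete ℝ A
  exact hasStrictFDerivAt_exp_zero (𝕂 := ℝ)

/-- A closed subset of a ring which is a group under multiplication. -/
structure IsClosedMulGroup (S : Set A) : Prop where
  isClosed : IsClosed S
  one_mem : (1 : A) ∈ S
  mul_mem : ∀ x ∈ S, ∀ y ∈ S, x * y ∈ S
  inv_mem : ∀ x ∈ S, ∃ y ∈ S, x * y = 1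

namespace IsClosedMulGroup

variable {S : Set A}

lemma exp_neg_mem (hS : IsClosedMulGroup S) {X : A} (hX : NormedSpace.exp X ∈ S) :
    NormedSpace.exp (-X) ∈ S := by
  obtain ⟨y, hy, h⟩ := hS.inv_mem _ hX
  have : y = NormedSpace.exp (-X) := by
    calc y = NormedSpace.exp (-X) * (NormedSpace.exp X * y) := by
          rw [← mul_assoc, nexp_neg_mul, one_mul]
      _ = NormedSpace.exp (-X) := by rw [h, mul_one]
  rwa [← this]

lemma exp_nsmul_mem (hS : IsClosedMulGroup S) {X : A} (hX : NormedSpace.exp X ∈ S) (n : ℕ) :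
    NormedSpace.exp (n • X) ∈ S := by
  rw [nexp_nsmul]
  induction n with
  | zero => simpa using hS.one_mem
  | succ k ih => rw [pow_succ]; exact hS.mul_mem _ ih _ hX

lemma exp_intCast_smul_mem (hS : IsClosedMulGroup S) {X : A} (hX : NormedSpace.exp X ∈ S)
    (m : ℤ) : NormedSpace.exp ((m : ℝ) • X) ∈ S := by
  obtain ⟨n, rfl | rfl⟩ := m.eq_nat_or_neg
  · have := hS.exp_nsmul_mem hX n
    simpa [← Nat.cast_smul_eq_nsmul ℝ] using this
  · have := hS.exp_neg_mem (hS.exp_nsmul_mem hX n)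
    simpa [← Nat.cast_smul_eq_nsmul ℝ] using this

/-- Limits of rescaled small logarithms of elements of `S` generate one-parameter groups in `S`. -/
lemma exp_smul_mem_of_tendsto (hS : IsClosedMulGroup S) {ι : Type*} {l : Filter ι} [l.NeBot]
    {Y : ι → A} {r : ι → ℝ} {X : A} (hY : Tendsto Y l (𝓝 0)) (hmem : ∀ᶠ n in l,
      NormedSpace.exp (Y n) ∈ S) (hX : Tendsto (fun n => r n • Y n) l (𝓝 X)) (t : ℝ) :
    NormedSpace.exp (t • X) ∈ S := by
  have h1 : Tendsto (fun n => ((⌊t * r n⌋ : ℤ) : ℝ) • Y n) l (𝓝 (t • X)) := by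
    have h2 : Tendsto (fun n => t • (r n • Y n)) l (𝓝 (t • X)) := hX.const_smul t
    have h3 : Tendsto (fun n => (Int.fract (t * r n)) • Y n) l (𝓝 0) := by
      refine squeeze_zero_norm (fun n => ?_) (tendsto_norm_zero.comp hY)
      rw [norm_smul]
      refine mul_le_of_le_one_left (norm_nonneg _) ?_
      rw [Real.norm_eq_abs, abs_of_nonneg (Int.fract_nonneg _)]
      exact (Int.fract_lt_one _).le
    have h4 := h2.sub h3
    rw [sub_zero] at h4
    refine h4.congr fun n => ?_
    rw [smul_smul, ← sub_smul, Int.self_sub_fract]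
  refine hS.isClosed.mem_of_tendsto ((nexp_continuous.tendsto _).comp h1) ?_
  filter_upwards [hmem] with n hn
  exact hS.exp_intCast_smul_mem hn _

/-- The derivative at `0` of a curve in the group is in the Lie algebra. -/
lemma exp_smul_mem_of_hasDerivAt (hS : IsClosedMulGroup S) {f : ℝ → A} {Z : A}
    (hfS : ∀ s, f s ∈ S) (hf0 : f 0 = 1) (hf : HasDerivAt f Z 0) (t : ℝ) :
    NormedSpace.exp (t • Z) ∈ S := by
  have : CompleteSpace A := FiniteDimensional.complete ℝ A
  have he := nexp_hasStrictFDerivAt_zero (A := A)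
  set lg := he.localInverse _ _ _ with hlg
  have hl : HasFDerivAt lg
      (((ContinuousLinearEquiv.refl ℝ A : A ≃L[ℝ] A).symm : A ≃L[ℝ] A) : A →L[ℝ] A) 1 := by
    have := he.to_localInverse.hasFDerivAt
    rwa [NormedSpace.exp_zero] at this
  have hright : ∀ᶠ y in 𝓝 (1 : A), NormedSpace.exp (lg y) = y := by
    have := he.eventually_right_inverse
    rwa [NormedSpace.exp_zero] at this
  have hl1 : lg 1 = 0 := by
    have := he.localInverse_apply_image
    rwa [NormedSpace.exp_zero] at this
  have hh : HasDerivAt (fun s => lg (f s)) Z 0 := by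
    have hl' : HasFDerivAt lg
        (((ContinuousLinearEquiv.refl ℝ A : A ≃L[ℝ] A).symm : A ≃L[ℝ] A) : A →L[ℝ] A) (f 0) := by
      rwa [hf0]
    have : HasDerivAt (fun s => lg (f s)) _ 0 := hl'.comp_hasDerivAt (0 : ℝ) hf
    simpa using this
  have hh0 : lg (f 0) = 0 := by rw [hf0, hl1]
  have hslope := hasDerivAt_iff_tendsto_slope.1 hh
  have hseq : Tendsto (fun s : ℝ => s) (𝓝[≠] 0) (𝓝 0) := tendsto_nhdsWithin_of_tendsto_nhds
    tendsto_id
  refine hS.exp_smul_mem_of_tendsto (l := 𝓝[≠] (0 : ℝ)) (Y := fun s => lg (f s))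
    (r := fun s => s⁻¹) ?_ ?_ ?_ t
  · have := hh.continuousAt.tendsto
    rw [hh0] at this
    exact this.comp hseq
  · have h1 : Tendsto f (𝓝[≠] 0) (𝓝 1) := by
      have := hf.continuousAt.tendsto
      rw [hf0] at this
      exact this.comp hseq
    filter_upwards [h1.eventually hright] with s hs
    rw [hs]
    exact hfS s
  · refine hslope.congr fun s => ?_
    simp [slope, hh0]

lemma exp_smul_add_mem (hS : IsClosedMulGroup S) {X Y : A}
    (hX : ∀ t : ℝ, NormedSpace.exp (t • X) ∈ S) (hY : ∀ t : ℝ, NormedSpace.exp (t • Y) ∈ S)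
    (t : ℝ) : NormedSpace.exp (t • (X + Y)) ∈ S := by
  have : CompleteSpace A := FiniteDimensional.complete ℝ A
  let f : ℝ → A := fun s => NormedSpace.exp (s • X) * NormedSpace.exp (s • Y)
  have hf : HasDerivAt f (X + Y) 0 := by
    have h1 := hasDerivAt_exp_smul_const (𝕂 := ℝ) X (0 : ℝ)
    have h2 := hasDerivAt_exp_smul_const (𝕂 := ℝ) Y (0 : ℝ)
    have h3 : HasDerivAt f _ 0 := h1.mul h2
    simpa using h3
  have hf0 : f 0 = 1 := by simp [f]
  exact hS.exp_smul_mem_of_hasDerivAt (fun s => hS.mul_mem _ (hX s) _ (hY s)) hf0 hf t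

/-- The Lie algebra of a closed group. -/
def lieAlg (hS : IsClosedMulGroup S) : Submodule ℝ A where
  carrier := {X | ∀ t : ℝ, NormedSpace.exp (t • X) ∈ S}
  add_mem' := fun hX hY t => hS.exp_smul_add_mem hX hY t
  zero_mem' := fun t => by simpa using hS.one_mem
  smul_mem' := fun c X hX t => by rw [smul_smul]; exact hX _

lemma exp_mem (hS : IsClosedMulGroup S) {X : A} (hX : X ∈ hS.lieAlg) : NormedSpace.exp X ∈ S := by
  simpa using hX 1

/-- **Closed subgroup theorem**: the exponential maps small elements of the Lie algebra onto a
neighbourhood of the identity. -/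
theorem eventually_exists_exp_eq (hS : IsClosedMulGroup S) {O : Set A} (hO : O ∈ 𝓝 (0 : A)) :
    ∀ᶠ g in 𝓝 (1 : A), g ∈ S → ∃ X ∈ hS.lieAlg, X ∈ O ∧ NormedSpace.exp X = g := by
  have : CompleteSpace A := FiniteDimensional.complete ℝ A
  have : ProperSpace A := FiniteDimensional.proper ℝ A
  obtain ⟨C, hC⟩ := hS.lieAlg.exists_isCompl
  let e : (hS.lieAlg × C) ≃L[ℝ] A :=
    (Submodule.prodEquivOfIsCompl _ _ hC).toContinuousLinearEquiv
  let Φ : hS.lieAlg × C → A := fun p => NormedSpace.exp (p.1 : A) * NormedSpace.exp (p.2 : A)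
  have hΦ0 : Φ 0 = 1 := by simp [Φ]
  have hΦ : HasStrictFDerivAt Φ (e : (hS.lieAlg × C) →L[ℝ] A) 0 := by
    have he := nexp_hasStrictFDerivAt_zero (A := A)
    have h1 : HasStrictFDerivAt (fun p : hS.lieAlg × C => NormedSpace.exp (p.1 : A))
        ((ContinuousLinearEquiv.refl ℝ A : A →L[ℝ] A).comp
          (hS.lieAlg.subtypeL.comp (ContinuousLinearMap.fst ℝ hS.lieAlg C))) 0 :=
      HasStrictFDerivAt.comp (g := (NormedSpace.exp : A → A)) (0 : hS.lieAlg × C)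
        (f := fun p : hS.lieAlg × C => (p.1 : A)) (by simpa using he)
        (hS.lieAlg.subtypeL.comp (ContinuousLinearMap.fst ℝ hS.lieAlg C)).hasStrictFDerivAt
    have h2 : HasStrictFDerivAt (fun p : hS.lieAlg × C => NormedSpace.exp (p.2 : A))
        ((ContinuousLinearEquiv.refl ℝ A : A →L[ℝ] A).comp
          (C.subtypeL.comp (ContinuousLinearMap.snd ℝ hS.lieAlg C))) 0 :=
      HasStrictFDerivAt.comp (g := (NormedSpace.exp : A → A)) (0 : hS.lieAlg × C)
        (f := fun p : hS.lieAlg × C => (p.2 : A)) (by simpa using he)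
        (C.subtypeL.comp (ContinuousLinearMap.snd ℝ hS.lieAlg C)).hasStrictFDerivAt
    have h3 := h1.mul' h2
    refine h3.congr_fderiv ?_
    ext p <;> simp [e]
  have hcont : Tendsto (hΦ.localInverse _ _ _) (𝓝 1) (𝓝 0) := by
    have h := hΦ.localInverse_continuousAt.tendsto
    rwa [hΦ.localInverse_apply_image, hΦ0] at h
  have hright : ∀ᶠ y in 𝓝 (1 : A), Φ (hΦ.localInverse _ _ _ y) = y := by
    have := hΦ.eventually_right_inverse
    rwa [hΦ0] at this
  set lg := hΦ.localInverse _ _ _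
  by_contra hcon
  rw [Filter.not_eventually] at hcon
  obtain ⟨g, hg, hgcon⟩ := Filter.exists_seq_forall_of_frequently
    (p := fun g => ¬ (g ∈ S → ∃ X ∈ hS.lieAlg, X ∈ O ∧ NormedSpace.exp X = g)) hcon
  have hlg : Tendsto (fun n => lg (g n)) atTop (𝓝 0) := hcont.comp hg
  have hlg1 : Tendsto (fun n => ((lg (g n)).1 : A)) atTop (𝓝 0) := by
    have : Continuous fun p : hS.lieAlg × C => (p.1 : A) := by fun_prop
    exact (this.tendsto' 0 0 (by simp)).comp hlg
  have hlg2 : Tendsto (fun n => ((lg (g n)).2 : A)) atTop (𝓝 0) := by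
    have : Continuous fun p : hS.lieAlg × C => (p.2 : A) := by fun_prop
    exact (this.tendsto' 0 0 (by simp)).comp hlg
  have hgood : ∀ᶠ n in atTop, NormedSpace.exp ((lg (g n)).2 : A) ∈ S ∧ ((lg (g n)).2 : A) ≠ 0 := by
    filter_upwards [hlg1.eventually hO, hg.eventually hright] with n h1 h2
    have h3 := hgcon n
    push Not at h3
    obtain ⟨h3, h4⟩ := h3
    refine ⟨?_, fun h0 => ?_⟩
    · have h5 : NormedSpace.exp ((lg (g n)).2 : A) =
          NormedSpace.exp (-((lg (g n)).1 : A)) * g n := by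
        have h6 : g n =
            NormedSpace.exp ((lg (g n)).1 : A) * NormedSpace.exp ((lg (g n)).2 : A) := h2.symm
        nth_rw 3 [h6]
        rw [← mul_assoc, nexp_neg_mul, one_mul]
      rw [h5]
      exact hS.mul_mem _ (hS.exp_mem (neg_mem (lg (g n)).1.2)) _ h3
    · apply h4 _ (lg (g n)).1.2 h1
      have h6 : NormedSpace.exp ((lg (g n)).1 : A) * NormedSpace.exp ((lg (g n)).2 : A) = g n := h2
      rwa [h0, NormedSpace.exp_zero, mul_one] at h6
  obtain ⟨N, hN⟩ := eventually_atTop.1 hgood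
  let Y : ℕ → A := fun n => ((lg (g (n + N))).2 : A)
  have hY0 : Tendsto Y atTop (𝓝 0) := hlg2.comp (tendsto_add_atTop_nat N)
  have hY : ∀ n, NormedSpace.exp (Y n) ∈ S ∧ Y n ≠ 0 := fun n => hN _ (by omega)
  obtain ⟨Z, hZ, φ, hφ, hlim⟩ := (isCompact_sphere (0 : A) 1).tendsto_subseq
    (x := fun n => ‖Y n‖⁻¹ • Y n) (fun n => by
      simp [norm_smul, inv_mul_cancel₀ (norm_ne_zero_iff.2 (hY n).2)])
  have hZL : Z ∈ hS.lieAlg := fun t => hS.exp_smul_mem_of_tendsto (l := atTop) (Y := Y ∘ φ)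
    (r := fun n => ‖Y (φ n)‖⁻¹) (hY0.comp hφ.tendsto_atTop)
    (Eventually.of_forall fun n => (hY _).1) hlim t
  have hZC : Z ∈ C := by
    refine (Submodule.closed_of_finiteDimensional C).mem_of_tendsto hlim
      (Eventually.of_forall fun n => ?_)
    exact C.smul_mem _ (lg (g (φ n + N))).2.2
  have hZ0 : Z = 0 := by
    have := hC.disjoint.le_bot ⟨hZL, hZC⟩
    simpa using this
  rw [hZ0] at hZ
  simp at hZ

end IsClosedMulGroup

end ClosedSubgroup

section PoincareMiranda

variable {ι : Type*} [DecidableEq ι]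

/-- The mod 2 cup product of the coboundaries of `s j, s (j + 1), …, s (j + n - 1)`, evaluated on
the cube with lowest vertex `x` and edge directions `U`. -/
def cupSum (s : ℕ → (ι → ℕ) → ZMod 2) : ℕ → ℕ → (ι → ℕ) → Finset ι → ZMod 2
  | 0, _, _, _ => 1
  | n + 1, j, x, U => ∑ u ∈ U, (s j x + s j (x + Pi.single u 1)) *
      cupSum s n (j + 1) (x + Pi.single u 1) (U.erase u)

lemma zmod_two_sum_offDiag (U : Finset ι) (f : ι → ι → ZMod 2) (hf : ∀ u w, f u w = f w u) :
    ∑ u ∈ U, ∑ w ∈ U.erase u, f u w = 0 := by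
  rw [Finset.sum_sigma']
  refine Finset.sum_involution (fun p _ => ⟨p.2, p.1⟩) ?_ ?_ ?_ ?_
  · rintro ⟨u, w⟩ _
    simp only [hf w u]
    exact CharTwo.add_self_eq_zero _
  · rintro ⟨u, w⟩ h _ h'
    simp only [Finset.mem_sigma, Finset.mem_erase] at h
    simp only [Sigma.mk.injEq, heq_eq_eq] at h'
    exact h.2.1 h'.1
  · rintro ⟨u, w⟩ h
    simp only [Finset.mem_sigma, Finset.mem_erase] at h ⊢
    exact ⟨h.2.2, Ne.symm h.2.1, h.1⟩
  · rintro ⟨u, w⟩ _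
    rfl

lemma sum_erase_erase_comm (U : Finset ι) (f : ι → ι → ZMod 2) :
    ∑ u ∈ U, ∑ w ∈ U.erase u, f u w = ∑ w ∈ U, ∑ u ∈ U.erase w, f u w := by
  refine Finset.sum_comm' fun u w => ?_
  simp only [Finset.mem_erase, ne_eq]
  tauto

lemma cupSum_cocycle (s : ℕ → (ι → ℕ) → ZMod 2) (n : ℕ) : ∀ (j : ℕ) (x : ι → ℕ) (U : Finset ι),
    U.card = n + 1 → ∑ u ∈ U, cupSum s n j (x + Pi.single u 1) (U.erase u) =
      ∑ u ∈ U, cupSum s n j x (U.erase u) := by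
  induction n with
  | zero => intro j x U _; simp [cupSum]
  | succ n ih =>
    intro j x U hU
    simp only [cupSum]
    set C : ι → ι → ZMod 2 := fun u w =>
      cupSum s n (j + 1) (x + Pi.single u 1 + Pi.single w 1) ((U.erase u).erase w) with hC
    have hCs : ∀ u w, C u w = C w u := fun u w => by
      simp only [hC]
      rw [add_right_comm, Finset.erase_right_comm]
    have hL : ∑ u ∈ U, ∑ w ∈ U.erase u, (s j (x + Pi.single u 1) +
        s j (x + Pi.single u 1 + Pi.single w 1)) * C u w =
        ∑ u ∈ U, ∑ w ∈ U.erase u, s j (x + Pi.single u 1) * C u w := by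
      simp only [add_mul, Finset.sum_add_distrib]
      have h0 := zmod_two_sum_offDiag U
        (fun u w => s j (x + Pi.single u 1 + Pi.single w 1) * C u w)
        (fun u w => by rw [hCs u w, add_right_comm])
      exact (congrArg _ h0).trans (add_zero _)
    refine hL.trans ?_
    refine Eq.trans ?_ (sum_erase_erase_comm U (fun u w => (s j x + s j (x + Pi.single w 1)) *
      cupSum s n (j + 1) (x + Pi.single w 1) ((U.erase u).erase w))).symm
    have hR : ∀ w ∈ U, ∑ u ∈ U.erase w, (s j x + s j (x + Pi.single w 1)) *
        cupSum s n (j + 1) (x + Pi.single w 1) ((U.erase u).erase w) =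
        ∑ u ∈ U.erase w, (s j x + s j (x + Pi.single w 1)) * C w u := by
      intro w hw
      rw [← Finset.mul_sum, ← Finset.mul_sum]
      congr 1
      have := ih (j + 1) (x + Pi.single w 1) (U.erase w) (by
        rw [Finset.card_erase_of_mem hw, hU]; rfl)
      rw [hC]
      refine Eq.trans ?_ this.symm
      exact Finset.sum_congr rfl fun u _ => by rw [Finset.erase_right_comm]
    rw [Finset.sum_congr rfl hR]
    simp only [add_mul, Finset.sum_add_distrib]
    have h0 := zmod_two_sum_offDiag U (fun w u => s j x * C w u) (fun u w => by rw [hCs u w])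
    exact ((congrArg (· + _) h0).trans (zero_add _)).symm

lemma cupSum_succ (s : ℕ → (ι → ℕ) → ZMod 2) (n j : ℕ) (x : ι → ℕ) (U : Finset ι)
    (hU : U.card = n + 1) : cupSum s (n + 1) j x U =
      ∑ u ∈ U, (s j (x + Pi.single u 1) * cupSum s n (j + 1) (x + Pi.single u 1) (U.erase u) +
        s j x * cupSum s n (j + 1) x (U.erase u)) := by
  simp only [cupSum, add_mul, Finset.sum_add_distrib, ← Finset.mul_sum]
  rw [cupSum_cocycle s n (j + 1) x U hU, add_comm]

lemma cupSum_eq_zero (s : ℕ → (ι → ℕ) → ZMod 2) (n : ℕ) : ∀ (j : ℕ) (x : ι → ℕ) (U : Finset ι)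
    (i : ℕ) (c : ZMod 2), j ≤ i → i < j + n →
    (∀ y : ι → ℕ, (∀ w ∉ U, y w = x w) → s i y = c) → cupSum s n j x U = 0 := by
  induction n with
  | zero => intro j x U i c h1 h2; omega
  | succ n ih =>
    intro j x U i c h1 h2 h
    refine Finset.sum_eq_zero fun u hu => ?_
    rcases h1.eq_or_lt with rfl | h1
    · rw [h x (fun _ _ => rfl), h (x + Pi.single u 1), CharTwo.add_self_eq_zero, zero_mul]
      intro w hw
      have : w ≠ u := fun h => hw (h ▸ hu)
      simp [this]
    · rw [ih (j + 1) _ _ i c (by omega) (by omega), mul_zero]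
      intro y hy
      refine h y fun w hw => ?_
      have : w ≠ u := fun h => hw (h ▸ hu)
      rw [hy w (by simp [hw])]
      simp [this]

/-- A nonzero `cupSum` is witnessed by a monotone chain of vertices. -/
lemma exists_of_cupSum_ne_zero (s : ℕ → (ι → ℕ) → ZMod 2) (n : ℕ) : ∀ (j : ℕ) (x : ι → ℕ)
    (U : Finset ι), cupSum s n j x U ≠ 0 → ∀ i, j ≤ i → i < j + n →
    ∃ y z : ι → ℕ, (∀ w, x w ≤ y w ∧ y w ≤ x w + if w ∈ U then 1 else 0) ∧
      (∀ w, x w ≤ z w ∧ z w ≤ x w + if w ∈ U then 1 else 0) ∧ s i y ≠ s i z := by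
  induction n with
  | zero => intro j x U _ i h1 h2; omega
  | succ n ih =>
    intro j x U h i h1 h2
    obtain ⟨u, hu, hne⟩ := Finset.exists_ne_zero_of_sum_ne_zero h
    rcases h1.eq_or_lt with rfl | h1
    · refine ⟨x, x + Pi.single u 1, fun w => ⟨le_rfl, by omega⟩, fun w => ?_, fun he => ?_⟩
      · by_cases hw : w = u
        · subst hw; simp [hu]
        · simp [hw]
      · apply left_ne_zero_of_mul hne
        rw [← he, CharTwo.add_self_eq_zero]
    · obtain ⟨y, z, hy, hz, hyz⟩ := ih (j + 1) _ _ (right_ne_zero_of_mul hne) i (by omega)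
        (by omega)
      have key : ∀ y : ι → ℕ, (∀ w, (x + Pi.single u 1 : ι → ℕ) w ≤ y w ∧
          y w ≤ (x + Pi.single u 1 : ι → ℕ) w + if w ∈ U.erase u then 1 else 0) →
          ∀ w, x w ≤ y w ∧ y w ≤ x w + if w ∈ U then 1 else 0 := by
        intro y hy w
        have := hy w
        by_cases hw : w = u
        · subst hw; simp at this; simp [hu]; omega
        · simp [hw] at this; exact this
      exact ⟨y, z, key y hy, key z hz, hyz⟩

end PoincareMiranda

section Box

variable {d : ℕ}

/-- The box of lowest vertices: the first `j` coordinates are `k`, the others are `< k`. -/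
def gridBox (d k j : ℕ) : Finset (Fin d → ℕ) :=
  Fintype.piFinset fun i => if (i : ℕ) < j then {k} else Finset.range k

/-- The directions `≥ j`. -/
def dirGE (d j : ℕ) : Finset (Fin d) := Finset.univ.filter fun i => j ≤ (i : ℕ)

lemma mem_gridBox {k j : ℕ} {x : Fin d → ℕ} :
    x ∈ gridBox d k j ↔ ∀ i : Fin d, ((i : ℕ) < j → x i = k) ∧ (j ≤ (i : ℕ) → x i < k) := by
  simp only [gridBox, Fintype.mem_piFinset]
  refine forall_congr' fun i => ?_
  split_ifs with h
  · simp [h]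
  · simp [h, not_lt.1 h]

lemma sum_piFinset_update_union (t : Fin d → Finset ℕ) (u : Fin d) {a b : Finset ℕ}
    (hab : Disjoint a b) (f : (Fin d → ℕ) → ZMod 2) :
    ∑ x ∈ Fintype.piFinset (Function.update t u (a ∪ b)), f x =
      ∑ x ∈ Fintype.piFinset (Function.update t u a), f x +
      ∑ x ∈ Fintype.piFinset (Function.update t u b), f x := by
  have hmem : ∀ (c : Finset ℕ) (x : Fin d → ℕ), x ∈ Fintype.piFinset (Function.update t u c) ↔
      x u ∈ c ∧ ∀ i, i ≠ u → x i ∈ t i := by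
    intro c x
    rw [Fintype.mem_piFinset]
    constructor
    · intro h
      refine ⟨by simpa using h u, fun i hi => by simpa [hi] using h i⟩
    · rintro ⟨h1, h2⟩ i
      by_cases hi : i = u
      · subst hi; simpa using h1
      · simpa [hi] using h2 i hi
  rw [← Finset.sum_union]
  · congr 1
    ext x
    simp only [Finset.mem_union, hmem]
    tauto
  · rw [Finset.disjoint_left]
    intro x hx hx'
    rw [hmem] at hx hx'
    exact Finset.disjoint_left.1 hab hx.1 hx'.1

lemma sum_shift_add_sum (k : ℕ) (t : Fin d → Finset ℕ) (u : Fin d) (hu : t u = Finset.range k)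
    (f : (Fin d → ℕ) → ZMod 2) :
    ∑ x ∈ Fintype.piFinset t, (f (x + Pi.single u 1) + f x) =
      ∑ x ∈ Fintype.piFinset (Function.update t u {k}), f x +
      ∑ x ∈ Fintype.piFinset (Function.update t u {0}), f x := by
  have h1 : ∑ x ∈ Fintype.piFinset t, f (x + Pi.single u 1) =
      ∑ x ∈ Fintype.piFinset (Function.update t u (Finset.Ico 1 (k + 1))), f x := by
    refine Finset.sum_nbij' (fun x => x + Pi.single u 1) (fun x => x - Pi.single u 1) ?_ ?_ ?_ ?_ ?_
    · intro x hx
      rw [Fintype.mem_piFinset] at hx ⊢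
      intro i
      have := hx i
      by_cases hi : i = u
      · subst hi
        rw [hu] at this
        simp at this ⊢
        omega
      · simpa [hi] using this
    · intro x hx
      rw [Fintype.mem_piFinset] at hx ⊢
      intro i
      have := hx i
      by_cases hi : i = u
      · subst hi
        rw [hu]
        simp at this ⊢
        omega
      · simpa [hi] using this
    · intro x _
      exact add_tsub_cancel_right _ _
    · intro x hx
      rw [Fintype.mem_piFinset] at hx
      refine tsub_add_cancel_of_le fun i => ?_
      have := hx i
      by_cases hi : i = u
      · subst hi
        simp at this ⊢
        omega
      · simp [hi]
    · intro x _
      rfl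
  have h2 := sum_piFinset_update_union t u (a := Finset.range k) (b := {k}) (by simp) f
  have h3 := sum_piFinset_update_union t u (a := Finset.Ico 1 (k + 1)) (b := {0}) (by simp) f
  have h4 : Finset.range k ∪ {k} = Finset.Ico 1 (k + 1) ∪ {0} := by
    ext i
    simp
    omega
  rw [h4, h3, ← hu, Function.update_eq_self] at h2
  rw [Finset.sum_add_distrib, h1]
  generalize ∑ x ∈ Fintype.piFinset t, f x = p at *
  generalize ∑ x ∈ Fintype.piFinset (Function.update t u {k}), f x = q at *
  generalize ∑ x ∈ Fintype.piFinset (Function.update t u {0}), f x = r at *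
  generalize ∑ x ∈ Fintype.piFinset (Function.update t u (Finset.Ico 1 (k + 1))), f x = v at *
  revert h2
  clear * -
  revert p q r v
  decide

lemma sum_cupSum_gridBox (k : ℕ) (s : ℕ → (Fin d → ℕ) → ZMod 2)
    (h0 : ∀ (i : Fin d) x, x i = 0 → s i x = 0) (h1 : ∀ (i : Fin d) x, x i = k → s i x = 1)
    (n : ℕ) : ∀ j, j + n = d → ∑ x ∈ gridBox d k j, cupSum s n j x (dirGE d j) = 1 := by
  induction n with
  | zero =>
    intro j hj
    have : gridBox d k j = {fun _ => k} := by
      ext x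
      simp only [mem_gridBox, Finset.mem_singleton, funext_iff]
      refine forall_congr' fun i => ?_
      have := i.2
      constructor
      · intro h; exact h.1 (by omega)
      · intro h; exact ⟨fun _ => h, fun h' => by omega⟩
    rw [this]
    simp [cupSum]
  | succ n ih =>
    intro j hj
    have hcard : (dirGE d j).card = n + 1 := by
      have : (dirGE d j) = Finset.Ici (⟨j, by omega⟩ : Fin d) := by
        ext i; simp [dirGE, Fin.le_def]
      rw [this, Fin.card_Ici]
      simp
      omega
    rw [Finset.sum_congr rfl fun x _ => cupSum_succ s n j x (dirGE d j) hcard, Finset.sum_comm]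
    let J : Fin d := ⟨j, by omega⟩
    have hJ : J ∈ dirGE d j := by simp [dirGE, J]
    have hmem : ∀ (u : Fin d) (c : ℕ) (x : Fin d → ℕ),
        x ∈ Fintype.piFinset (Function.update
        (fun i : Fin d => if (i : ℕ) < j then {k} else Finset.range k) u {c}) → x u = c := by
      intro u c x hx
      have := (Fintype.mem_piFinset.1 hx) u
      simpa using this
    have hstep : ∀ u ∈ dirGE d j, ∑ x ∈ gridBox d k j, (s j (x + Pi.single u 1) *
        cupSum s n (j + 1) (x + Pi.single u 1) ((dirGE d j).erase u) +
        s j x * cupSum s n (j + 1) x ((dirGE d j).erase u)) = if u = J then 1 else 0 := by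
      intro u hu
      have hu' : j ≤ (u : ℕ) := by simpa [dirGE] using hu
      have := sum_shift_add_sum k (fun i : Fin d => if (i : ℕ) < j then {k} else Finset.range k) u
        (by simp [not_lt.2 hu']) (fun x => s j x * cupSum s n (j + 1) x ((dirGE d j).erase u))
      refine this.trans ?_
      split_ifs with huJ
      · subst huJ
        rw [Finset.sum_eq_zero (s := Fintype.piFinset (Function.update _ J {0})), add_zero]
        · rw [← ih (j + 1) (by omega)]
          have hb : Fintype.piFinset (Function.update
              (fun i : Fin d => if (i : ℕ) < j then {k} else Finset.range k) J {k}) =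
              gridBox d k (j + 1) := by
            unfold gridBox
            congr 1
            funext i
            by_cases hi : i = J
            · subst hi; simp [J]
            · have : (i : ℕ) ≠ j := fun h => hi (Fin.ext h)
              have h3 : (i : ℕ) < j ↔ (i : ℕ) < j + 1 := by omega
              simp [hi, h3]
          have hd : (dirGE d j).erase J = dirGE d (j + 1) := by
            ext i
            simp [dirGE, J, Fin.ext_iff]
            omega
          rw [hb, hd]
          refine Finset.sum_congr rfl fun x hx => ?_
          rw [h1 J x ((mem_gridBox.1 hx J).1 (by simp [J])), one_mul]
        · intro x hx
          rw [h0 J x (hmem _ _ _ hx), zero_mul]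
      · have huj : j < (u : ℕ) := lt_of_le_of_ne hu' fun h => huJ (Fin.ext h.symm)
        have hz : ∀ (c : ℕ) (b : ZMod 2), (∀ y : Fin d → ℕ, y u = c → s u y = b) →
            ∑ x ∈ Fintype.piFinset (Function.update
            (fun i : Fin d => if (i : ℕ) < j then {k} else Finset.range k) u {c}),
            s j x * cupSum s n (j + 1) x ((dirGE d j).erase u) = 0 := by
          intro c b hb
          refine Finset.sum_eq_zero fun x hx => ?_
          rw [cupSum_eq_zero s n (j + 1) x _ u b (by omega) (by have := u.2; omega), mul_zero]
          intro y hy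
          refine hb y ?_
          rw [hy u (by simp), hmem _ _ _ hx]
        rw [hz k 1 (h1 u), hz 0 0 (h0 u), add_zero]
    rw [Finset.sum_congr rfl hstep]
    simp [hJ]

/-- Discrete Poincaré–Miranda theorem. -/
lemma exists_grid_cell (k : ℕ) (s : Fin d → (Fin d → ℕ) → Prop)
    (h0 : ∀ (i : Fin d) x, x i = 0 → ¬ s i x) (h1 : ∀ (i : Fin d) x, x i = k → s i x) :
    ∃ x : Fin d → ℕ, (∀ i, x i < k) ∧ ∀ i : Fin d, ∃ y z : Fin d → ℕ,
      (∀ w, x w ≤ y w ∧ y w ≤ x w + 1) ∧ (∀ w, x w ≤ z w ∧ z w ≤ x w + 1) ∧ s i y ∧ ¬ s i z := by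
  classical
  let S : ℕ → (Fin d → ℕ) → ZMod 2 := fun i x =>
    if h : i < d then (if s ⟨i, h⟩ x then 1 else 0) else 0
  have hS : ∀ (i : Fin d) x, S i x = if s i x then 1 else 0 := fun i x => by simp [S]
  have h := sum_cupSum_gridBox k S (fun i x hx => by simp [hS, h0 i x hx])
    (fun i x hx => by simp [hS, h1 i x hx]) d 0 (by simp)
  obtain ⟨x, hx, hne⟩ := Finset.exists_ne_zero_of_sum_ne_zero (h.trans_ne one_ne_zero)
  refine ⟨x, fun i => (mem_gridBox.1 hx i).2 (Nat.zero_le _), fun i => ?_⟩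
  obtain ⟨y, z, hy, hz, hyz⟩ := exists_of_cupSum_ne_zero S d 0 x _ hne i (Nat.zero_le _)
    (by simp)
  have hy' : ∀ w, x w ≤ y w ∧ y w ≤ x w + 1 := fun w => by simpa [dirGE] using hy w
  have hz' : ∀ w, x w ≤ z w ∧ z w ≤ x w + 1 := fun w => by simpa [dirGE] using hz w
  rw [hS, hS] at hyz
  by_cases hsy : s i y
  · refine ⟨y, z, hy', hz', hsy, fun hsz => hyz (by simp [hsy, hsz])⟩
  · refine ⟨z, y, hz', hy', by_contra fun hsz => hyz (by simp [hsy, hsz]), hsy⟩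

end Box

section Dimension
open Set

/-- **Poincaré–Miranda theorem**, in the form of a covering statement. -/
theorem exists_not_mem_cover {d : ℕ} (M P : Fin d → Set (Icc (0 : Fin d → ℝ) 1))
    (hM : ∀ i, IsClosed (M i)) (hP : ∀ i, IsClosed (P i)) (hMP : ∀ i, Disjoint (M i) (P i))
    (hMF : ∀ i, ∀ x ∈ M i, (x : Fin d → ℝ) i ≠ 1) (hPF : ∀ i, ∀ x ∈ P i, (x : Fin d → ℝ) i ≠ 0) :
    ∃ x, ∀ i, x ∉ M i ∧ x ∉ P i := by
  by_contra! hcov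
  have hval : ∀ i : Fin d, Continuous fun x : Icc (0 : Fin d → ℝ) 1 => (x : Fin d → ℝ) i :=
    fun i => (continuous_apply i).comp continuous_subtype_val
  have hU : ∀ i, ∃ g : C(Icc (0 : Fin d → ℝ) 1, ℝ),
      EqOn g 0 (M i ∪ {x | (x : Fin d → ℝ) i = 0}) ∧
      EqOn g 1 (P i ∪ {x | (x : Fin d → ℝ) i = 1}) := by
    intro i
    obtain ⟨g, h0, h1, -⟩ := exists_continuous_zero_one_of_isClosed
      ((hM i).union (isClosed_eq (hval i) continuous_const))
      ((hP i).union (isClosed_eq (hval i) (continuous_const (y := (1 : ℝ))))) (by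
        rw [Set.disjoint_left]
        rintro x (hx | hx) (hx' | hx')
        · exact Set.disjoint_left.1 (hMP i) hx hx'
        · exact hMF i x hx hx'
        · exact hPF i x hx' hx
        · simp only [mem_ofPred_eq] at hx hx'
          linarith)
    exact ⟨g, h0, h1⟩
  choose g hg0 hg1 using hU
  have huc : UniformContinuous fun x i => g i x :=
    CompactSpace.uniformContinuous_of_continuous (continuous_pi fun i => (g i).continuous)
  obtain ⟨δ, hδ, hδg⟩ := Metric.uniformContinuous_iff.1 huc (1 / 2) (by norm_num)
  obtain ⟨k, hk⟩ := exists_nat_one_div_lt hδ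
  have hk0 : (0 : ℝ) < k + 1 := by positivity
  let pt : (Fin d → ℕ) → Icc (0 : Fin d → ℝ) 1 := fun v =>
    ⟨fun i => min ((v i : ℝ) / (k + 1)) 1, fun i => by simp; positivity, fun i => by simp⟩
  obtain ⟨v, -, hv⟩ := exists_grid_cell (k + 1) (fun i v => 1 / 2 < g i (pt v))
    (fun i x hx => by
      have : pt x ∈ {x : Icc (0 : Fin d → ℝ) 1 | (x : Fin d → ℝ) i = 0} := by simp [pt, hx]
      rw [hg0 i (Or.inr this)]
      norm_num)
    (fun i x hx => by
      have : pt x ∈ {x : Icc (0 : Fin d → ℝ) 1 | (x : Fin d → ℝ) i = 1} := by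
        simp [pt, hx, div_self hk0.ne']
      rw [hg1 i (Or.inr this)]
      norm_num)
  have hclose : ∀ y : Fin d → ℕ, (∀ w, v w ≤ y w ∧ y w ≤ v w + 1) → ∀ i,
      |g i (pt y) - g i (pt v)| < 1 / 2 := by
    intro y hy i
    have h1 : dist (pt y) (pt v) < δ := by
      rw [Subtype.dist_eq, dist_pi_lt_iff hδ]
      intro w
      refine lt_of_le_of_lt ?_ hk
      rw [Real.dist_eq]
      refine (abs_min_sub_min_le_max _ _ _ _).trans ?_
      rw [sub_self, abs_zero, ← sub_div, abs_div, abs_of_pos hk0]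
      refine max_le (div_le_div_of_nonneg_right ?_ hk0.le) (by positivity)
      have h2 : (v w : ℝ) ≤ y w := by exact_mod_cast (hy w).1
      have h3 : (y w : ℝ) ≤ v w + 1 := by exact_mod_cast (hy w).2
      rw [abs_le]
      constructor <;> linarith
    have h2 := hδg h1
    rw [dist_pi_lt_iff (by norm_num)] at h2
    simpa [Real.dist_eq] using h2 i
  obtain ⟨i, hi⟩ := hcov (pt v)
  obtain ⟨y, z, hy, hz, hgy, hgz⟩ := hv i
  by_cases hm : pt v ∈ M i
  · have h := hclose y hy i
    rw [hg0 i (Or.inl hm)] at h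
    have := (abs_lt.1 h).2
    simp at this hgy
    linarith
  · have h := hclose z hz i
    rw [hg1 i (Or.inl (hi hm))] at h
    have := (abs_lt.1 h).1
    simp at this hgz
    linarith

/-- Floor vector map used for a covering of `ℝⁿ` by `n + 1` families of disjoint cubes. -/
lemma isClosed_floor_mem {X : Type*} [TopologicalSpace X] {n : ℕ} {h : X → Fin n → ℝ}
    (hh : Continuous h) {ε : ℝ} (hε : 0 < ε) (Q : Set (Fin n → ℤ)) :
    IsClosed {x | (∀ a, ε ≤ Int.fract (h x a) ∧ Int.fract (h x a) ≤ 1 - ε) ∧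
      (fun a => ⌊h x a⌋) ∈ Q} := by
  rw [← isOpen_compl_iff, isOpen_iff_mem_nhds]
  intro x hx
  have hc : ∀ a, ContinuousAt (fun y => h y a) x := fun a =>
    ((continuous_apply a).comp hh).continuousAt
  by_cases hxA : ∀ a, 0 < Int.fract (h x a)
  · have hfl : ∀ a, ∀ᶠ y in 𝓝 x, ⌊h y a⌋ = ⌊h x a⌋ := by
      intro a
      have h1 : (⌊h x a⌋ : ℝ) < h x a := by
        have := hxA a
        rw [← Int.self_sub_floor] at this
        linarith
      filter_upwards [(hc a).eventually (Ioo_mem_nhds h1 (Int.lt_floor_add_one _))] with y hy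
      exact Int.floor_eq_iff.2 ⟨hy.1.le, hy.2⟩
    have hall := Filter.eventually_all.2 hfl
    by_cases hxB : ∀ a, ε ≤ Int.fract (h x a) ∧ Int.fract (h x a) ≤ 1 - ε
    · filter_upwards [hall] with y hy hy'
      apply hx
      refine ⟨hxB, ?_⟩
      have : (fun a => ⌊h x a⌋) = fun a => ⌊h y a⌋ := funext fun a => (hy a).symm
      rw [this]
      exact hy'.2
    · push Not at hxB
      obtain ⟨a, ha⟩ := hxB
      have hfr : ContinuousAt (fun y => h y a - ⌊h x a⌋) x := (hc a).sub continuousAt_const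
      by_cases h2 : ε ≤ Int.fract (h x a)
      · have h3 := ha h2
        rw [← Int.self_sub_floor] at h3
        filter_upwards [hfr.eventually (lt_mem_nhds h3), hall] with y hy hy2 hy3
        have := (hy3.1 a).2
        rw [← Int.self_sub_floor, hy2 a] at this
        linarith
      · push Not at h2
        rw [← Int.self_sub_floor] at h2
        filter_upwards [hfr.eventually (gt_mem_nhds h2), hall] with y hy hy2 hy3
        have := (hy3.1 a).1
        rw [← Int.self_sub_floor, hy2 a] at this
        linarith
  · push Not at hxA
    obtain ⟨a, ha⟩ := hxA
    have h0 : h x a = ⌊h x a⌋ := by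
      have := le_antisymm ha (Int.fract_nonneg _)
      rw [← Int.self_sub_floor] at this
      linarith
    have hfr : ContinuousAt (fun y => h y a - ⌊h x a⌋) x := (hc a).sub continuousAt_const
    have h1 : h x a - ⌊h x a⌋ ∈ Ioo (-ε) ε := by
      rw [← h0]; simp [hε]
    filter_upwards [hfr.eventually (Ioo_mem_nhds h1.1 h1.2)] with y hy hy2
    obtain ⟨h3, h4⟩ := hy2.1 a
    have h5 : Int.fract (h y a) = Int.fract (h y a - ⌊h x a⌋) := (Int.fract_sub_intCast _ _).symm
    rcases le_or_gt 0 (h y a - ⌊h x a⌋) with h6 | h6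
    · have h7 : Int.fract (h y a - ⌊h x a⌋) ≤ h y a - ⌊h x a⌋ := by
        have : (0 : ℝ) ≤ ⌊h y a - ⌊h x a⌋⌋ := by exact_mod_cast Int.floor_nonneg.2 h6
        rw [← Int.self_sub_floor]
        linarith
      have := hy.2
      linarith
    · have h7 : h y a - ⌊h x a⌋ + 1 ≤ Int.fract (h y a - ⌊h x a⌋) := by
        have : (⌊h y a - ⌊h x a⌋⌋ : ℝ) ≤ -1 := by
          have : ⌊h y a - ⌊h x a⌋⌋ < 0 := Int.floor_lt.2 (by simpa using h6)
          exact_mod_cast Int.le_sub_one_of_lt this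
        rw [← Int.self_sub_floor (h y a - ⌊h x a⌋)]
        linarith
      have := hy.1
      linarith

/-- There is no continuous injection of the `(n + 1)`-cube into `ℝⁿ`. -/
theorem not_injective_of_continuous_cube {n : ℕ} (f : Icc (0 : Fin (n + 1) → ℝ) 1 → Fin n → ℝ)
    (hf : Continuous f) : ¬ Function.Injective f := by
  intro hinj
  obtain ⟨r, hr, hfar⟩ : ∃ r : ℝ, 0 < r ∧ ∀ x z : Icc (0 : Fin (n + 1) → ℝ) 1,
      1 ≤ dist x z → r ≤ dist (f x) (f z) := by
    have hK : IsCompact {p : Icc (0 : Fin (n + 1) → ℝ) 1 × Icc (0 : Fin (n + 1) → ℝ) 1 |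
        1 ≤ dist p.1 p.2} :=
      (isClosed_le continuous_const (by fun_prop)).isCompact
    rcases Set.eq_empty_or_nonempty {p : Icc (0 : Fin (n + 1) → ℝ) 1 × Icc (0 : Fin (n + 1) → ℝ) 1 |
        1 ≤ dist p.1 p.2} with he | hne
    · refine ⟨1, one_pos, fun x z h => ?_⟩
      have h' : (x, z) ∈ {p : Icc (0 : Fin (n + 1) → ℝ) 1 × Icc (0 : Fin (n + 1) → ℝ) 1 |
        1 ≤ dist p.1 p.2} := h
      rw [he] at h'
      exact h'.elim
    · obtain ⟨p, hp, hmin⟩ := hK.exists_isMinOn hne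
        (f := fun p => dist (f p.1) (f p.2)) (by fun_prop)
      refine ⟨dist (f p.1) (f p.2), dist_pos.2 fun h => ?_, fun x z h =>
        isMinOn_iff.1 hmin (x, z) h⟩
      have := hinj h
      simp only [mem_ofPred_eq, this, dist_self] at hp
      linarith
  have hn0 : (0 : ℝ) < n + 1 := by positivity
  set ε : ℝ := 1 / (2 * (n + 1)) with hε
  have hε0 : 0 < ε := by positivity
  let h : Fin (n + 1) → Icc (0 : Fin (n + 1) → ℝ) 1 → Fin n → ℝ := fun j x a =>
    f x a / r - (j : ℕ) / (n + 1)
  have hh : ∀ j, Continuous (h j) := fun j => by fun_prop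
  let A : Fin (n + 1) → Icc (0 : Fin (n + 1) → ℝ) 1 → Prop := fun j x =>
    ∀ a, ε ≤ Int.fract (h j x a) ∧ Int.fract (h j x a) ≤ 1 - ε
  let N : Fin (n + 1) → Icc (0 : Fin (n + 1) → ℝ) 1 → Fin n → ℤ := fun j x a => ⌊h j x a⌋
  let Q : Fin (n + 1) → Set (Fin n → ℤ) := fun j =>
    {q | ∃ z : Icc (0 : Fin (n + 1) → ℝ) 1, (z : Fin (n + 1) → ℝ) j = 0 ∧ A j z ∧ N j z = q}
  obtain ⟨x, hx⟩ := exists_not_mem_cover (fun j => {x | A j x ∧ N j x ∈ Q j})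
    (fun j => {x | A j x ∧ N j x ∈ (Q j)ᶜ}) (fun j => isClosed_floor_mem (hh j) hε0 _)
    (fun j => isClosed_floor_mem (hh j) hε0 _)
    (fun j => Set.disjoint_left.2 fun x h1 h2 => h2.2 h1.2)
    (by
      rintro j x ⟨-, z, hz0, -, hz⟩ hx1
      have h1 : 1 ≤ dist x z := by
        rw [Subtype.dist_eq]
        refine le_trans ?_ (dist_le_pi_dist _ _ j)
        rw [hx1, hz0]
        simp
      have h2 := hfar x z h1
      have h3 : dist (f x) (f z) < r := by
        rw [dist_pi_lt_iff hr]
        intro a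
        have h4 := Int.abs_sub_lt_one_of_floor_eq_floor (congrFun hz a)
        have h5 : h j z a - h j x a = (f z a - f x a) / r := by simp only [h]; ring
        rw [h5, abs_div, abs_of_pos hr, div_lt_one hr] at h4
        rw [dist_comm]
        exact h4
      linarith)
    (by
      rintro j x ⟨h1, h2⟩ hx0
      exact h2 ⟨x, hx0, h1, rfl⟩)
  have hxA : ∀ j, ¬ A j x := fun j hj => by
    by_cases hq : N j x ∈ Q j
    · exact (hx j).1 ⟨hj, hq⟩
    · exact (hx j).2 ⟨hj, hq⟩
  simp only [A, not_forall] at hxA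
  choose a ha using hxA
  obtain ⟨i, j, hij, haij⟩ := Fintype.exists_ne_map_eq_of_card_lt a (by simp)
  have hnear : ∀ j, ∃ m : ℤ, |h j x (a j) - m| < ε := by
    intro j
    have := ha j
    by_cases h1 : ε ≤ Int.fract (h j x (a j))
    · refine ⟨⌊h j x (a j)⌋ + 1, ?_⟩
      have h2 : 1 - ε < Int.fract (h j x (a j)) := not_le.1 fun h => this ⟨h1, h⟩
      have h3 := Int.lt_floor_add_one (h j x (a j))
      rw [← Int.self_sub_floor] at h2
      push_cast
      rw [abs_lt]
      constructor <;> linarith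
    · refine ⟨⌊h j x (a j)⌋, ?_⟩
      rw [Int.self_sub_floor, abs_of_nonneg (Int.fract_nonneg _)]
      exact not_le.1 h1
  obtain ⟨m, hm⟩ := hnear i
  obtain ⟨m', hm'⟩ := hnear j
  rw [haij] at hm
  have h1 : |((i : ℕ) : ℝ) / (n + 1) - (j : ℕ) / (n + 1) + (m - m')| < 2 * ε := by
    have : ((i : ℕ) : ℝ) / (n + 1) - (j : ℕ) / (n + 1) + (m - m') =
        (h j x (a j) - m') - (h i x (a j) - m) := by simp only [h]; ring
    rw [this]
    refine (abs_sub _ _).trans_lt ?_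
    linarith
  have h2 : |((((i : ℕ) : ℤ) - ((j : ℕ) : ℤ) + (m - m') * (n + 1) : ℤ) : ℝ)| < 1 := by
    have h3 : ((((i : ℕ) : ℤ) - ((j : ℕ) : ℤ) + (m - m') * (n + 1) : ℤ) : ℝ) =
        (((i : ℕ) : ℝ) / (n + 1) - (j : ℕ) / (n + 1) + (m - m')) * (n + 1) := by
      push_cast
      field_simp
    rw [h3, abs_mul, abs_of_pos hn0]
    have h4 : (1 : ℝ) = 2 * ε * (n + 1) := by rw [hε]; field_simp
    exact (mul_lt_mul_of_pos_right h1 hn0).trans_eq h4.symm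
  have h3 : ((i : ℕ) : ℤ) - ((j : ℕ) : ℤ) + (m - m') * (n + 1) = 0 := by
    rw [← Int.cast_abs] at h2
    exact Int.abs_lt_one_iff.1 (by exact_mod_cast h2)
  have hi := i.2
  have hj := j.2
  apply hij
  apply Fin.ext
  have h4 : m - m' = 0 := by
    by_contra h5
    rcases lt_or_gt_of_ne h5 with h6 | h6
    · have : (m - m') * (n + 1 : ℤ) ≤ -1 * (n + 1) :=
        mul_le_mul_of_nonneg_right (by omega) (by positivity)
      omega
    · have : 1 * (n + 1 : ℤ) ≤ (m - m') * (n + 1) :=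
        mul_le_mul_of_nonneg_right (by omega) (by positivity)
      omega
  rw [h4] at h3
  omega

/-- Invariance of dimension: a finite-dimensional space with a locally defined continuous
injection into `ℝⁿ` has dimension at most `n`. -/
theorem finrank_le_of_continuousOn_injOn {n : ℕ} {V : Type*} [NormedAddCommGroup V]
    [NormedSpace ℝ V] [FiniteDimensional ℝ V] {U : Set V} (hU : U ∈ 𝓝 0)
    (f : V → Fin n → ℝ) (hf : ContinuousOn f U) (hinj : InjOn f U) : Module.finrank ℝ V ≤ n := by
  by_contra! hlt
  obtain ⟨L, hL⟩ : ∃ L : (Fin (n + 1) → ℝ) →ₗ[ℝ] V, Function.Injective L :=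
    (exists_linearIndependent_of_le_finrank (R := ℝ) (M := V) hlt).elim fun v hv =>
      ⟨Fintype.linearCombination ℝ v, hv.fintypeLinearCombination_injective⟩
  have hLc : Continuous L := L.continuous_of_finiteDimensional
  obtain ⟨ε, hε, hεU⟩ := Metric.mem_nhds_iff.1 (hLc.continuousAt.preimage_mem_nhds
    (show U ∈ 𝓝 (L 0) by rwa [map_zero]))
  have hmem : ∀ x : Icc (0 : Fin (n + 1) → ℝ) 1, L ((ε / 2) • (x : Fin (n + 1) → ℝ)) ∈ U := by
    intro x
    apply hεU
    rw [mem_ball_zero_iff, norm_smul, Real.norm_eq_abs, abs_of_pos (half_pos hε)]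
    have : ‖(x : Fin (n + 1) → ℝ)‖ ≤ 1 := by
      rw [pi_norm_le_iff_of_nonneg zero_le_one]
      intro i
      rw [Real.norm_eq_abs, abs_le]
      have h1 := x.2.1 i
      have h2 := x.2.2 i
      simp at h1 h2
      constructor <;> linarith
    calc ε / 2 * ‖(x : Fin (n + 1) → ℝ)‖ ≤ ε / 2 * 1 := by gcongr
      _ < ε := by linarith
  refine not_injective_of_continuous_cube
    (fun x : Icc (0 : Fin (n + 1) → ℝ) 1 => f (L ((ε / 2) • (x : Fin (n + 1) → ℝ)))) ?_ ?_
  · exact hf.comp_continuous (by fun_prop) hmem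
  · intro x y hxy
    have h1 := hL (hinj (hmem x) (hmem y) hxy)
    exact Subtype.ext (smul_right_injective _ (half_pos hε).ne' h1)

end Dimension

section AlgRep
open Filter

set_option linter.unusedSectionVars false

lemma nexp_eventually_injOn {A : Type*} [NormedRing A] [NormedAlgebra ℝ A]
    [FiniteDimensional ℝ A] :
    ∃ O ∈ 𝓝 (0 : A), IsOpen O ∧ Set.InjOn (NormedSpace.exp : A → A) O := by
  have : CompleteSpace A := FiniteDimensional.complete ℝ A
  obtain ⟨O, hO, hOo, h0⟩ := eventually_nhds_iff.1
    (nexp_hasStrictFDerivAt_zero (A := A)).eventually_left_inverse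
  refine ⟨O, hOo.mem_nhds h0, hOo, fun x hx y hy hxy => ?_⟩
  rw [← hO x hx, ← hO y hy, hxy]

/-- Small elements of the image of a compact group come from small elements of the group. -/
lemma eventually_exists_preimage {G B : Type*} [Group G] [TopologicalSpace G]
    [IsTopologicalGroup G] [CompactSpace G] [Monoid B] [TopologicalSpace B] [T2Space B]
    (ψ : G →* B) (hψ : Continuous ψ) {U : Set G} (hU : U ∈ 𝓝 1) :
    ∀ᶠ b in 𝓝 (1 : B), b ∈ Set.range ψ → ∃ g ∈ U, ψ g = b := by
  let C : Set G := ⋂ k ∈ {k : G | ψ k = 1}, {g | g * k ∈ (interior U)ᶜ}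
  have hC : IsClosed C := isClosed_biInter fun k _ =>
    isOpen_interior.isClosed_compl.preimage (continuous_mul_const k)
  have h1 : (1 : B) ∉ ψ '' C := by
    rintro ⟨g, hg, hg1⟩
    have hinv : ψ g⁻¹ = 1 := by
      have : ψ g⁻¹ * ψ g = 1 := by rw [← map_mul, inv_mul_cancel, map_one]
      rwa [hg1, mul_one] at this
    have := Set.mem_iInter₂.1 hg g⁻¹ hinv
    simp only [Set.mem_ofPred_eq, mul_inv_cancel] at this
    exact this (mem_interior_iff_mem_nhds.2 hU)
  have hopen : (ψ '' C)ᶜ ∈ 𝓝 (1 : B) :=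
    (hC.isCompact.image hψ).isClosed.isOpen_compl.mem_nhds h1
  filter_upwards [hopen] with b hb hbr
  obtain ⟨g, rfl⟩ := hbr
  have hgC : g ∉ C := fun h => hb ⟨g, h, rfl⟩
  simp only [C, Set.mem_iInter, not_forall] at hgC
  obtain ⟨k, hk, hgk⟩ := hgC
  refine ⟨g * k, interior_subset (not_not.1 hgk), ?_⟩
  rw [map_mul, show ψ k = 1 from hk, mul_one]

lemma isClosedMulGroup_range {G A : Type*} [Group G] [TopologicalSpace G] [CompactSpace G]
    [NormedRing A] (φ : G →* A) (hφ : Continuous φ) : IsClosedMulGroup (Set.range φ) where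
  isClosed := (isCompact_range hφ).isClosed
  one_mem := ⟨1, map_one φ⟩
  mul_mem := by
    rintro _ ⟨x, rfl⟩ _ ⟨y, rfl⟩
    exact ⟨x * y, map_mul φ x y⟩
  inv_mem := by
    rintro _ ⟨x, rfl⟩
    exact ⟨φ x⁻¹, ⟨x⁻¹, rfl⟩, by rw [← map_mul, mul_inv_cancel, map_one]⟩

/-- A continuous finite-dimensional representation. -/
structure AlgRep (G : Type*) [Group G] [TopologicalSpace G] where
  A : Type
  [ring : NormedRing A]
  [alg : NormedAlgebra ℂ A]
  [fd : FiniteDimensional ℂ A]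
  ρ : G →* A
  cont : Continuous ρ

attribute [instance] AlgRep.ring AlgRep.alg AlgRep.fd

variable {G : Type*} [Group G] [TopologicalSpace G] [IsTopologicalGroup G] [CompactSpace G]

namespace AlgRep


/-- The product of two representations. -/
noncomputable def prod (R Q : AlgRep G) : AlgRep G where
  A := R.A × Q.A
  ρ := R.ρ.prod Q.ρ
  cont := R.cont.prodMk Q.cont

/-- The projection onto the first factor. -/
noncomputable def fstL (R Q : AlgRep G) : (R.prod Q).A →L[ℝ] R.A :=
  ContinuousLinearMap.fst ℝ R.A Q.A

lemma fstL_exp (R Q : AlgRep G) (X : (R.prod Q).A) :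
    fstL R Q (NormedSpace.exp X) = NormedSpace.exp (fstL R Q X) := by
  have h1 : CompleteSpace R.A := FiniteDimensional.complete ℂ R.A
  have h2 : CompleteSpace Q.A := FiniteDimensional.complete ℂ Q.A
  let : NormedAlgebra ℚ R.A := NormedAlgebra.restrictScalars ℚ ℂ R.A
  let : NormedAlgebra ℚ Q.A := NormedAlgebra.restrictScalars ℚ ℂ Q.A
  exact Prod.fst_exp (𝔸 := R.A) (𝔹 := Q.A) X

/-- The Lie algebra of the image. -/
noncomputable def lie (R : AlgRep G) : Submodule ℝ R.A :=
  (isClosedMulGroup_range R.ρ R.cont).lieAlg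

lemma mem_lie (R : AlgRep G) {X : R.A} :
    X ∈ R.lie ↔ ∀ t : ℝ, NormedSpace.exp (t • X) ∈ Set.range R.ρ := Iff.rfl

lemma fstL_mem_lie (R Q : AlgRep G) {X : (R.prod Q).A} (hX : X ∈ (R.prod Q).lie) :
    fstL R Q X ∈ R.lie := by
  intro t
  obtain ⟨g, hg⟩ := hX t
  refine ⟨g, ?_⟩
  rw [← map_smul, ← fstL_exp, ← hg]
  rfl

lemma exists_fstL_eq (R Q : AlgRep G) {Y : R.A} (hY : Y ∈ R.lie) :
    ∃ X ∈ (R.prod Q).lie, fstL R Q X = Y := by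
  obtain ⟨O, hO, -, hinj⟩ := nexp_eventually_injOn (A := R.A)
  have hO' : fstL R Q ⁻¹' O ∈ 𝓝 (0 : (R.prod Q).A) :=
    (fstL R Q).continuous.continuousAt.preimage_mem_nhds (by rwa [map_zero])
  have h1 := (isClosedMulGroup_range (R.prod Q).ρ (R.prod Q).cont).eventually_exists_exp_eq hO'
  have hU : (R.prod Q).ρ ⁻¹' {a | a ∈ Set.range (R.prod Q).ρ → ∃ X ∈ (R.prod Q).lie,
      X ∈ fstL R Q ⁻¹' O ∧ NormedSpace.exp X = a} ∈ 𝓝 (1 : G) :=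
    (R.prod Q).cont.continuousAt.preimage_mem_nhds (by rw [map_one]; exact h1)
  have h2 := eventually_exists_preimage R.ρ R.cont hU
  have ht : Tendsto (fun t : ℝ => t • Y) (𝓝[≠] 0) (𝓝 0) := by
    have : Continuous fun t : ℝ => t • Y := by fun_prop
    exact (this.tendsto' 0 0 (zero_smul ℝ Y)).mono_left nhdsWithin_le_nhds
  have ht' : Tendsto (fun t : ℝ => NormedSpace.exp (t • Y)) (𝓝[≠] 0) (𝓝 1) :=
    (nexp_continuous.tendsto' 0 1 NormedSpace.exp_zero).comp ht
  obtain ⟨t, htO, ht2, ht0⟩ := ((ht.eventually hO).and ((ht'.eventually h2).and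
    self_mem_nhdsWithin)).exists
  obtain ⟨g, hgU, hg⟩ := ht2 (hY t)
  obtain ⟨X, hX, hXO, hXe⟩ := hgU ⟨g, rfl⟩
  have h3 : NormedSpace.exp (fstL R Q X) = NormedSpace.exp (t • Y) := by
    rw [← fstL_exp, hXe, ← hg]
    rfl
  have h4 := hinj hXO htO h3
  exact ⟨t⁻¹ • X, Submodule.smul_mem _ _ hX, by
    rw [map_smul, h4, smul_smul, inv_mul_cancel₀ ht0, one_smul]⟩

/-- A linear section of the projection of Lie algebras. -/
lemma exists_section (R Q : AlgRep G) : ∃ σ : R.lie →ₗ[ℝ] (R.prod Q).lie,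
    ∀ Y, fstL R Q (σ Y) = Y := by
  let p : (R.prod Q).lie →ₗ[ℝ] R.lie :=
    ((fstL R Q : (R.prod Q).A →ₗ[ℝ] R.A)).restrict fun X hX => fstL_mem_lie R Q hX
  have hp : LinearMap.range p = ⊤ := by
    rw [LinearMap.range_eq_top]
    rintro ⟨Y, hY⟩
    obtain ⟨X, hX, hXY⟩ := exists_fstL_eq R Q hY
    exact ⟨⟨X, hX⟩, Subtype.ext hXY⟩
  obtain ⟨σ, hσ⟩ := p.exists_rightInverse_of_surjective hp
  exact ⟨σ, fun Y => congrArg Subtype.val (LinearMap.congr_fun hσ Y)⟩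

/-- If the two Lie algebras have the same dimension, the projection is injective. -/
lemma fstL_injOn (R Q : AlgRep G) (h : Module.finrank ℝ (R.prod Q).lie ≤ Module.finrank ℝ R.lie)
    {X : (R.prod Q).A} (hX : X ∈ (R.prod Q).lie) (h0 : fstL R Q X = 0) : X = 0 := by
  let p : (R.prod Q).lie →ₗ[ℝ] R.lie :=
    ((fstL R Q : (R.prod Q).A →ₗ[ℝ] R.A)).restrict fun X hX => fstL_mem_lie R Q hX
  have hp : Function.Surjective p := by
    rintro ⟨Y, hY⟩
    obtain ⟨X, hX, hXY⟩ := exists_fstL_eq R Q hY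
    exact ⟨⟨X, hX⟩, Subtype.ext hXY⟩
  have hfr : Module.finrank ℝ (R.prod Q).lie = Module.finrank ℝ R.lie :=
    le_antisymm h (LinearMap.finrank_le_finrank_of_surjective hp)
  have hinj : Function.Injective p := (LinearMap.injective_iff_surjective_of_finrank_eq_finrank
    hfr).2 hp
  have : (⟨X, hX⟩ : (R.prod Q).lie) = 0 := hinj (by
    rw [map_zero]; exact Subtype.ext h0)
  exact congrArg Subtype.val this

/-- The sequence of products with the members of a sequence of representations. -/
noncomputable def seq (R : AlgRep G) (Q : ℕ → AlgRep G) : ℕ → AlgRep G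
  | 0 => R
  | n + 1 => (seq R Q n).prod (Q n)

/-- A continuous lift of the exponential map of a representation to the group. -/
theorem exists_lift [T2Space G] (R : AlgRep G) (Q : ℕ → AlgRep G)
    (hQ : ∀ g : G, (∀ n, (Q n).ρ g = 1) → g = 1) :
    ∃ s : R.lie → G, Continuous s ∧ s 0 = 1 ∧
      ∀ X : R.lie, R.ρ (s X) = NormedSpace.exp (X : R.A) := by
  choose σ hσ using fun n => exists_section (R.seq Q n) (Q n)
  let τ : ∀ n, R.lie →ₗ[ℝ] (R.seq Q n).lie := fun n =>
    Nat.rec (motive := fun n => R.lie →ₗ[ℝ] (R.seq Q n).lie) LinearMap.id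
      (fun n f => (σ n).comp f) n
  have hτ0 : τ 0 = LinearMap.id := rfl
  have hτ : ∀ n X, fstL (R.seq Q n) (Q n) (σ n (τ n X)) = τ n X := fun n X => hσ n (τ n X)
  have hsep : ∀ g h : G, (∀ n, (R.seq Q n).ρ g = (R.seq Q n).ρ h) → g = h := by
    intro g h hgh
    rw [← mul_inv_eq_one]
    refine hQ _ fun n => ?_
    have h1 : (Q n).ρ g = (Q n).ρ h := congrArg Prod.snd (hgh (n + 1))
    rw [map_mul, h1, ← map_mul, mul_inv_cancel, map_one]
  have hex : ∀ X : R.lie, ∃ g : G, ∀ n, (R.seq Q n).ρ g = NormedSpace.exp (τ n X : (R.seq Q n).A) := by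
    intro X
    have hcl : ∀ n, IsClosed {g : G | (R.seq Q n).ρ g =
        NormedSpace.exp (τ n X : (R.seq Q n).A)} :=
      fun n => isClosed_eq (R.seq Q n).cont continuous_const
    have := IsCompact.nonempty_iInter_of_sequence_nonempty_isCompact_isClosed
      (fun n => {g : G | (R.seq Q n).ρ g = NormedSpace.exp (τ n X : (R.seq Q n).A)}) ?_ ?_
      (hcl 0).isCompact hcl
    · obtain ⟨g, hg⟩ := this
      exact ⟨g, fun n => Set.mem_iInter.1 hg n⟩
    · intro n g hg
      have h1 : ((R.seq Q n).prod (Q n)).ρ g = NormedSpace.exp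
        (σ n (τ n X) : ((R.seq Q n).prod (Q n)).A) := hg
      have h2 := congrArg (fstL (R.seq Q n) (Q n)) h1
      rw [fstL_exp, hτ] at h2
      exact h2
    · intro n
      obtain ⟨g, hg⟩ := (τ n X).2 1
      rw [one_smul] at hg
      exact ⟨g, hg⟩
  choose s hs using hex
  refine ⟨s, ?_, ?_, fun X => hs X 0⟩
  · let E : G → ∀ n, (R.seq Q n).A := fun g n => (R.seq Q n).ρ g
    have hE : Continuous E := continuous_pi fun n => (R.seq Q n).cont
    have hEi : IsClosedEmbedding E :=
      hE.isClosedEmbedding fun g h hgh => hsep g h fun n => congrFun hgh n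
    rw [hEi.isInducing.continuous_iff]
    refine continuous_pi fun n => ?_
    have : (fun X => (E ∘ s) X n) = fun X => NormedSpace.exp (τ n X : (R.seq Q n).A) :=
      funext fun X => hs X n
    rw [this]
    exact nexp_continuous.comp
      (continuous_subtype_val.comp (τ n).continuous_of_finiteDimensional)
  · refine hsep _ _ fun n => ?_
    rw [hs 0 n, map_zero, map_one]
    exact NormedSpace.exp_zero

end AlgRep

end AlgRep

section Embedding

open Filter

lemma IsTopManifold.secondCountable {X : Type*} [TopologicalSpace X] [CompactSpace X]
    (h : IsTopManifold X) : SecondCountableTopology X := by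
  choose n U V hU hx _ e using h
  obtain ⟨t, ht⟩ := isCompact_univ.elim_finite_subcover U hU
    (fun x _ => Set.mem_iUnion.2 ⟨x, hx x⟩)
  have : ∀ x, SecondCountableTopology (U x) := fun x =>
    (e x).some.isEmbedding.isInducing.secondCountableTopology
  refine TopologicalSpace.secondCountableTopology_of_countable_cover
    (U := fun x : t => U x) (fun x => hU x) ?_
  rw [Set.eq_univ_iff_forall]
  intro y
  simpa using ht (Set.mem_univ y)

/-- Every point of a manifold has arbitrarily small connected neighbourhoods. -/
lemma IsTopManifold.exists_isPreconnected {X : Type*} [TopologicalSpace X]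
    (h : IsTopManifold X) (x : X) {W : Set X} (hW : W ∈ 𝓝 x) :
    ∃ C ∈ 𝓝 x, C ⊆ W ∧ IsPreconnected C := by
  obtain ⟨n, U, V, hU, hx, hV, ⟨e⟩⟩ := h x
  have : LocallyConnectedSpace V := hV.locallyConnectedSpace
  have : LocallyConnectedSpace U := e.isOpenEmbedding.locallyConnectedSpace
  have hW' : Subtype.val ⁻¹' W ∈ 𝓝 (⟨x, hx⟩ : U) :=
    continuous_subtype_val.continuousAt.preimage_mem_nhds hW
  obtain ⟨C, hC, hC', hCW⟩ := locallyConnectedSpace_iff_connected_subsets.1 this ⟨x, hx⟩ _ hW'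
  refine ⟨Subtype.val '' C, ?_, Set.image_subset_iff.2 hCW,
    hC'.image _ continuous_subtype_val.continuousOn⟩
  exact hU.isOpenEmbedding_subtypeVal.image_mem_nhds.2 hC

lemma IsTopManifold.exists_chart {X : Type*} [TopologicalSpace X]
    (h : IsTopManifold X) (x : X) : ∃ (n : ℕ) (f : X → Fin n → ℝ), ∃ U ∈ 𝓝 x,
      ContinuousOn f U ∧ Set.InjOn f U := by
  classical
  obtain ⟨n, U, V, hU, hx, hV, ⟨e⟩⟩ := h x
  refine ⟨n, fun y i => if hy : y ∈ U then (e ⟨y, hy⟩ : EuclideanSpace ℝ (Fin n)) i else 0,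
    U, hU.mem_nhds hx, ?_, ?_⟩
  · rw [continuousOn_iff_continuous_domRestrict]
    refine continuous_pi fun i => ?_
    have : Continuous fun y : U => (e y : EuclideanSpace ℝ (Fin n)) i :=
      (EuclideanSpace.proj (𝕜 := ℝ) i).continuous.comp
        (continuous_subtype_val.comp e.continuous)
    refine this.congr fun y => ?_
    simp
  · intro y hy z hz hyz
    have : e ⟨y, hy⟩ = e ⟨z, hz⟩ := by
      refine Subtype.ext (PiLp.ext fun i => ?_)
      simpa [hy, hz] using congrFun hyz i
    exact congrArg Subtype.val (e.injective this)

lemma exists_log {A : Type*} [NormedRing A] [NormedAlgebra ℝ A]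
    [FiniteDimensional ℝ A] :
    ∃ (L : A → A), ∃ O ∈ 𝓝 (0 : A), ∃ W ∈ 𝓝 (1 : A), ContinuousOn L W ∧
      ∀ X ∈ O, L (NormedSpace.exp X) = X := by
  have : CompleteSpace A := FiniteDimensional.complete ℝ A
  have h := nexp_hasStrictFDerivAt_zero (A := A)
  let e := HasStrictFDerivAt.toOpenPartialHomeomorph (f' := ContinuousLinearEquiv.refl ℝ A) _ h
  have he : (e : A → A) = NormedSpace.exp := rfl
  have h0 : (0 : A) ∈ e.source := h.mem_toOpenPartialHomeomorph_source
  have h1 : (1 : A) ∈ e.target := by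
    have := e.map_source h0
    rwa [he, NormedSpace.exp_zero] at this
  exact ⟨e.symm, e.source, e.open_source.mem_nhds h0, e.target, e.open_target.mem_nhds h1,
    e.continuousOn_symm, fun X hX => e.left_inv hX⟩

variable {G : Type*} [Group G] [TopologicalSpace G] [IsTopologicalGroup G] [CompactSpace G]
  [T2Space G]

namespace AlgRep

lemma exists_ne_one [SecondCountableTopology G] {g : G} (hg : g ≠ 1) :
    ∃ R : AlgRep G, R.ρ g ≠ 1 := by
  obtain ⟨n, ρ, hρ, hρg⟩ := exists_matrix_rep_ne_one hg
  let E := EuclideanSpace ℂ (Fin n)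
  let c := Matrix.toEuclideanCLM (𝕜 := ℂ) (n := Fin n)
  have hc : Continuous c :=
    (c.toAlgEquiv.toLinearMap : Matrix (Fin n) (Fin n) ℂ →ₗ[ℂ] E →L[ℂ] E).continuous_of_finiteDimensional
  refine ⟨⟨E →L[ℂ] E, (c : Matrix (Fin n) (Fin n) ℂ →* E →L[ℂ] E).comp ρ, hc.comp hρ⟩, ?_⟩
  intro h
  exact hρg (c.injective (h.trans (map_one c).symm))

lemma exists_seq [SecondCountableTopology G] :
    ∃ Q : ℕ → AlgRep G, ∀ g : G, (∀ n, (Q n).ρ g = 1) → g = 1 := by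
  choose R hR using fun g : {g : G // g ≠ 1} => exists_ne_one g.2
  let R' : Option {g : G // g ≠ 1} → AlgRep G := fun o => o.elim ⟨ℂ, 1, continuous_const⟩ R
  obtain ⟨T, hT, hTU⟩ := TopologicalSpace.isOpen_iUnion_countable
    (fun o => {g : G | (R' o).ρ g ≠ 1})
    (fun o => isOpen_ne_fun (R' o).cont continuous_const)
  obtain ⟨f, hf⟩ := (hT.insert none).exists_eq_range (Set.insert_nonempty _ _)
  refine ⟨fun n => R' (f n), fun g hg => ?_⟩
  by_contra hne
  have h1 : g ∈ ⋃ o, {g : G | (R' o).ρ g ≠ 1} := Set.mem_iUnion.2 ⟨some ⟨g, hne⟩, hR ⟨g, hne⟩⟩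
  rw [← hTU] at h1
  obtain ⟨o, ho, hgo⟩ := Set.mem_iUnion₂.1 h1
  have : o ∈ Set.range f := hf ▸ Set.mem_insert_of_mem _ ho
  obtain ⟨n, rfl⟩ := this
  exact hgo (hg n)

lemma finrank_lie_le (Q : ℕ → AlgRep G) (hQ : ∀ g : G, (∀ n, (Q n).ρ g = 1) → g = 1)
    {n : ℕ} {f : G → Fin n → ℝ} {U : Set G} (hU : U ∈ 𝓝 1) (hf : ContinuousOn f U)
    (hfi : Set.InjOn f U) (R : AlgRep G) : Module.finrank ℝ R.lie ≤ n := by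
  obtain ⟨s, hs, hs0, hsX⟩ := R.exists_lift Q hQ
  obtain ⟨O, hO, -, hOi⟩ := nexp_eventually_injOn (A := R.A)
  have h1 : s ⁻¹' U ∩ Subtype.val ⁻¹' O ∈ 𝓝 (0 : R.lie) :=
    inter_mem (hs.continuousAt.preimage_mem_nhds (by rwa [hs0]))
      (continuous_subtype_val.continuousAt.preimage_mem_nhds hO)
  refine finrank_le_of_continuousOn_injOn h1 (f ∘ s)
    (hf.comp hs.continuousOn fun X hX => hX.1) ?_
  intro X hX Y hY hXY
  have h2 := hfi hX.1 hY.1 hXY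
  refine Subtype.ext (hOi hX.2 hY.2 ?_)
  rw [← hsX, ← hsX, h2]

/-- If `R` has maximal dimension then small elements in its kernel are in every other kernel. -/
lemma eventually_ker (R R' : AlgRep G)
    (h : Module.finrank ℝ (R.prod R').lie ≤ Module.finrank ℝ R.lie) :
    ∀ᶠ g in 𝓝 (1 : G), R.ρ g = 1 → R'.ρ g = 1 := by
  obtain ⟨O, hO, -, hinj⟩ := nexp_eventually_injOn (A := R.A)
  have hO' : fstL R R' ⁻¹' O ∈ 𝓝 (0 : (R.prod R').A) :=
    (fstL R R').continuous.continuousAt.preimage_mem_nhds (by rwa [map_zero])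
  have h1 := (isClosedMulGroup_range (R.prod R').ρ (R.prod R').cont).eventually_exists_exp_eq hO'
  have h2 := ((R.prod R').cont.tendsto' 1 1 (map_one _)).eventually h1
  filter_upwards [h2] with g hg hg1
  obtain ⟨X, hX, hXO, hXe⟩ := hg ⟨g, rfl⟩
  have h3 : NormedSpace.exp (fstL R R' X) = NormedSpace.exp 0 := by
    rw [← fstL_exp, hXe, NormedSpace.exp_zero]
    exact hg1
  have h4 := R.fstL_injOn R' h hX (hinj hXO (mem_of_mem_nhds hO) h3)
  rw [h4, NormedSpace.exp_zero] at hXe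
  exact (congrArg Prod.snd hXe).symm

/-- A compact group which is a manifold has a faithful representation. -/
theorem exists_injective (hG : IsTopManifold G) : ∃ R : AlgRep G, Function.Injective R.ρ := by
  have := hG.secondCountable
  obtain ⟨Q, hQ⟩ := exists_seq (G := G)
  obtain ⟨d, f, U, hU, hf, hfi⟩ := hG.exists_chart 1
  obtain ⟨R, hR⟩ : ∃ R : AlgRep G, ∀ R' : AlgRep G,
      Module.finrank ℝ R'.lie ≤ Module.finrank ℝ R.lie := by
    have hfin : (Set.range fun R : AlgRep G => Module.finrank ℝ R.lie).Finite :=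
      (Set.finite_Iic d).subset (by
        rintro _ ⟨R, rfl⟩
        exact finrank_lie_le Q hQ hU hf hfi R)
    obtain ⟨m, ⟨R, rfl⟩, hm⟩ := Set.exists_max_image _ id hfin ⟨_, Q 0, rfl⟩
    exact ⟨R, fun R' => hm _ ⟨R', rfl⟩⟩
  obtain ⟨s, hs, hs0, hsX⟩ := R.exists_lift Q hQ
  obtain ⟨L, O, hO, W, hW, hL, hLX⟩ := exists_log (A := R.A)
  have h1 := (isClosedMulGroup_range R.ρ R.cont).eventually_exists_exp_eq hO
  have h2 := (R.cont.tendsto' 1 1 (map_one _)).eventually (h1.and (eventually_mem_nhds_iff.2 hW))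
  obtain ⟨C, hC, hCsub, hCc⟩ := hG.exists_isPreconnected 1 h2
  have hlog : ∀ g ∈ C, L (R.ρ g) ∈ R.lie ∧ NormedSpace.exp (L (R.ρ g)) = R.ρ g := by
    intro g hg
    obtain ⟨X, hX, hXO, hXe⟩ := (hCsub hg).1 ⟨g, rfl⟩
    rw [← hXe, hLX X hXO]
    exact ⟨hX, rfl⟩
  have hLc : ContinuousOn (fun g => L (R.ρ g)) C := fun g hg =>
    ((hL.continuousAt (hCsub hg).2).comp R.cont.continuousAt).continuousWithinAt
  let lg : C → R.lie := fun g => ⟨L (R.ρ g), (hlog g g.2).1⟩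
  have hlg : Continuous lg :=
    (continuousOn_iff_continuous_domRestrict.1 hLc).subtype_mk _
  let r : C → G := fun g => (s (lg g))⁻¹ * g
  have hr : Continuous r := (hs.comp hlg).inv.mul continuous_subtype_val
  have hrker : ∀ g, R.ρ (r g) = 1 := by
    intro g
    have h3 : R.ρ (s (lg g)) = R.ρ g := (hsX _).trans (hlog g g.2).2
    rw [map_mul, ← h3, ← map_mul, inv_mul_cancel, map_one]
  have hl1 : L 1 = 0 := by
    have := hLX 0 (mem_of_mem_nhds hO)
    rwa [NormedSpace.exp_zero] at this
  have hrk : ∀ g : C, R.ρ g = 1 → r g = g := by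
    intro g hg
    have : lg g = 0 := Subtype.ext (by change L (R.ρ g) = 0; rw [hg, hl1])
    change (s (lg g))⁻¹ * g = g
    rw [this, hs0, inv_one, one_mul]
  have h1C : (1 : G) ∈ C := mem_of_mem_nhds hC
  have hr1 : r ⟨1, h1C⟩ = 1 := hrk ⟨1, h1C⟩ (map_one _)
  have : PreconnectedSpace C := Subtype.preconnectedSpace hCc
  have hQr : ∀ n g, (Q n).ρ (r g) = 1 := by
    intro n
    have hclo : IsClopen {g : C | (Q n).ρ (r g) = 1} := by
      refine ⟨isClosed_eq ((Q n).cont.comp hr) continuous_const, isOpen_iff_mem_nhds.2 ?_⟩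
      intro g (hg : (Q n).ρ (r g) = 1)
      have hker := R.eventually_ker (Q n) (hR _)
      have ht : Tendsto (fun g' => (r g)⁻¹ * r g') (𝓝 g) (𝓝 1) :=
        (continuous_const.mul hr).tendsto' _ _ (inv_mul_cancel _)
      filter_upwards [ht.eventually hker] with g' hg'
      have h3 : R.ρ ((r g)⁻¹ * r g') = 1 := by
        have : R.ρ (r g * ((r g)⁻¹ * r g')) = 1 := by rw [mul_inv_cancel_left, hrker]
        rwa [map_mul, hrker, one_mul] at this
      have h4 := hg' h3
      have h5 : (Q n).ρ (r g * ((r g)⁻¹ * r g')) = 1 := by rw [map_mul, h4, hg, one_mul]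
      rwa [mul_inv_cancel_left] at h5
    have := hclo.eq_univ ⟨⟨1, h1C⟩, by
      change (Q n).ρ (r ⟨1, h1C⟩) = 1
      rw [hr1, map_one]⟩
    exact fun g => Set.eq_univ_iff_forall.1 this g
  have hker : ∀ g ∈ C, R.ρ g = 1 → g = 1 := by
    intro g hg hg1
    have h3 := hQ (r ⟨g, hg⟩) fun n => hQr n ⟨g, hg⟩
    rwa [hrk ⟨g, hg⟩ hg1] at h3
  by_contra! hcon
  have hseq : ∀ n g, (R.seq Q (n + 1)).ρ g = 1 → (R.seq Q n).ρ g = 1 ∧ (Q n).ρ g = 1 :=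
    fun n g hg => ⟨congrArg Prod.fst hg, congrArg Prod.snd hg⟩
  have hseq0 : ∀ n g, (R.seq Q n).ρ g = 1 → R.ρ g = 1 := by
    intro n g
    induction n with
    | zero => exact id
    | succ n ih => exact fun hg => ih (hseq n g hg).1
  have hcl : ∀ n, IsClosed {g | (R.seq Q n).ρ g = 1 ∧ g ∈ (interior C)ᶜ} := fun n =>
    (isClosed_eq (R.seq Q n).cont continuous_const).inter isOpen_interior.isClosed_compl
  obtain ⟨g, hg⟩ := IsCompact.nonempty_iInter_of_sequence_nonempty_isCompact_isClosed
    (fun n => {g | (R.seq Q n).ρ g = 1 ∧ g ∈ (interior C)ᶜ})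
    (fun n g hg => ⟨(hseq n g hg.1).1, hg.2⟩) (fun n => by
      have := hcon (R.seq Q n)
      rw [injective_iff_map_eq_one] at this
      push Not at this
      obtain ⟨g, hg, hg1⟩ := this
      exact ⟨g, hg, fun hgC => hg1 (hker g (interior_subset hgC) (hseq0 n g hg))⟩)
    (hcl 0).isCompact hcl
  have hg' := fun n => Set.mem_iInter.1 hg n
  have hg1 : g = 1 := hQ g fun n => (hseq n g (hg' (n + 1)).1).2
  exact (hg' 0).2 (hg1 ▸ mem_interior_iff_mem_nhds.2 hC)

end AlgRep

end Embedding

section LieStructure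

set_option linter.unusedSectionVars false

open Filter

section Algebra

variable {A : Type*} [NormedRing A] [NormedAlgebra ℝ A] [FiniteDimensional ℝ A]

lemma nexp_hasDerivAt (X : A) : HasDerivAt (fun t : ℝ => NormedSpace.exp (t • X)) X 0 := by
  have : CompleteSpace A := FiniteDimensional.complete ℝ A
  simpa using hasDerivAt_exp_smul_const (𝕂 := ℝ) X (0 : ℝ)

lemma nexp_neg_hasDerivAt (X : A) :
    HasDerivAt (fun t : ℝ => NormedSpace.exp (-(t • X))) (-X) 0 := by
  simpa using nexp_hasDerivAt (-X)

lemma commute_of_commute_exp {X y : A} (h : ∀ t : ℝ, Commute (NormedSpace.exp (t • X)) y) :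
    Commute X y := by
  have h1 : HasDerivAt (fun t : ℝ => NormedSpace.exp (t • X) * y) (X * y) 0 :=
    (nexp_hasDerivAt X).mul_const y
  have h2 : HasDerivAt (fun t : ℝ => NormedSpace.exp (t • X) * y) (y * X) 0 := by
    refine ((nexp_hasDerivAt X).const_mul y).congr_of_eventuallyEq (Eventually.of_forall ?_)
    exact fun t => h t
  exact h1.unique h2

lemma Commute.nexp_left {X y : A} (h : Commute X y) : Commute (NormedSpace.exp X) y := by
  have : CompleteSpace A := FiniteDimensional.complete ℝ A
  let : NormedAlgebra ℚ A := NormedAlgebra.restrictScalars ℚ ℝ A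
  exact h.exp_left

lemma bracket_mem {V : Submodule ℝ A} {X v : A}
    (h : ∀ t : ℝ, NormedSpace.exp (t • X) * v * NormedSpace.exp (-(t • X)) ∈ V) :
    X * v - v * X ∈ V := by
  let f : ℝ → A := fun t => NormedSpace.exp (t • X) * v * NormedSpace.exp (-(t • X))
  have h1 : HasDerivAt f (X * v - v * X) 0 := by
    have h3 : HasDerivAt f _ 0 := ((nexp_hasDerivAt X).mul_const v).mul (nexp_neg_hasDerivAt X)
    simpa [sub_eq_add_neg] using h3
  have h2 := hasDerivAt_iff_tendsto_slope.1 h1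
  refine V.closed_of_finiteDimensional.mem_of_tendsto h2 (Eventually.of_forall fun t => ?_)
  rw [slope_def_module]
  exact V.smul_mem _ (V.sub_mem (h t) (h 0))

lemma nexp_mul_of_mul_eq {A : Type*} [NormedRing A] [NormedAlgebra ℂ A] [FiniteDimensional ℂ A]
    {v y : A} {μ : ℂ} (h : v * y = μ • y) :
    NormedSpace.exp v * y = NormedSpace.exp μ • y := by
  have : CompleteSpace A := FiniteDimensional.complete ℂ A
  have hp : ∀ n : ℕ, v ^ n * y = μ ^ n • y := by
    intro n
    induction n with
    | zero => simp
    | succ n ih => rw [pow_succ, mul_assoc, h, mul_smul_comm, ih, smul_smul, pow_succ, mul_comm]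
  have h1 := (NormedSpace.exp_series_hasSum_exp' (𝕂 := ℂ) v).mul_right y
  have h2 := (NormedSpace.exp_series_hasSum_exp' (𝕂 := ℂ) μ).smul_const y
  have h3 : (fun n : ℕ => ((n.factorial : ℂ)⁻¹ • v ^ n) * y) =
      fun n : ℕ => ((n.factorial : ℂ)⁻¹ • μ ^ n) • y := by
    funext n
    rw [smul_mul_assoc, hp, smul_smul, smul_eq_mul]
  rw [h3] at h1
  exact h1.unique h2

end Algebra

namespace AlgRep

variable {G : Type*} [Group G] [TopologicalSpace G]

lemma ρ_mul_inv (R : AlgRep G) (g : G) : R.ρ g * R.ρ g⁻¹ = 1 := by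
  rw [← map_mul, mul_inv_cancel, map_one]

lemma ρ_inv_mul (R : AlgRep G) (g : G) : R.ρ g⁻¹ * R.ρ g = 1 := by
  rw [← map_mul, inv_mul_cancel, map_one]

lemma ρ_inv_of_eq_exp (R : AlgRep G) {g : G} {X : R.A} (h : R.ρ g = NormedSpace.exp X) :
    R.ρ g⁻¹ = NormedSpace.exp (-X) := by
  have h1 : NormedSpace.exp (-X) * R.ρ g = 1 := by rw [h, nexp_neg_mul]
  calc R.ρ g⁻¹ = (NormedSpace.exp (-X) * R.ρ g) * R.ρ g⁻¹ := by rw [h1, one_mul]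
    _ = _ := by rw [mul_assoc, ρ_mul_inv, mul_one]

lemma exp_smul_conj (R : AlgRep G) (g : G) (t : ℝ) (X : R.A) :
    NormedSpace.exp (t • (R.ρ g * X * R.ρ g⁻¹)) =
      R.ρ g * NormedSpace.exp (t • X) * R.ρ g⁻¹ := by
  rw [← nexp_conj (R.ρ_inv_mul g) (R.ρ_mul_inv g)]
  simp only [smul_mul_assoc, mul_smul_comm]

/-- The restriction of a representation to a subgroup. -/
noncomputable abbrev restrict (R : AlgRep G) (H : Subgroup G) : AlgRep H where
  A := R.A
  ρ := R.ρ.comp H.subtype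
  cont := R.cont.comp continuous_subtype_val

variable [IsTopologicalGroup G] [CompactSpace G]

lemma mem_lie_restrict (R : AlgRep G) {H : Subgroup G} [CompactSpace H] {X : R.A} :
    X ∈ (R.restrict H).lie ↔ ∀ t : ℝ, ∃ h ∈ H, R.ρ h = NormedSpace.exp (t • X) :=
  forall_congr' fun _ => ⟨fun ⟨h, hh⟩ => ⟨h, h.2, hh⟩, fun ⟨h, hH, hh⟩ => ⟨⟨h, hH⟩, hh⟩⟩

lemma lie_restrict_mono (R : AlgRep G) {H K : Subgroup G} [CompactSpace H] [CompactSpace K]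
    (h : H ≤ K) : (R.restrict H).lie ≤ (R.restrict K).lie := by
  intro X hX
  rw [mem_lie_restrict] at hX ⊢
  intro t
  obtain ⟨g, hg, hgX⟩ := hX t
  exact ⟨g, h hg, hgX⟩

lemma lie_restrict_le (R : AlgRep G) (H : Subgroup G) [CompactSpace H] :
    (R.restrict H).lie ≤ R.lie := by
  intro X hX t
  obtain ⟨g, _, hg⟩ := R.mem_lie_restrict.1 hX t
  exact ⟨g, hg⟩

/-- Invariance under the adjoint action. -/
def IsInv (R : AlgRep G) (V : Submodule ℝ R.A) : Prop :=
  ∀ g : G, ∀ X ∈ V, R.ρ g * X * R.ρ g⁻¹ ∈ V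

lemma isInv_lie_restrict (R : AlgRep G) (H : Subgroup G) [H.Normal] [CompactSpace H] :
    R.IsInv (R.restrict H).lie := by
  intro g X hX
  rw [mem_lie_restrict] at hX ⊢
  intro t
  obtain ⟨h, hh, hhX⟩ := hX t
  refine ⟨g * h * g⁻¹, Subgroup.Normal.conj_mem ‹_› h hh g, ?_⟩
  rw [exp_smul_conj, ← hhX, map_mul, map_mul]

lemma isInv_lie (R : AlgRep G) : R.IsInv R.lie := by
  intro g X hX t
  obtain ⟨h, hh⟩ := hX t
  refine ⟨g * h * g⁻¹, ?_⟩
  rw [exp_smul_conj, ← hh, map_mul, map_mul]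

lemma eventually_exists_exp (R : AlgRep G) {O : Set R.A} (hO : O ∈ 𝓝 0) :
    ∀ᶠ g in 𝓝 (1 : G), ∃ X ∈ R.lie, X ∈ O ∧ NormedSpace.exp X = R.ρ g := by
  have h1 := (isClosedMulGroup_range R.ρ R.cont).eventually_exists_exp_eq hO
  filter_upwards [(R.cont.tendsto' 1 1 (map_one _)).eventually h1] with g hg
  exact hg ⟨g, rfl⟩

/-- A connected group is generated by its one-parameter subgroups. -/
lemma eq_top_of_lie [ConnectedSpace G] (R : AlgRep G) (hR : Function.Injective R.ρ)
    (H : Subgroup G) (h : ∀ X ∈ R.lie, ∃ g ∈ H, R.ρ g = NormedSpace.exp X) : H = ⊤ := by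
  have h1 : (H : Set G) ∈ 𝓝 1 := by
    filter_upwards [R.eventually_exists_exp univ_mem] with g hg
    obtain ⟨X, hX, -, hXe⟩ := hg
    obtain ⟨g', hg', hgX⟩ := h X hX
    rw [← hR (hgX.trans hXe)]
    exact hg'
  have h2 : IsOpen (H : Set G) := Subgroup.isOpen_of_mem_nhds H h1
  have h3 : IsClopen (H : Set G) := ⟨Subgroup.isClosed_of_isOpen H h2, h2⟩
  exact SetLike.coe_injective (h3.eq_univ ⟨1, H.one_mem⟩)

lemma finite_of_lie_eq_bot (R : AlgRep G) (hR : Function.Injective R.ρ) (h : R.lie = ⊥) :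
    Finite G := by
  have h1 : ({1} : Set G) ∈ 𝓝 1 := by
    filter_upwards [R.eventually_exists_exp univ_mem] with g hg
    obtain ⟨X, hX, -, hXe⟩ := hg
    rw [h, Submodule.mem_bot] at hX
    rw [hX, NormedSpace.exp_zero] at hXe
    exact hR (hXe.symm.trans (map_one _).symm)
  have : DiscreteTopology G := discreteTopology_of_isOpen_singleton_one
    (isOpen_iff_mem_nhds.2 (by rintro x rfl; exact h1))
  exact finite_of_compact_of_discrete

/-- Passing to the identity component does not change the Lie algebra. -/
lemma exists_connected [T2Space G] (R : AlgRep G) (hR : Function.Injective R.ρ) (H : Subgroup G)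
    [CompactSpace H] : ∃ (K : Subgroup G) (_ : CompactSpace K), K ≤ H ∧ ConnectedSpace K ∧
      (R.restrict K).lie = (R.restrict H).lie := by
  let K : Subgroup G := (Subgroup.connectedComponentOfOne H).map H.subtype
  have hK : (K : Set G) = Subtype.val '' connectedComponent (1 : H) := rfl
  have hKc : CompactSpace K := isCompact_iff_compactSpace.1 (by
    rw [hK]; exact isClosed_connectedComponent.isCompact.image continuous_subtype_val)
  have hKconn : IsConnected (K : Set G) := by
    rw [hK]
    exact isConnected_connectedComponent.image _ continuous_subtype_val.continuousOn
  have hKH : K ≤ H := Subgroup.map_subtype_le _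
  refine ⟨K, hKc, hKH, isConnected_iff_connectedSpace.1 hKconn,
    le_antisymm (R.lie_restrict_mono hKH) ?_⟩
  intro X hX
  have hX' : ∀ t : ℝ, ∃ h : H, (R.restrict H).ρ h = NormedSpace.exp (t • X) := hX
  choose γ hγ using hX'
  have hemb : IsClosedEmbedding (R.restrict H).ρ := (R.restrict H).cont.isClosedEmbedding
    fun a b hab => Subtype.ext (hR hab)
  have hγc : Continuous γ := by
    rw [hemb.isInducing.continuous_iff]
    have : (R.restrict H).ρ ∘ γ = fun t : ℝ => NormedSpace.exp (t • X) := funext hγ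
    rw [this]
    exact nexp_continuous.comp (by fun_prop)
  have hγ0 : γ 0 = 1 := hemb.injective (by rw [hγ, zero_smul, NormedSpace.exp_zero, map_one])
  rw [mem_lie_restrict]
  intro t
  refine ⟨γ t, ?_, hγ t⟩
  have h1 : γ t ∈ connectedComponent (1 : H) :=
    (isPreconnected_range hγc).subset_connectedComponent ⟨0, hγ0⟩ ⟨t, rfl⟩
  exact ⟨γ t, h1, rfl⟩

end AlgRep

end LieStructure

section Complement

set_option linter.unusedSectionVars false

open MeasureTheory

lemma exists_mean (G : Type*) [Group G] [TopologicalSpace G] [IsTopologicalGroup G]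
    [CompactSpace G] [T2Space G] [MeasurableSpace G] [BorelSpace G] :
    ∃ μ : Measure G, IsProbabilityMeasure μ ∧ μ.IsMulLeftInvariant := by
  let K : TopologicalSpace.PositiveCompacts G := ⊤
  refine ⟨Measure.haarMeasure K, ⟨?_⟩, inferInstance⟩
  have := Measure.haarMeasure_self (K₀ := K)
  exact this

lemma Continuous.integrable_of_compactSpace {X E : Type*} [TopologicalSpace X] [CompactSpace X]
    [MeasurableSpace X] [OpensMeasurableSpace X] [NormedAddCommGroup E] {f : X → E}
    (hf : Continuous f) (μ : Measure X) [IsProbabilityMeasure μ] : Integrable f μ :=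
  hf.integrable_of_hasCompactSupport (HasCompactSupport.of_compactSpace f)

namespace AlgRep

variable {G : Type*} [Group G] [TopologicalSpace G] [IsTopologicalGroup G] [CompactSpace G]
  [T2Space G]

lemma ρ_conj_conj (R : AlgRep G) (g h : G) (x : R.A) :
    R.ρ g * (R.ρ h * x * R.ρ h⁻¹) * R.ρ g⁻¹ = R.ρ (g * h) * x * R.ρ (g * h)⁻¹ := by
  rw [mul_inv_rev, map_mul, map_mul]
  simp only [mul_assoc]

/-- Invariant subspaces have invariant complements. -/
theorem exists_isInv_compl (R : AlgRep G) {V E : Submodule ℝ R.A} (hV : R.IsInv V)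
    (hE : R.IsInv E) (hVE : V ≤ E) :
    ∃ V' : Submodule ℝ R.A, R.IsInv V' ∧ V ⊓ V' = ⊥ ∧ V ⊔ V' = E := by
  borelize G
  have : CompleteSpace R.A := FiniteDimensional.complete ℂ R.A
  obtain ⟨μ, hμ, hμl⟩ := exists_mean G
  obtain ⟨C, hC⟩ := V.exists_isCompl
  let p : R.A →L[ℝ] R.A :=
    (V.subtype ∘ₗ V.projectionOnto C hC).toContinuousLinearMap
  have hpV : ∀ x, p x ∈ V := fun x => (V.projectionOnto C hC x).2
  have hpid : ∀ x ∈ V, p x = x := fun x hx =>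
    congrArg Subtype.val (Submodule.projectionOnto_apply_left hC ⟨x, hx⟩)
  let Φ : R.A → G → R.A := fun x g => R.ρ g * p (R.ρ g⁻¹ * x * R.ρ g) * R.ρ g⁻¹
  have hρ := R.cont
  have hΦ : ∀ x, Continuous (Φ x) := fun x => by fun_prop
  have hΦi : ∀ x, Integrable (Φ x) μ := fun x => (hΦ x).integrable_of_compactSpace μ
  let P : R.A →ₗ[ℝ] R.A :=
    { toFun := fun x => ∫ g, Φ x g ∂μ
      map_add' := fun x y => by
        rw [← integral_add (hΦi x) (hΦi y)]
        simp only [Φ, mul_add, add_mul, map_add]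
      map_smul' := fun c x => by
        rw [RingHom.id_apply, ← integral_smul]
        simp only [Φ, mul_smul_comm, smul_mul_assoc, map_smul] }
  have hPdef : ∀ x, P x = ∫ g, Φ x g ∂μ := fun x => rfl
  have hΦV : ∀ x g, Φ x g ∈ V := fun x g => hV g _ (hpV _)
  have hPV : ∀ x, P x ∈ V := by
    intro x
    have h1 := p.integral_comp_comm (hΦi x)
    have h2 : (fun g => p (Φ x g)) = Φ x := funext fun g => hpid _ (hΦV x g)
    rw [h2] at h1
    rw [hPdef, h1]
    exact hpV _
  have hPid : ∀ x ∈ V, P x = x := by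
    intro x hx
    have h1 : Φ x = fun _ => x := by
      funext g
      have h2 : R.ρ g⁻¹ * x * R.ρ g ∈ V := by simpa using hV g⁻¹ x hx
      simp only [Φ]
      rw [hpid _ h2, mul_assoc, mul_assoc, mul_assoc, ρ_mul_inv, mul_one, ← mul_assoc, ρ_mul_inv,
        one_mul]
    rw [hPdef, h1, integral_const]
    simp
  have hPinv : ∀ (h : G) x, P (R.ρ h * x * R.ρ h⁻¹) = R.ρ h * P x * R.ρ h⁻¹ := by
    intro h x
    let T : R.A →L[ℝ] R.A := (ContinuousLinearMap.mul ℝ R.A (R.ρ h)).comp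
      ((ContinuousLinearMap.mul ℝ R.A).flip (R.ρ h⁻¹))
    have hT : ∀ y, T y = R.ρ h * y * R.ρ h⁻¹ := fun y => by simp [T, mul_assoc]
    have h1 : ∀ g, Φ (R.ρ h * x * R.ρ h⁻¹) (h * g) = T (Φ x g) := by
      intro g
      have h2 : R.ρ (h * g)⁻¹ * (R.ρ h * x * R.ρ h⁻¹) * R.ρ (h * g) =
          R.ρ g⁻¹ * x * R.ρ g := by
        have := R.ρ_conj_conj (h * g)⁻¹ h x
        simpa [mul_assoc] using this
      rw [hT]
      simp only [Φ]
      rw [h2, ρ_conj_conj]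
    rw [hPdef, ← integral_mul_left_eq_self _ h, ← hT (P x), hPdef x]
    simp only [h1]
    exact T.integral_comp_comm (hΦi x)
  refine ⟨LinearMap.ker P ⊓ E, ?_, ?_, ?_⟩
  · intro g X hX
    refine ⟨?_, hE g X hX.2⟩
    have h1 : P X = 0 := hX.1
    change P _ = 0
    rw [hPinv, h1, mul_zero, zero_mul]
  · rw [eq_bot_iff]
    rintro x ⟨hx, hxk, -⟩
    have h1 : P x = 0 := hxk
    rw [hPid x hx] at h1
    exact h1
  · refine le_antisymm (sup_le hVE inf_le_right) fun x hx => ?_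
    refine Submodule.mem_sup.2 ⟨P x, hPV x, x - P x, ⟨?_, E.sub_mem hx (hVE (hPV x))⟩,
      by abel⟩
    change P _ = 0
    rw [map_sub, hPid _ (hPV x), sub_self]

/-- A vector commuting with the group which is in the Lie algebra of the common kernel of all
characters vanishes. -/
theorem eq_zero_of_central (R : AlgRep G) {v : R.A} (hv : ∀ g, Commute (R.ρ g) v)
    (h : ∀ t : ℝ, ∃ g : G, R.ρ g = NormedSpace.exp (t • v) ∧
      ∀ θ : G →* ℂ, Continuous θ → θ g = 1) : v = 0 := by
  have hc : CompleteSpace R.A := FiniteDimensional.complete ℂ R.A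
  choose γ hγ hγθ using h
  let L : Module.End ℂ R.A := LinearMap.mulLeft ℂ v
  have hL : ∀ y, L y = v * y := fun y => rfl
  have hev : ∀ μ : ℂ, L.HasEigenvalue μ → μ = 0 := by
    intro μ hμ
    let F := L.eigenspace μ
    have hF : ∀ y, y ∈ F ↔ v * y = μ • y := fun y => Module.End.mem_eigenspace_iff
    have hmaps : ∀ g, ∀ y ∈ F, LinearMap.mulLeft ℂ (R.ρ g) y ∈ F := by
      intro g y hy
      rw [hF] at hy ⊢
      change v * (R.ρ g * y) = μ • (R.ρ g * y)
      rw [← mul_assoc, ← (hv g).eq, mul_assoc, hy, mul_smul_comm]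
    let ψ : G →* Module.End ℂ F :=
      { toFun := fun g => (LinearMap.mulLeft ℂ (R.ρ g)).restrict (hmaps g)
        map_one' := by ext y; simp
        map_mul' := fun a b => by ext y; simp }
    let θ : G →* ℂ := LinearMap.det.comp ψ
    have hθ : Continuous θ := by
      let b := Module.finBasis ℂ F
      have h1 : ∀ g, θ g = (LinearMap.toMatrix b b (ψ g)).det := fun g =>
        (LinearMap.det_toMatrix b (ψ g)).symm
      have h2 : Continuous fun g => (LinearMap.toMatrix b b (ψ g)).det := by
        refine Continuous.matrix_det (continuous_matrix fun i j => ?_)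
        simp only [LinearMap.toMatrix_apply]
        have h3 : Continuous fun y : F => b.repr y i :=
          ((Finsupp.lapply i).comp b.repr.toLinearMap : F →ₗ[ℂ] ℂ).continuous_of_finiteDimensional
        refine h3.comp ?_
        refine Continuous.subtype_mk (f := fun g => R.ρ g * (b j : R.A)) ?_ _
        exact R.cont.mul continuous_const
      exact h2.congr fun g => (h1 g).symm
    have hval : ∀ t : ℝ, θ (γ t) = NormedSpace.exp ((t : ℂ) * μ) ^ Module.finrank ℂ F := by
      intro t
      have h1 : ψ (γ t) = (NormedSpace.exp ((t : ℂ) * μ)) • (LinearMap.id : F →ₗ[ℂ] F) := by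
        ext y
        change R.ρ (γ t) * (y : R.A) = NormedSpace.exp ((t : ℂ) * μ) • (y : R.A)
        rw [hγ]
        refine nexp_mul_of_mul_eq ?_
        rw [smul_mul_assoc, (hF y).1 y.2, ← smul_smul]
        rfl
      change LinearMap.det (ψ (γ t)) = _
      rw [h1, LinearMap.det_smul, LinearMap.det_id, mul_one]
    have hd : Module.finrank ℂ F ≠ 0 := by
      intro h0
      exact hμ (Submodule.finrank_eq_zero.1 h0)
    have h1 : ∀ t : ℝ, Complex.exp ((t : ℂ) * (Module.finrank ℂ F * μ)) = 1 := by
      intro t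
      have := hval t
      rw [hγθ t θ hθ, ← Complex.exp_eq_exp_ℂ, ← Complex.exp_nat_mul] at this
      rw [this]
      congr 1
      ring
    have h2 : HasDerivAt (fun t : ℝ => Complex.exp ((t : ℂ) * (Module.finrank ℂ F * μ)))
        (Module.finrank ℂ F * μ) 0 := by
      have h3 : HasDerivAt (fun t : ℝ => (t : ℂ) * (Module.finrank ℂ F * μ)) _ (0 : ℝ) :=
        (Complex.ofRealCLM.hasDerivAt (x := (0 : ℝ))).mul_const (Module.finrank ℂ F * μ)
      have h4 := h3.cexp
      simpa using h4
    have h5 : HasDerivAt (fun t : ℝ => Complex.exp ((t : ℂ) * (Module.finrank ℂ F * μ))) 0 0 := by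
      simp only [h1]
      exact hasDerivAt_const _ _
    have h6 := h2.unique h5
    exact (mul_eq_zero.1 h6).resolve_left (Nat.cast_ne_zero.2 hd)
  have hsq : ∀ y, v * (v * y) = 0 → v * y = 0 := by
    intro y hy
    have h0 : ∀ t : ℝ, NormedSpace.exp (t • v) * (v * y) = v * y := by
      intro t
      have := nexp_mul_of_mul_eq (v := t • v) (y := v * y) (μ := 0) (by
        rw [smul_mul_assoc, hy, smul_zero, zero_smul])
      simpa using this
    have h1 : ∀ t : ℝ, HasDerivAt (fun t : ℝ => NormedSpace.exp (t • v) * y - t • (v * y)) 0 t := by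
      intro t
      have h2 := (hasDerivAt_exp_smul_const (𝕂 := ℝ) v t).mul_const y
      have h3 : HasDerivAt (fun t : ℝ => t • (v * y)) _ t := (hasDerivAt_id t).smul_const (v * y)
      have h4 := h2.sub h3
      rwa [mul_assoc, h0, one_smul, sub_self] at h4
    have h2 : ∀ t : ℝ, NormedSpace.exp (t • v) * y - t • (v * y) = y := by
      intro t
      have := is_const_of_deriv_eq_zero (fun t => (h1 t).differentiableAt)
        (fun t => (h1 t).deriv) t 0
      simpa using this
    obtain ⟨M, hM⟩ := (isCompact_range R.cont).isBounded.exists_norm_le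
    have h3 : ∀ t : ℝ, 0 ≤ t → t * ‖v * y‖ ≤ M * ‖y‖ + ‖y‖ := by
      intro t ht
      have h4 : t • (v * y) = R.ρ (γ t) * y - y := by
        rw [hγ]
        exact (sub_eq_of_eq_add (sub_eq_iff_eq_add.1 (h2 t) |>.trans (add_comm _ _))).symm
      have h5 : ‖t • (v * y)‖ ≤ M * ‖y‖ + ‖y‖ := by
        rw [h4]
        refine (norm_sub_le _ _).trans (add_le_add_left ((norm_mul_le _ _).trans ?_) _)
        exact mul_le_mul_of_nonneg_right (hM _ ⟨_, rfl⟩) (norm_nonneg _)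
      rwa [norm_smul, Real.norm_of_nonneg ht] at h5
    by_contra hne
    have hpos : 0 < ‖v * y‖ := norm_pos_iff.2 hne
    have hM0 : 0 ≤ M * ‖y‖ + ‖y‖ := by simpa using h3 0 le_rfl
    have h6 := h3 ((M * ‖y‖ + ‖y‖ + 1) / ‖v * y‖) (by positivity)
    rw [div_mul_cancel₀ _ hpos.ne'] at h6
    linarith
  have hker : ∀ (n : ℕ) y, (L ^ n) y = 0 → L y = 0 ∨ n = 0 := by
    intro n
    induction n with
    | zero => exact fun y _ => Or.inr rfl
    | succ n ih =>
      intro y hy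
      left
      rw [pow_succ, Module.End.mul_apply] at hy
      rcases ih _ hy with h | h
      · exact hsq y h
      · simpa [h] using hy
  have htop := Module.End.iSup_maxGenEigenspace_eq_top L
  have hle : ⊤ ≤ LinearMap.ker L := by
    rw [← htop]
    refine iSup_le fun μ => ?_
    intro y hy
    by_cases hμ : μ = 0
    · subst hμ
      obtain ⟨n, hn⟩ := (Module.End.mem_maxGenEigenspace L 0 y).1 hy
      rw [zero_smul, sub_zero] at hn
      rcases hker n y hn with h | h
      · exact h
      · rw [h, pow_zero, Module.End.one_apply] at hn
        rw [hn]; exact Submodule.zero_mem _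
    · obtain ⟨n, hn⟩ := (Module.End.mem_maxGenEigenspace L μ y).1 hy
      have hinj : ∀ z, (L - μ • (1 : Module.End ℂ R.A)) z = 0 → z = 0 := by
        intro z hz
        by_contra hz0
        refine hμ (hev μ (Module.End.hasEigenvalue_of_hasEigenvector (x := z) ⟨?_, hz0⟩))
        rw [Module.End.mem_genEigenspace_one]
        rw [LinearMap.sub_apply] at hz
        exact sub_eq_zero.1 hz
      have hy0 : y = 0 := by
        clear hy
        induction n with
        | zero => exact hn
        | succ n ih =>
          rw [pow_succ', Module.End.mul_apply] at hn
          exact ih (hinj _ hn)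
      rw [hy0]; exact Submodule.zero_mem _
  have : L 1 = 0 := hle (x := 1) trivial
  rwa [hL, mul_one] at this

end AlgRep

end Complement

section Splitting

set_option linter.unusedSectionVars false

namespace AlgRep

variable {G : Type*} [Group G] [TopologicalSpace G] [IsTopologicalGroup G] [CompactSpace G]
  [T2Space G]

/-- The Lie algebra is a nontrivial irreducible representation. -/
def IsSimpleLie (R : AlgRep G) : Prop :=
  R.lie ≠ ⊥ ∧ (∀ X ∈ R.lie, (∀ g, Commute (R.ρ g) X) → X = 0) ∧
    ∀ V ≤ R.lie, R.IsInv V → V = ⊥ ∨ V = R.lie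

/-- The subgroup acting trivially on a subspace by conjugation. -/
def cent (R : AlgRep G) (V : Submodule ℝ R.A) : Subgroup G where
  carrier := {g | ∀ v ∈ V, Commute (R.ρ g) v}
  one_mem' := fun v _ => by rw [map_one]; exact Commute.one_left v
  mul_mem' := fun ha hb v hv => by rw [map_mul]; exact (ha v hv).mul_left (hb v hv)
  inv_mem' := fun {g} hg v hv => by
    have h1 := (hg v hv).eq
    calc R.ρ g⁻¹ * v = R.ρ g⁻¹ * (v * R.ρ g) * R.ρ g⁻¹ := by
          rw [mul_assoc, mul_assoc, ρ_mul_inv, mul_one]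
      _ = v * R.ρ g⁻¹ := by rw [← h1, ← mul_assoc, ρ_inv_mul, one_mul]

lemma mem_cent (R : AlgRep G) {V : Submodule ℝ R.A} {g : G} :
    g ∈ R.cent V ↔ ∀ v ∈ V, Commute (R.ρ g) v := Iff.rfl

lemma isClosed_cent (R : AlgRep G) (V : Submodule ℝ R.A) : IsClosed (R.cent V : Set G) := by
  have : (R.cent V : Set G) = ⋂ v ∈ V, {g | R.ρ g * v = v * R.ρ g} := by
    ext g
    simp [mem_cent, commute_iff_eq]
  rw [this]
  have := R.cont
  exact isClosed_biInter fun v _ => isClosed_eq (by fun_prop) (by fun_prop)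

lemma cent_normal (R : AlgRep G) {V : Submodule ℝ R.A} (hV : R.IsInv V) : (R.cent V).Normal := by
  refine ⟨fun h hh g v hv => ?_⟩
  have h1 : R.ρ h * (R.ρ g⁻¹ * v * R.ρ g) = R.ρ g⁻¹ * v * R.ρ g * R.ρ h :=
    hh _ (by simpa using hV g⁻¹ v hv)
  change R.ρ (g * h * g⁻¹) * v = v * R.ρ (g * h * g⁻¹)
  rw [map_mul, map_mul]
  calc R.ρ g * R.ρ h * R.ρ g⁻¹ * v
      = R.ρ g * (R.ρ h * (R.ρ g⁻¹ * v * R.ρ g)) * R.ρ g⁻¹ := by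
        simp only [mul_assoc, ρ_mul_inv, mul_one]
    _ = (R.ρ g * R.ρ g⁻¹) * v * R.ρ g * R.ρ h * R.ρ g⁻¹ := by rw [h1]; simp only [mul_assoc]
    _ = _ := by rw [ρ_mul_inv, one_mul]; simp only [mul_assoc]

/-- The common kernel of all characters. -/
def charKer (G : Type*) [Group G] [TopologicalSpace G] : Subgroup G :=
  ⨅ θ : {θ : G →* ℂ // Continuous θ}, θ.1.ker

lemma mem_charKer {g : G} : g ∈ charKer G ↔ ∀ θ : G →* ℂ, Continuous θ → θ g = 1 := by
  simp [charKer, Subgroup.mem_iInf, MonoidHom.mem_ker]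

lemma isClosed_charKer : IsClosed (charKer G : Set G) := by
  rw [charKer, Subgroup.coe_iInf]
  exact isClosed_iInter fun θ => isClosed_eq θ.2 continuous_const

instance charKer_normal : (charKer G).Normal := Subgroup.normal_iInf_normal fun _ => inferInstance

/-- In a connected group, what commutes with the Lie algebra commutes with the group. -/
lemma commute_of_commute_lie [ConnectedSpace G] (R : AlgRep G) (hR : Function.Injective R.ρ)
    {v : R.A} (h : ∀ X ∈ R.lie, Commute X v) (g : G) : Commute (R.ρ g) v := by
  have h1 : R.cent (Submodule.span ℝ {v}) = ⊤ := R.eq_top_of_lie hR _ fun X hX => by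
    obtain ⟨g, hg⟩ := hX 1
    rw [one_smul] at hg
    refine ⟨g, fun w hw => ?_, hg⟩
    obtain ⟨c, rfl⟩ := Submodule.mem_span_singleton.1 hw
    rw [hg]
    exact ((h X hX).smul_right c).nexp_left
  have h2 : g ∈ R.cent (Submodule.span ℝ {v}) := h1 ▸ Subgroup.mem_top g
  exact h2 v (Submodule.mem_span_singleton_self v)

lemma exp_conj_mem (R : AlgRep G) {V : Submodule ℝ R.A} (hV : R.IsInv V) {X v : R.A}
    (hX : X ∈ R.lie) (hv : v ∈ V) (t : ℝ) :
    NormedSpace.exp (t • X) * v * NormedSpace.exp (-(t • X)) ∈ V := by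
  obtain ⟨g, hg⟩ := hX t
  rw [← R.ρ_inv_of_eq_exp hg, ← hg]
  exact hV g v hv

/-- Elements of complementary invariant subspaces commute. -/
lemma commute_of_disjoint (R : AlgRep G) {V W : Submodule ℝ R.A} (hV : R.IsInv V)
    (hW : R.IsInv W) (hVl : V ≤ R.lie) (hWl : W ≤ R.lie) (h : W ⊓ V = ⊥) {w v : R.A}
    (hw : w ∈ W) (hv : v ∈ V) : Commute w v := by
  have h1 : w * v - v * w ∈ V := bracket_mem (R.exp_conj_mem hV (hWl hw) hv)
  have h2 : v * w - w * v ∈ W := bracket_mem (R.exp_conj_mem hW (hVl hv) hw)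
  have h3 : w * v - v * w ∈ W ⊓ V := ⟨by
    have := W.neg_mem h2
    rwa [neg_sub] at this, h1⟩
  rw [h, Submodule.mem_bot] at h3
  exact sub_eq_zero.1 h3

/-- If `X` is in the Lie algebra of a normal subgroup containing the relevant commutators, so
are the differences of `X` and its conjugates. -/
lemma sub_conj_mem_lie (R : AlgRep G) (H : Subgroup G) [CompactSpace H] {X : R.A} (g : G)
    (h : ∀ (t : ℝ) (k : G), R.ρ k = NormedSpace.exp (t • X) → k * g * k⁻¹ * g⁻¹ ∈ H)
    (hX : X ∈ R.lie) : X - R.ρ g * X * R.ρ g⁻¹ ∈ (R.restrict H).lie := by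
  choose k hk using hX
  let f : ℝ → R.A := fun t =>
    NormedSpace.exp (t • X) * R.ρ g * NormedSpace.exp (-(t • X)) * R.ρ g⁻¹
  have hf : ∀ t, f t = R.ρ (k t * g * (k t)⁻¹ * g⁻¹) := by
    intro t
    simp only [map_mul]
    rw [R.ρ_inv_of_eq_exp (hk t), hk]
  have hd : HasDerivAt f (X - R.ρ g * X * R.ρ g⁻¹) 0 := by
    have h3 : HasDerivAt f _ 0 := ((((nexp_hasDerivAt X).mul_const (R.ρ g)).mul
      (nexp_neg_hasDerivAt X)).mul_const (R.ρ g⁻¹))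
    convert h3 using 1
    simp [sub_eq_add_neg, add_mul, mul_assoc, ρ_mul_inv]
  refine (isClosedMulGroup_range (R.restrict H).ρ (R.restrict H).cont).exp_smul_mem_of_hasDerivAt
    (f := f) (fun s => ⟨⟨_, h s (k s) (hk s)⟩, (hf s).symm⟩) ?_ hd
  simp [f, ρ_mul_inv]

/-- A nonabelian compact connected linear group has a nontrivial irreducible invariant subspace in
its Lie algebra, with an invariant complement. -/
lemma exists_irreducible [ConnectedSpace G] (R : AlgRep G) (hR : Function.Injective R.ρ)
    (hna : ∃ a b : G, a * b ≠ b * a) :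
    ∃ W V : Submodule ℝ R.A, R.IsInv W ∧ R.IsInv V ∧ W ⊓ V = ⊥ ∧ W ⊔ V = R.lie ∧ W ≠ ⊥ ∧
      (∀ X ∈ W, (∀ g, Commute (R.ρ g) X) → X = 0) ∧
      ∀ W' ≤ W, R.IsInv W' → W' = ⊥ ∨ W' = W := by
  let z : Submodule ℝ R.A :=
    { carrier := {X | X ∈ R.lie ∧ ∀ g, Commute (R.ρ g) X}
      add_mem' := fun ha hb => ⟨R.lie.add_mem ha.1 hb.1, fun g => (ha.2 g).add_right (hb.2 g)⟩
      zero_mem' := ⟨R.lie.zero_mem, fun g => Commute.zero_right _⟩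
      smul_mem' := fun c X hX => ⟨R.lie.smul_mem c hX.1, fun g => (hX.2 g).smul_right c⟩ }
  have hz : R.IsInv z := by
    intro g X hX
    have : R.ρ g * X * R.ρ g⁻¹ = X := by rw [(hX.2 g).eq, mul_assoc, ρ_mul_inv, mul_one]
    rwa [this]
  obtain ⟨z', hz', hzz, hzs⟩ := R.exists_isInv_compl hz R.isInv_lie fun X hX => hX.1
  have hz_ne : z' ≠ ⊥ := by
    intro h0
    rw [h0, sup_bot_eq] at hzs
    obtain ⟨a, b, hab⟩ := hna
    refine hab (hR ?_)
    rw [map_mul, map_mul]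
    refine R.commute_of_commute_lie hR (v := R.ρ b) (fun X hX => ?_) a
    rw [← hzs] at hX
    exact (hX.2 b).symm
  obtain ⟨W, ⟨hW0, hWi, hWz⟩, hWmin⟩ := wellFounded_lt.has_min
    {W : Submodule ℝ R.A | W ≠ ⊥ ∧ R.IsInv W ∧ W ≤ z'} ⟨z', hz_ne, hz', le_rfl⟩
  have hWl : W ≤ R.lie := hWz.trans (hzs ▸ le_sup_right)
  obtain ⟨V, hV, hWV, hWVs⟩ := R.exists_isInv_compl hWi R.isInv_lie hWl
  refine ⟨W, V, hWi, hV, hWV, hWVs, hW0, ?_, ?_⟩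
  · intro X hX hc
    have : X ∈ z ⊓ z' := ⟨⟨hWl hX, hc⟩, hWz hX⟩
    rwa [hzz, Submodule.mem_bot] at this
  · intro W' hW' hinv
    by_contra! hcon
    exact hWmin W' ⟨hcon.1, hinv, hW'.trans hWz⟩ (lt_of_le_of_ne hW' hcon.2)

/-- A nonabelian compact connected linear group splits off a simple factor. -/
theorem exists_splitting [ConnectedSpace G] (R : AlgRep G) (hR : Function.Injective R.ρ)
    (hna : ∃ a b : G, a * b ≠ b * a) :
    ∃ (K₁ K₂ : Subgroup G) (_ : CompactSpace K₁) (_ : CompactSpace K₂),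
      ConnectedSpace K₁ ∧ ConnectedSpace K₂ ∧ (∀ a ∈ K₁, ∀ b ∈ K₂, a * b = b * a) ∧
      (∀ g, ∃ a ∈ K₁, ∃ b ∈ K₂, a * b = g) ∧ Finite (K₁ ⊓ K₂ : Subgroup G) ∧
      Module.finrank ℝ (R.restrict K₂).lie < Module.finrank ℝ R.lie ∧
      (R.restrict K₁).IsSimpleLie := by
  obtain ⟨W, V, hW, hV, hWV, hWVs, hW0, hWfix, hWirr⟩ := R.exists_irreducible hR hna
  have hWl : W ≤ R.lie := hWVs ▸ le_sup_left
  have hVl : V ≤ R.lie := hWVs ▸ le_sup_right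
  have hcomm : ∀ w ∈ W, ∀ v ∈ V, Commute w v := fun w hw v hv =>
    R.commute_of_disjoint hV hW hVl hWl hWV hw hv
  have hdecomp : ∀ X ∈ R.lie, ∃ w ∈ W, ∃ v ∈ V, w + v = X := fun X hX => by
    rw [← hWVs] at hX
    exact Submodule.mem_sup.1 hX
  have hVn := R.cent_normal hV
  have hWn := R.cent_normal hW
  -- the two commuting factors
  let H₁ : Subgroup G := R.cent V ⊓ charKer G
  let H₂ : Subgroup G := R.cent W
  have hH₁c : CompactSpace H₁ := isCompact_iff_compactSpace.1
    ((R.isClosed_cent V).inter isClosed_charKer).isCompact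
  have hH₂c : CompactSpace H₂ := isCompact_iff_compactSpace.1 (R.isClosed_cent W).isCompact
  have hH₁n : H₁.Normal := inferInstance
  have hlieComm : ∀ (H : Subgroup G) [CompactSpace H] (E : Submodule ℝ R.A), H ≤ R.cent E →
      ∀ X ∈ (R.restrict H).lie, ∀ v ∈ E, Commute X v := by
    intro H _ E hHE X hX v hv
    refine commute_of_commute_exp fun t => ?_
    obtain ⟨h, hh, hhX⟩ := R.mem_lie_restrict.1 hX t
    rw [← hhX]
    exact hHE hh v hv
  have hcentral : ∀ v : R.A, (∀ w ∈ W, Commute w v) → (∀ u ∈ V, Commute u v) →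
      ∀ g, Commute (R.ρ g) v := by
    intro v h1 h2
    refine R.commute_of_commute_lie hR fun X hX => ?_
    obtain ⟨w, hw, u, hu, rfl⟩ := hdecomp X hX
    exact (h1 w hw).add_left (h2 u hu)
  have hlie₂ : (R.restrict H₂).lie = V := by
    apply le_antisymm
    · intro X hX
      obtain ⟨w, hw, v, hv, rfl⟩ := hdecomp X (R.lie_restrict_le H₂ hX)
      have h1 : w = 0 := by
        refine hWfix w hw (hcentral w (fun w' hw' => ?_) fun u hu => (hcomm w hw u hu).symm)
        have h2 := hlieComm H₂ W le_rfl _ hX w' hw'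
        have h3 := h2.sub_left (hcomm w' hw' v hv).symm
        rw [add_sub_cancel_right] at h3
        exact h3.symm
      rwa [h1, zero_add]
    · intro v hv
      rw [mem_lie_restrict]
      intro t
      obtain ⟨g, hg⟩ := hVl hv t
      refine ⟨g, fun w hw => ?_, hg⟩
      rw [hg]
      exact ((hcomm w hw v hv).symm.smul_left t).nexp_left
  have hWle : W ≤ (R.restrict H₁).lie := by
    have h1 := hWirr ((R.restrict H₁).lie ⊓ W) inf_le_right fun g X hX =>
      ⟨R.isInv_lie_restrict H₁ g X hX.1, hW g X hX.2⟩
    rcases h1 with h1 | h1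
    · exfalso
      obtain ⟨w, hw, hw0⟩ := W.ne_bot_iff.1 hW0
      refine hw0 (hWfix w hw fun g => ?_)
      have h2 : w - R.ρ g * w * R.ρ g⁻¹ ∈ (R.restrict H₁).lie ⊓ W := by
        refine ⟨R.sub_conj_mem_lie H₁ g (fun t k hk => ⟨?_, ?_⟩) (hWl hw),
          W.sub_mem hw (hW g w hw)⟩
        · have hkV : k ∈ R.cent V := fun v hv => by
            rw [hk]
            exact ((hcomm w hw v hv).smul_left t).nexp_left
          have h3 : k * (g * k⁻¹ * g⁻¹) ∈ R.cent V :=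
            mul_mem hkV (hVn.conj_mem _ (inv_mem hkV) g)
          rw [← mul_assoc, ← mul_assoc] at h3
          exact h3
        · refine mem_charKer.2 fun θ _ => ?_
          rw [map_mul, map_mul, map_mul, mul_right_comm, mul_assoc (θ k),
            ← map_mul, mul_inv_cancel, map_one, mul_one, ← map_mul, mul_inv_cancel, map_one]
      rw [h1, Submodule.mem_bot, sub_eq_zero] at h2
      change R.ρ g * w = w * R.ρ g
      conv_rhs => rw [h2]
      rw [mul_assoc, ρ_inv_mul, mul_one]
    · exact h1 ▸ inf_le_left
  have hlie₁ : (R.restrict H₁).lie = W := by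
    refine le_antisymm (fun X hX => ?_) hWle
    obtain ⟨w, hw, v, hv, rfl⟩ := hdecomp X (R.lie_restrict_le H₁ hX)
    have hvl : v ∈ (R.restrict H₁).lie := by
      have := (R.restrict H₁).lie.sub_mem hX (hWle hw)
      rwa [add_sub_cancel_left] at this
    have hv0 : v = 0 := by
      refine R.eq_zero_of_central (hcentral v (fun w' hw' => hcomm w' hw' v hv) fun u hu => ?_) ?_
      · exact (hlieComm H₁ V inf_le_left v hvl u hu).symm
      · intro t
        obtain ⟨g, hg, hgv⟩ := R.mem_lie_restrict.1 hvl t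
        exact ⟨g, hgv, mem_charKer.1 hg.2⟩
    rwa [hv0, add_zero]
  obtain ⟨K₁, hK₁c, hK₁H, hK₁, hK₁l⟩ := R.exists_connected hR H₁
  obtain ⟨K₂, hK₂c, hK₂H, hK₂, hK₂l⟩ := R.exists_connected hR H₂
  rw [hlie₁] at hK₁l
  rw [hlie₂] at hK₂l
  have hinj : ∀ K : Subgroup G, Function.Injective (R.restrict K).ρ := fun K a b hab =>
    Subtype.ext (hR hab)
  have hKK : ∀ a ∈ K₁, ∀ b ∈ K₂, a * b = b * a := by
    intro a ha b hb
    have h1 := (R.restrict K₂).commute_of_commute_lie (hinj K₂) (v := R.ρ a)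
      (fun X hX => ((hK₁H ha).1 X (hK₂l ▸ hX)).symm) ⟨b, hb⟩
    exact (hR (by rw [map_mul, map_mul]; exact h1.eq)).symm
  have hgen : ∀ g, ∃ a ∈ K₁, ∃ b ∈ K₂, a * b = g := by
    let P : Subgroup G :=
      { carrier := {g | ∃ a ∈ K₁, ∃ b ∈ K₂, a * b = g}
        one_mem' := ⟨1, one_mem _, 1, one_mem _, mul_one 1⟩
        mul_mem' := by
          rintro _ _ ⟨a, ha, b, hb, rfl⟩ ⟨a', ha', b', hb', rfl⟩
          refine ⟨a * a', mul_mem ha ha', b * b', mul_mem hb hb', ?_⟩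
          rw [mul_assoc, ← mul_assoc a', hKK a' ha' b hb, mul_assoc, mul_assoc]
        inv_mem' := by
          rintro _ ⟨a, ha, b, hb, rfl⟩
          refine ⟨a⁻¹, inv_mem ha, b⁻¹, inv_mem hb, ?_⟩
          rw [mul_inv_rev, hKK _ (inv_mem ha) _ (inv_mem hb)] }
    have hP : P = ⊤ := R.eq_top_of_lie hR P fun X hX => by
      obtain ⟨w, hw, v, hv, rfl⟩ := hdecomp X hX
      rw [← hK₁l] at hw
      rw [← hK₂l] at hv
      obtain ⟨a, ha, haw⟩ := R.mem_lie_restrict.1 hw 1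
      obtain ⟨b, hb, hbv⟩ := R.mem_lie_restrict.1 hv 1
      refine ⟨a * b, ⟨a, ha, b, hb, rfl⟩, ?_⟩
      rw [map_mul, haw, hbv, one_smul, one_smul, nexp_add]
      exact hcomm w (hK₁l ▸ hw) v (hK₂l ▸ hv)
    intro g
    have : g ∈ P := hP ▸ Subgroup.mem_top g
    exact this
  refine ⟨K₁, K₂, hK₁c, hK₂c, hK₁, hK₂, hKK, hgen, ?_, ?_, ?_, ?_, ?_⟩
  · have hc : CompactSpace (K₁ ⊓ K₂ : Subgroup G) := isCompact_iff_compactSpace.1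
      ((isCompact_iff_compactSpace.2 hK₁c).inter (isCompact_iff_compactSpace.2 hK₂c))
    refine (R.restrict (K₁ ⊓ K₂)).finite_of_lie_eq_bot (hinj _) (eq_bot_iff.2 ?_)
    intro X hX
    rw [← hWV]
    exact ⟨hK₁l ▸ R.lie_restrict_mono inf_le_left hX, hK₂l ▸ R.lie_restrict_mono inf_le_right hX⟩
  · rw [hK₂l]
    refine Submodule.finrank_lt_finrank_of_lt (lt_of_le_of_ne hVl fun h => hW0 ?_)
    rw [eq_bot_iff, ← hWV]
    exact le_inf le_rfl (h ▸ hWl)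
  · rw [hK₁l]
    exact hW0
  · intro X hX hc
    rw [hK₁l] at hX
    refine hWfix X hX fun g => ?_
    obtain ⟨a, ha, b, hb, rfl⟩ := hgen g
    rw [map_mul]
    exact (hc ⟨a, ha⟩).mul_left (hK₂H hb X hX)
  · intro W' hW' hinv
    rw [hK₁l] at hW' ⊢
    refine hWirr W' hW' fun g X hX => ?_
    obtain ⟨a, ha, b, hb, rfl⟩ := hgen g
    rw [← ρ_conj_conj]
    refine hinv ⟨a, ha⟩ _ ?_
    rw [(hK₂H hb X (hW' hX)).eq, mul_assoc, ρ_mul_inv, mul_one]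
    exact hX

end AlgRep

end Splitting

section UniversalCover
set_option linter.unusedSectionVars false
open Topology unitInterval

instance continuousMap_isTopologicalGroup {X K : Type*} [TopologicalSpace X] [LocallyCompactSpace X]
    [Group K] [TopologicalSpace K] [IsTopologicalGroup K] : IsTopologicalGroup C(X, K) where
  continuous_mul := continuous_mul
  continuous_inv := ContinuousMap.continuous_postcomp ⟨fun k : K => k⁻¹, continuous_inv⟩

variable {K : Type u} [Group K] [TopologicalSpace K] [IsTopologicalGroup K]

/-- The group of paths in `K` starting at the identity. -/
def pathGroup (K : Type u) [Group K] [TopologicalSpace K] [IsTopologicalGroup K] :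
    Subgroup C(I, K) where
  carrier := {γ | γ 0 = 1}
  mul_mem' {a b} ha hb := by
    have ha : a 0 = 1 := ha
    have hb : b 0 = 1 := hb
    simp [ha, hb]
  one_mem' := by simp
  inv_mem' {a} ha := by
    have ha : a 0 = 1 := ha
    simp [ha]

lemma mem_pathGroup {γ : C(I, K)} : γ ∈ pathGroup K ↔ γ 0 = 1 := Iff.rfl

/-- The subgroup of null-homotopic loops. -/
def nullLoops (K : Type u) [Group K] [TopologicalSpace K] [IsTopologicalGroup K] :
    Subgroup (pathGroup K) where
  carrier := {γ | ∃ H : C(I × I, K), (∀ t, H (0, t) = γ.1 t) ∧ (∀ t, H (1, t) = 1) ∧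
    (∀ r, H (r, 0) = 1) ∧ ∀ r, H (r, 1) = 1}
  mul_mem' := by
    rintro a b ⟨H, h0, h1, h2, h3⟩ ⟨H', h0', h1', h2', h3'⟩
    exact ⟨H * H', fun t => by simp [h0, h0'], fun t => by simp [h1, h1'],
      fun t => by simp [h2, h2'], fun t => by simp [h3, h3']⟩
  one_mem' := ⟨1, by simp, by simp, by simp, by simp⟩
  inv_mem' := by
    rintro a ⟨H, h0, h1, h2, h3⟩
    exact ⟨H⁻¹, fun t => by simp [h0], fun t => by simp [h1],
      fun t => by simp [h2], fun t => by simp [h3]⟩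

lemma mem_nullLoops {γ : pathGroup K} : γ ∈ nullLoops K ↔
    ∃ H : C(I × I, K), (∀ t, H (0, t) = γ.1 t) ∧ (∀ t, H (1, t) = 1) ∧
    (∀ r, H (r, 0) = 1) ∧ ∀ r, H (r, 1) = 1 := Iff.rfl

instance nullLoops_normal : (nullLoops K).Normal where
  conj_mem := by
    rintro a ⟨H, h0, h1, h2, h3⟩ g
    refine ⟨(g.1.comp ContinuousMap.snd) * H * (g.1.comp ContinuousMap.snd)⁻¹, fun t => ?_,
      fun t => ?_, fun t => ?_, fun t => ?_⟩
    · simp [h0]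
    · simp [h1]
    · simp [h2]
    · simp [h3]

/-- The endpoint homomorphism on the path group. -/
def pathEnd (K : Type u) [Group K] [TopologicalSpace K] [IsTopologicalGroup K] :
    pathGroup K →* K where
  toFun γ := γ.1 1
  map_one' := rfl
  map_mul' _ _ := rfl

lemma pathEnd_apply (γ : pathGroup K) : pathEnd K γ = γ.1 1 := rfl

lemma continuous_pathEnd : Continuous (pathEnd K) :=
  (continuous_eval_const (1 : I)).comp continuous_subtype_val

lemma nullLoops_le_ker : nullLoops K ≤ (pathEnd K).ker := by
  rintro γ ⟨H, h0, -, -, h3⟩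
  rw [MonoidHom.mem_ker, pathEnd_apply, ← h0, h3]

/-- The universal covering group. -/
abbrev UnivCover (K : Type u) [Group K] [TopologicalSpace K] [IsTopologicalGroup K] : Type u :=
  pathGroup K ⧸ nullLoops K

/-- The covering homomorphism. -/
def univProj (K : Type u) [Group K] [TopologicalSpace K] [IsTopologicalGroup K] :
    UnivCover K →* K :=
  QuotientGroup.lift (nullLoops K) (pathEnd K) nullLoops_le_ker

lemma univProj_mk (γ : pathGroup K) : univProj K (γ : UnivCover K) = γ.1 1 := rfl

lemma continuous_univProj : Continuous (univProj K) :=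
  continuous_quot_lift _ continuous_pathEnd

/-- The path `γ` reparametrized to run up to time `r`. -/
def truncPath (γ : pathGroup K) (r : I) : pathGroup K :=
  ⟨γ.1.comp ⟨fun t => r * t, by fun_prop⟩, by
    have h : γ.1 0 = 1 := γ.2
    simp [mem_pathGroup, h]⟩

lemma truncPath_apply (γ : pathGroup K) (r t : I) : (truncPath γ r).1 t = γ.1 (r * t) := rfl

lemma continuous_truncPath (γ : pathGroup K) : Continuous (truncPath γ) := by
  refine Continuous.subtype_mk ?_ _
  apply ContinuousMap.continuous_of_continuous_uncurry
  exact γ.1.continuous.comp (continuous_fst.mul continuous_snd)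

lemma truncPath_zero (γ : pathGroup K) : truncPath γ 0 = 1 := by
  ext t
  have h : γ.1 0 = 1 := γ.2
  simp [truncPath_apply, h]

lemma truncPath_one (γ : pathGroup K) : truncPath γ 1 = γ := by
  ext t
  simp [truncPath_apply]

instance : PathConnectedSpace (pathGroup K) where
  nonempty := ⟨1⟩
  joined x y := by
    have h : ∀ γ : pathGroup K, Joined 1 γ := fun γ =>
      ⟨⟨⟨truncPath γ, continuous_truncPath γ⟩, truncPath_zero γ, truncPath_one γ⟩⟩
    exact (h x).symm.trans (h y)

/-- A topological group with a continuous local logarithm at the identity. -/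
structure HasLocalLog (V : Type*) [AddCommGroup V] [Module ℝ V] [TopologicalSpace V]
    (s : V → K) (L : K → V) (W : Set K) : Prop where
  cont : Continuous s
  isOpen : IsOpen W
  one_mem : (1 : K) ∈ W
  contOn : ContinuousOn L W
  right_inv : ∀ w ∈ W, s (L w) = w
  log_one : L 1 = 0

namespace HasLocalLog

variable {V : Type*} [AddCommGroup V] [Module ℝ V] [TopologicalSpace V] [IsTopologicalAddGroup V]
  [ContinuousSMul ℝ V] {s : V → K} {L : K → V} {W : Set K}

lemma map_zero (h : HasLocalLog V s L W) : s 0 = 1 := by rw [← h.log_one, h.right_inv _ h.one_mem]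

/-- The radial path to `s X`. -/
def ray (h : HasLocalLog V s L W) (X : V) : pathGroup K :=
  ⟨⟨fun t => s ((t : ℝ) • X), h.cont.comp (by fun_prop)⟩, by simp [mem_pathGroup, h.map_zero]⟩

lemma ray_apply (h : HasLocalLog V s L W) (X : V) (t : I) : (h.ray X).1 t = s ((t : ℝ) • X) := rfl

lemma continuous_ray (h : HasLocalLog V s L W) : Continuous h.ray := by
  refine Continuous.subtype_mk ?_ _
  apply ContinuousMap.continuous_of_continuous_uncurry
  exact h.cont.comp (by fun_prop)

lemma ray_zero (h : HasLocalLog V s L W) : h.ray 0 = 1 := by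
  ext t
  simp [ray_apply, h.map_zero]

/-- The paths remaining in the domain of the logarithm. -/
def smallPaths (_ : HasLocalLog V s L W) : Set (pathGroup K) := {γ | ∀ t, γ.1 t ∈ W}

lemma isOpen_smallPaths (h : HasLocalLog V s L W) : IsOpen h.smallPaths := by
  have h1 := ContinuousMap.isOpen_setOfPred_mapsTo (isCompact_univ : IsCompact (Set.univ : Set I))
    h.isOpen
  have h2 := h1.preimage (continuous_subtype_val (p := fun γ => γ ∈ pathGroup K))
  convert h2 using 1
  ext γ
  simp [smallPaths, Set.MapsTo]

lemma one_mem_smallPaths (h : HasLocalLog V s L W) : (1 : pathGroup K) ∈ h.smallPaths :=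
  fun _ => h.one_mem

lemma smallPaths_eq (h : HasLocalLog V s L W) {γ : pathGroup K} (hγ : γ ∈ h.smallPaths) :
    (γ : UnivCover K) = (h.ray (L (γ.1 1)) : UnivCover K) := by
  rw [QuotientGroup.eq, mem_nullLoops]
  have hc : Continuous fun t : I => L (γ.1 t) :=
    h.contOn.comp_continuous γ.1.continuous hγ
  have h0 : γ.1 0 = 1 := γ.2
  refine ⟨⟨fun x => (γ.1 x.2)⁻¹ * s ((1 - (x.1 : ℝ)) • ((x.2 : ℝ) • L (γ.1 1))
    + (x.1 : ℝ) • L (γ.1 x.2)), ?_⟩, ?_, ?_, ?_, ?_⟩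
  · refine ((γ.1.continuous.comp continuous_snd).inv).mul (h.cont.comp ?_)
    have := hc.comp (continuous_snd (X := I) (Y := I))
    exact Continuous.add (by fun_prop) (Continuous.smul (by fun_prop) this)
  · intro t
    simp [ray_apply]
  · intro t
    simp [h.right_inv _ (hγ t)]
  · intro r
    simp [h0, h.log_one, h.map_zero]
  · intro r
    simp [← add_smul, h.right_inv _ (hγ 1)]

lemma image_smallPaths_mem_nhds (h : HasLocalLog V s L W) :
    ((↑) '' h.smallPaths : Set (UnivCover K)) ∈ 𝓝 (1 : UnivCover K) :=
  (QuotientGroup.isOpenMap_coe.image_mem_nhds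
    (h.isOpen_smallPaths.mem_nhds h.one_mem_smallPaths) :)

lemma eq_one_of_small (h : HasLocalLog V s L W) {u : UnivCover K}
    (hu : u ∈ ((↑) '' h.smallPaths : Set (UnivCover K)))
    (hu1 : univProj K u = 1) : u = 1 := by
  obtain ⟨γ, hγ, rfl⟩ := hu
  rw [univProj_mk] at hu1
  rw [h.smallPaths_eq hγ, hu1, h.log_one, h.ray_zero]
  rfl

lemma isOpenMap_univProj (h : HasLocalLog V s L W) : IsOpenMap (univProj K) := by
  rw [IsTopologicalGroup.isOpenMap_iff_nhds_one]
  intro A hA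
  rw [Filter.mem_map] at hA
  have h1 : (univProj K) ⁻¹' A ∈ 𝓝 ((1 : pathGroup K) : UnivCover K) := hA
  have hL : ContinuousAt L 1 := h.contOn.continuousAt (h.isOpen.mem_nhds h.one_mem)
  have h2 : Filter.Tendsto (fun w => (h.ray (L w) : UnivCover K)) (𝓝 1) (𝓝 1) := by
    have h4 : ContinuousAt (fun w => (h.ray (L w) : UnivCover K)) 1 :=
      (continuous_quot_mk.comp h.continuous_ray).continuousAt.comp hL
    have := h4.tendsto
    rwa [h.log_one, h.ray_zero] at this
  filter_upwards [h2 h1, h.isOpen.mem_nhds h.one_mem] with w hw hwW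
  have h3 : univProj K (h.ray (L w) : UnivCover K) ∈ A := hw
  rwa [univProj_mk, ray_apply, Set.Icc.coe_one, one_smul, h.right_inv _ hwW] at h3

lemma univProj_surjective (h : HasLocalLog V s L W) [ConnectedSpace K] :
    Function.Surjective (univProj K) := by
  rw [← MonoidHom.range_eq_top]
  have hO : IsOpen ((univProj K).range : Set K) := by
    rw [MonoidHom.coe_range]
    have := h.isOpenMap_univProj (K := K)
    exact IsOpenMap.isOpen_range this
  have hC := Subgroup.isClosed_of_isOpen _ hO
  have hu := IsClopen.eq_univ (s := ((univProj K).range : Set K)) ⟨hC, hO⟩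
    ⟨1, (univProj K).range.one_mem⟩
  exact SetLike.coe_injective hu

lemma discrete_ker (h : HasLocalLog V s L W) : DiscreteTopology (univProj K).ker := by
  rw [discreteTopology_iff_isOpen_singleton_one]
  rw [isOpen_singleton_iff_nhds_eq_pure, nhds_subtype_eq_comap]
  refine le_antisymm ?_
    (nhds_subtype_eq_comap (p := fun u => u ∈ (univProj K).ker) ▸
      pure_le_nhds (1 : (univProj K).ker))
  rw [Filter.le_pure_iff]
  refine ⟨_, h.image_smallPaths_mem_nhds, ?_⟩
  rintro ⟨u, hu⟩ hu'
  exact Subtype.ext (h.eq_one_of_small hu' hu)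

lemma t2Space (h : HasLocalLog V s L W) [T2Space K] : T2Space (UnivCover K) := by
  have : T1Space (UnivCover K) := by
    refine IsTopologicalGroup.t1Space _ ?_
    rw [← isOpen_compl_iff, isOpen_iff_mem_nhds]
    intro u hu
    by_cases h1 : univProj K u = 1
    · have h2 : Filter.Tendsto (fun v : UnivCover K => v⁻¹ * u) (𝓝 u) (𝓝 1) := by
        have : Continuous (fun v : UnivCover K => v⁻¹ * u) := by fun_prop
        exact this.tendsto' _ _ (by simp)
      filter_upwards [h2 h.image_smallPaths_mem_nhds] with v hv hv1
      rw [Set.mem_singleton_iff] at hv1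
      subst hv1
      refine hu (h.eq_one_of_small (u := u) ?_ h1)
      simpa using hv
    · have h2 : (univProj K) ⁻¹' {1}ᶜ ∈ 𝓝 u :=
        (isOpen_compl_singleton.preimage continuous_univProj).mem_nhds h1
      filter_upwards [h2] with v hv hv1
      rw [Set.mem_singleton_iff] at hv1
      subst hv1
      simp at hv
  infer_instance

lemma isCoveringMap (h : HasLocalLog V s L W) [ConnectedSpace K] : IsCoveringMap (univProj K) := by
  have hq : IsQuotientMap (univProj K) :=
    h.isOpenMap_univProj.isQuotientMap continuous_univProj h.univProj_surjective
  refine (hq.isQuotientCoveringMap_of_isDiscrete_ker_monoidHom ?_).isCoveringMap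
  have := h.discrete_ker
  exact ⟨this⟩

lemma simplyConnectedSpace (h : HasLocalLog V s L W) [ConnectedSpace K] :
    SimplyConnectedSpace (UnivCover K) := by
  have hcov := h.isCoveringMap
  rw [simply_connected_iff_loops_nullhomotopic]
  refine ⟨inferInstanceAs (PathConnectedSpace (Quotient _)), ?_⟩
  intro u c
  let γ : pathGroup K := ⟨⟨fun t => (univProj K u)⁻¹ * univProj K (c t), by
    have := continuous_univProj (K := K)
    fun_prop⟩, by simp [mem_pathGroup]⟩
  have hγ : ∀ t, γ.1 t = (univProj K u)⁻¹ * univProj K (c t) := fun t => rfl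
  let Γ : C(I, UnivCover K) := ⟨fun r => u * (truncPath γ r : UnivCover K),
    continuous_const.mul (continuous_quot_mk.comp (continuous_truncPath γ))⟩
  let πc : C(I, K) := ⟨fun t => univProj K (c t), continuous_univProj.comp c.continuous⟩
  have h0 : πc 0 = univProj K u := by simp [πc]
  have hΓ : Γ = hcov.liftPath πc u h0 := by
    rw [hcov.eq_liftPath_iff']
    constructor
    · ext t
      simp [Γ, πc, univProj_mk, truncPath_apply, hγ]
    · simp [Γ, truncPath_zero]
  have hc : c.toContinuousMap = hcov.liftPath πc u h0 := by
    rw [hcov.eq_liftPath_iff']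
    constructor
    · ext t
      simp [πc]
    · simp
  have h1 : Γ 1 = u := by rw [hΓ, ← hc]; simp
  have h2 : γ ∈ nullLoops K := by
    rw [← QuotientGroup.eq_one_iff]
    have h3 : u * (truncPath γ 1 : UnivCover K) = u := h1
    rwa [truncPath_one, mul_eq_left] at h3
  obtain ⟨H, H0, H1, H2, H3⟩ := h2
  refine (hcov.homotopicRel_iff_comp (f₀ := c.toContinuousMap) (f₁ := ContinuousMap.const I u)
    ⟨0, by simp, by simp⟩).mpr ⟨⟨⟨⟨fun x => univProj K u * H x, by fun_prop⟩, ?_, ?_⟩, ?_⟩⟩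
  · intro t
    simp [H0, hγ]
  · intro t
    simp [H1]
  · rintro r t (rfl | rfl)
    · simp [H2]
    · simp [H3]
end HasLocalLog
end UniversalCover

section LocalLog
set_option linter.unusedSectionVars false
open Topology unitInterval

namespace HasLocalLog

variable {K : Type*} [Group K] [TopologicalSpace K] [IsTopologicalGroup K]
variable {V : Type*} [NormedAddCommGroup V] [NormedSpace ℝ V] {s : V → K} {L : K → V} {W : Set K}

lemma isTopManifold [FiniteDimensional ℝ V] (h : HasLocalLog V s L W)
    (hl : ∀ᶠ X in 𝓝 0, L (s X) = X) : IsTopManifold K := by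
  obtain ⟨O, hOl, hO, hO0⟩ := mem_nhds_iff.1 hl
  intro g
  let e := toEuclidean (E := V)
  have hW₁ : IsOpen (W ∩ L ⁻¹' O) := h.contOn.isOpen_inter_preimage h.isOpen hO
  have hV₁ : IsOpen (O ∩ s ⁻¹' W) := hO.inter (h.isOpen.preimage h.cont)
  refine ⟨Module.finrank ℝ V, (fun x => g⁻¹ * x) ⁻¹' (W ∩ L ⁻¹' O),
    e.symm ⁻¹' (O ∩ s ⁻¹' W), hW₁.preimage (by fun_prop), ?_, hV₁.preimage e.symm.continuous, ⟨?_⟩⟩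
  · simp only [Set.mem_preimage, inv_mul_cancel, Set.mem_inter_iff, h.log_one]
    exact ⟨h.one_mem, hO0⟩
  · exact
      { toFun := fun x => ⟨e (L (g⁻¹ * x)), by
          have h1 : g⁻¹ * (x : K) ∈ W := x.2.1
          have h2 : L (g⁻¹ * (x : K)) ∈ O := x.2.2
          simp only [Set.mem_preimage, ContinuousLinearEquiv.symm_apply_apply, Set.mem_inter_iff]
          exact ⟨h2, by rwa [h.right_inv _ h1]⟩⟩
        invFun := fun y => ⟨g * s (e.symm y), by
          have h1 : e.symm (y : EuclideanSpace ℝ (Fin (Module.finrank ℝ V))) ∈ O := y.2.1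
          have h2 : s (e.symm (y : EuclideanSpace ℝ (Fin (Module.finrank ℝ V)))) ∈ W := y.2.2
          have h3 : L (s (e.symm (y : EuclideanSpace ℝ (Fin (Module.finrank ℝ V))))) = _ := hOl h1
          simp only [Set.mem_preimage, inv_mul_cancel_left, Set.mem_inter_iff]
          exact ⟨h2, by rwa [h3]⟩⟩
        left_inv := fun x => by
          have h1 : g⁻¹ * (x : K) ∈ W := x.2.1
          ext
          simp [h.right_inv _ h1]
        right_inv := fun y => by
          have h1 : e.symm (y : EuclideanSpace ℝ (Fin (Module.finrank ℝ V))) ∈ O := y.2.1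
          have h3 : L (s (e.symm (y : EuclideanSpace ℝ (Fin (Module.finrank ℝ V))))) = _ := hOl h1
          apply Subtype.ext
          simp only [inv_mul_cancel_left, h3, ContinuousLinearEquiv.apply_symm_apply]
        continuous_toFun := by
          refine Continuous.subtype_mk (e.continuous.comp ?_) _
          exact h.contOn.comp_continuous (by fun_prop) fun x => x.2.1
        continuous_invFun := by
          refine Continuous.subtype_mk (continuous_const.mul (h.cont.comp ?_)) _
          exact e.symm.continuous.comp continuous_subtype_val }

/-- The local logarithm of the universal covering group. -/
lemma univ (h : HasLocalLog V s L W) : HasLocalLog V (fun X => (h.ray X : UnivCover K))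
    (fun u => L (univProj K u)) ((↑) '' h.smallPaths) where
  cont := continuous_quot_mk.comp h.continuous_ray
  isOpen := QuotientGroup.isOpenMap_coe _ h.isOpen_smallPaths
  one_mem := ⟨1, h.one_mem_smallPaths, rfl⟩
  contOn := by
    refine h.contOn.comp continuous_univProj.continuousOn ?_
    rintro _ ⟨γ, hγ, rfl⟩
    exact hγ 1
  right_inv := by
    rintro _ ⟨γ, hγ, rfl⟩
    rw [univProj_mk, ← h.smallPaths_eq hγ]
  log_one := by rw [map_one, h.log_one]

lemma univProj_ray (h : HasLocalLog V s L W) (X : V) :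
    univProj K (h.ray X : UnivCover K) = s X := by
  rw [univProj_mk, ray_apply, Set.Icc.coe_one, one_smul]

lemma exists_compact_nhds [FiniteDimensional ℝ V] (h : HasLocalLog V s L W) :
    ∃ C ∈ 𝓝 (1 : K), IsCompact C := by
  have : ProperSpace V := FiniteDimensional.proper ℝ V
  refine ⟨s '' Metric.closedBall 0 1, ?_, (isCompact_closedBall 0 1).image h.cont⟩
  have h1 : ContinuousAt L 1 := h.contOn.continuousAt (h.isOpen.mem_nhds h.one_mem)
  have h2 : ∀ᶠ w in 𝓝 (1 : K), L w ∈ Metric.closedBall 0 1 :=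
    h1 (by rw [h.log_one]; exact Metric.closedBall_mem_nhds _ one_pos)
  filter_upwards [h2, h.isOpen.mem_nhds h.one_mem] with w hw hwW
  exact ⟨L w, hw, h.right_inv w hwW⟩

end HasLocalLog

namespace AlgRep
variable {G : Type*} [Group G] [TopologicalSpace G] [IsTopologicalGroup G] [CompactSpace G]
  [T2Space G]

/-- The exponential map of a compact group with a finite-dimensional representation. -/
noncomputable def ex (R : AlgRep G) (X : R.lie) : G := (R.mem_lie.1 X.2 1).choose

lemma ρ_ex (R : AlgRep G) (X : R.lie) : R.ρ (R.ex X) = NormedSpace.exp (X : R.A) := by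
  have := (R.mem_lie.1 X.2 1).choose_spec
  exact this.trans (by rw [one_smul])

lemma continuous_ex (R : AlgRep G) (hR : Function.Injective R.ρ) : Continuous R.ex := by
  rw [(R.cont.isClosedEmbedding hR).isInducing.continuous_iff]
  exact (nexp_continuous.comp continuous_subtype_val).congr fun X => (R.ρ_ex X).symm

lemma exists_hasLocalLog (R : AlgRep G) (hR : Function.Injective R.ρ) :
    ∃ (L : G → R.lie) (W : Set G), HasLocalLog R.lie R.ex L W ∧
      ∀ᶠ X in 𝓝 0, L (R.ex X) = X := by
  classical
  obtain ⟨L, O, hO, W, hW, hL, hLX⟩ := exists_log (A := R.A)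
  have hL1 : L 1 = 0 := by
    have := hLX 0 (mem_of_mem_nhds hO)
    rwa [NormedSpace.exp_zero] at this
  have h1 := (R.eventually_exists_exp hO).and
    ((R.cont.tendsto' 1 1 (map_one _)).eventually (eventually_mem_nhds_iff.2 hW))
  obtain ⟨W', hW_sub, hW', hW_one⟩ := mem_nhds_iff.1 h1
  let L' : G → R.lie := fun g => if hg : L (R.ρ g) ∈ R.lie then ⟨L (R.ρ g), hg⟩ else 0
  have hL' : ∀ g ∈ W', (L' g : R.A) = L (R.ρ g) ∧ NormedSpace.exp (L (R.ρ g)) = R.ρ g := by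
    intro g hg
    obtain ⟨X, hX, hXO, hXe⟩ := (hW_sub hg).1
    have h2 : L (R.ρ g) = X := by rw [← hXe, hLX X hXO]
    have h3 : L (R.ρ g) ∈ R.lie := h2 ▸ hX
    refine ⟨by simp only [L', dif_pos h3], by rw [h2, hXe]⟩
  have hLex : ∀ X : R.lie, (X : R.A) ∈ O → L' (R.ex X) = X := by
    intro X hX
    have h2 : L (R.ρ (R.ex X)) = X := by rw [R.ρ_ex, hLX _ hX]
    have h3 : L (R.ρ (R.ex X)) ∈ R.lie := h2 ▸ X.2
    ext
    simp only [L', dif_pos h3, h2]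
  refine ⟨L', W', ⟨R.continuous_ex hR, hW', hW_one, ?_, ?_, ?_⟩, ?_⟩
  · rw [Topology.IsInducing.subtypeVal.continuousOn_iff]
    refine ContinuousOn.congr (f := fun g => L (R.ρ g)) ?_ fun g hg => (hL' g hg).1
    exact fun g hg =>
      ((hL.continuousAt (hW_sub hg).2).comp R.cont.continuousAt).continuousWithinAt
  · intro w hw
    apply hR
    rw [R.ρ_ex, (hL' w hw).1, (hL' w hw).2]
  · ext
    rw [(hL' 1 hW_one).1, map_one, hL1]
    rfl
  · have : Filter.Tendsto (fun X : R.lie => (X : R.A)) (𝓝 0) (𝓝 0) :=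
      continuous_subtype_val.tendsto' _ _ rfl
    filter_upwards [this hO] with X hX using hLex X hX
end AlgRep
end LocalLog

section Weyl
open Topology MeasureTheory

variable {K : Type*} [Group K] [TopologicalSpace K] [IsTopologicalGroup K] [CompactSpace K]
  [T2Space K] {U : Type*} [Group U] [TopologicalSpace U] [IsTopologicalGroup U] {π : U →* K}

/-- A continuous function on a central extension which is equivariant along the fibres. -/
lemma exists_twisted_function (hπ : Continuous π) (hs : Function.Surjective π)
    (hd : DiscreteTopology π.ker) (hz : π.ker ≤ Subgroup.center U) {W : Set K} {σ : K → U}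
    (hW : IsOpen W) (h1 : (1 : K) ∈ W) (hσ : ContinuousOn σ W) (hσπ : ∀ w ∈ W, π (σ w) = w)
    {χ : U → ℝ} (hχ : ∀ a ∈ π.ker, ∀ b ∈ π.ker, χ (a * b) = χ a + χ b) :
    ∃ f : U → ℝ, Continuous f ∧ ∀ z ∈ π.ker, ∀ x, f (z * x) = χ z + f x := by
  classical
  obtain ⟨h₀, h00, h01, -⟩ := exists_continuous_zero_one_of_isClosed hW.isClosed_compl
    (isClosed_singleton (x := (1 : K))) (by simpa using h1)
  let h : K → ℝ := fun k => max (h₀ k - 1 / 2) 0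
  have hh : Continuous h := by fun_prop
  have hh0 : ∀ k, 0 ≤ h k := fun k => le_max_right _ _
  have hh1 : 0 < h 1 := by
    have : h₀ 1 = 1 := h01 rfl
    simp only [h, this]
    norm_num
  let c : U → ℝ := fun v => χ (v * (σ (π v))⁻¹)
  have hck : ∀ v, π v ∈ W → v * (σ (π v))⁻¹ ∈ π.ker := fun v hv => by
    rw [MonoidHom.mem_ker, map_mul, map_inv, hσπ _ hv, mul_inv_cancel]
  have hcz : ∀ z ∈ π.ker, ∀ v, π v ∈ W → c (z * v) = χ z + c v := fun z hz v hv => by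
    have : π (z * v) = π v := by rw [map_mul, hz, one_mul]
    simp only [c]
    rw [this, mul_assoc, hχ z hz _ (hck v hv)]
  have hχc : ContinuousOn χ (π.ker : Set U) := by
    rw [continuousOn_iff_continuous_domRestrict]
    exact continuous_of_discreteTopology
  have hcc : ContinuousOn c (π ⁻¹' W) := by
    refine hχc.comp ?_ fun v hv => hck v hv
    exact continuousOn_id.mul (hσ.comp hπ.continuousOn fun v hv => hv).inv
  let f₀ : U → ℝ := fun v => h (π v) * c v
  have hf₀ : Continuous f₀ := by
    rw [continuous_iff_continuousAt]
    intro v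
    by_cases hv : π v ∈ W
    · exact (hh.comp hπ).continuousAt.mul
        (hcc.continuousAt ((hW.preimage hπ).mem_nhds hv))
    · have h2 : h₀ (π v) = 0 := h00 hv
      have h3 : ∀ᶠ w in 𝓝 v, h₀ (π w) < 1 / 2 := by
        have : Continuous fun w => h₀ (π w) := by fun_prop
        refine this.continuousAt.eventually_lt_const ?_
        change h₀ (π v) < 1 / 2
        rw [h2]
        norm_num
      have h4 : f₀ =ᶠ[𝓝 v] fun _ => 0 := by
        filter_upwards [h3] with w hw
        have : h (π w) = 0 := max_eq_right (by linarith)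
        simp [f₀, this]
      exact continuousAt_const.congr h4.symm
  have hf₀z : ∀ z ∈ π.ker, ∀ v, f₀ (z * v) = χ z * h (π v) + f₀ v := fun z hz v => by
    have h2 : π (z * v) = π v := by rw [map_mul, hz, one_mul]
    by_cases hv : π v ∈ W
    · simp only [f₀, h2, hcz z hz v hv]
      ring
    · have h3 : h₀ (π v) = 0 := h00 hv
      have h4 : h (π v) = 0 := max_eq_right (by rw [h3]; norm_num)
      simp [f₀, h2, h4]
  obtain ⟨t, ht⟩ := (isCompact_univ (X := K)).elim_finite_subcover
    (fun u : U => {k | 0 < h ((π u)⁻¹ * k)})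
    (fun u => isOpen_lt continuous_const (by fun_prop)) (fun k _ => by
      obtain ⟨u, rfl⟩ := hs k
      exact Set.mem_iUnion.2 ⟨u, by simpa using hh1⟩)
  let D : U → ℝ := fun x => ∑ u ∈ t, h (π (u⁻¹ * x))
  have hD : ∀ x, 0 < D x := fun x => by
    have h2 := ht (Set.mem_univ (π x))
    simp only [Set.mem_iUnion] at h2
    obtain ⟨u, hu, hux⟩ := h2
    refine Finset.sum_pos' (fun _ _ => hh0 _) ⟨u, hu, ?_⟩
    rw [map_mul, map_inv]
    exact hux
  have hDc : Continuous D := by fun_prop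
  refine ⟨fun x => (∑ u ∈ t, f₀ (u⁻¹ * x)) / D x, ?_, ?_⟩
  · exact (by fun_prop : Continuous fun x => ∑ u ∈ t, f₀ (u⁻¹ * x)).div hDc fun x => (hD x).ne'
  · intro z hzk x
    have h2 : ∀ u, u⁻¹ * (z * x) = z * (u⁻¹ * x) := fun u => by
      rw [← mul_assoc, ← mul_assoc, Subgroup.mem_center_iff.1 (hz hzk) u⁻¹]
    have h3 : D (z * x) = D x := by
      simp only [D, h2]
      refine Finset.sum_congr rfl fun u _ => ?_
      rw [map_mul, hzk, one_mul]
    simp only [h2, hf₀z z hzk, h3]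
    rw [Finset.sum_add_distrib, ← Finset.mul_sum, add_div, mul_div_assoc]
    change χ z * (D x / D x) + _ = _
    rw [div_self (hD x).ne', mul_one]

/-- Homomorphisms from the kernel of a central extension of a compact group to the reals
extend to the whole group. -/
lemma exists_hom_extension (hπ : Continuous π) (hs : Function.Surjective π) (ho : IsOpenMap π)
    (hd : DiscreteTopology π.ker) (hz : π.ker ≤ Subgroup.center U) {W : Set K} {σ : K → U}
    (hW : IsOpen W) (h1 : (1 : K) ∈ W) (hσ : ContinuousOn σ W) (hσπ : ∀ w ∈ W, π (σ w) = w)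
    {χ : U → ℝ} (hχ : ∀ a ∈ π.ker, ∀ b ∈ π.ker, χ (a * b) = χ a + χ b) :
    ∃ φ : U → ℝ, Continuous φ ∧ (∀ x y, φ (x * y) = φ x + φ y) ∧ ∀ z ∈ π.ker, φ z = χ z := by
  obtain ⟨f, hf, hfz⟩ := exists_twisted_function hπ hs hd hz hW h1 hσ hσπ hχ
  borelize K
  obtain ⟨μ, hμ, hμl⟩ := exists_mean K
  let r : K → U := Function.surjInv hs
  have hr : ∀ k, π (r k) = k := Function.surjInv_eq hs
  let G : U × K → ℝ := fun p => f (p.1 * r p.2) - f (r p.2)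
  have hG : ∀ x y, G (x, π y) = f (x * y) - f y := fun x y => by
    obtain ⟨z, hzk, hy⟩ : ∃ z ∈ π.ker, r (π y) = z * y :=
      ⟨r (π y) * y⁻¹, by simp [MonoidHom.mem_ker, hr], by simp⟩
    simp only [G, hy]
    rw [← mul_assoc, Subgroup.mem_center_iff.1 (hz hzk) x, mul_assoc, hfz z hzk, hfz z hzk]
    ring
  have hGc : Continuous G := by
    have hq : IsQuotientMap (Prod.map id π : U × U → U × K) :=
      (IsOpenMap.id.prodMap ho).isQuotientMap (continuous_id.prodMap hπ)
        (Function.surjective_id.prodMap hs)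
    rw [hq.continuous_iff]
    have : G ∘ Prod.map id π = fun p => f (p.1 * p.2) - f p.2 := by
      ext ⟨x, y⟩
      exact hG x y
    rw [this]
    fun_prop
  let Gc : C(U, C(K, ℝ)) := ContinuousMap.curry ⟨G, hGc⟩
  have hI : ∀ g : C(K, ℝ), Integrable g μ := fun g => g.continuous.integrable_of_compactSpace μ
  have hIc : Continuous fun g : C(K, ℝ) => ∫ k, g k ∂μ := by
    refine LipschitzWith.continuous (K := 1) (LipschitzWith.of_dist_le_mul fun g g' => ?_)
    rw [dist_eq_norm, dist_eq_norm, ← integral_sub (hI g) (hI g'), NNReal.coe_one, one_mul]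
    have := norm_integral_le_of_norm_le_const (μ := μ) (f := fun k => g k - g' k) (C := ‖g - g'‖)
      (Filter.Eventually.of_forall fun k => (g - g').norm_coe_le_norm k)
    simpa using this
  have hGI : ∀ x, Integrable (fun k => G (x, k)) μ := fun x => hI (Gc x)
  refine ⟨fun x => ∫ k, G (x, k) ∂μ, hIc.comp Gc.continuous, ?_, ?_⟩
  · intro x y
    have h2 : ∀ k, G (x * y, k) = G (x, π y * k) + G (y, k) := fun k => by
      obtain ⟨v, rfl⟩ := hs k
      rw [← map_mul, hG, hG, hG, mul_assoc]
      ring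
    simp_rw [h2]
    rw [integral_add _ (hGI y)]
    · rw [integral_mul_left_eq_self (fun k => G (x, k))]
    · exact (hGc.comp (by fun_prop : Continuous fun k => (x, π y * k))).integrable_of_compactSpace μ
  · intro z hzk
    have h2 : ∀ k, G (z, k) = χ z := fun k => by
      obtain ⟨v, rfl⟩ := hs k
      rw [hG, hfz z hzk]
      ring
    simp [h2]

/-- If the compact quotient has no characters, the kernel has no homomorphisms to `ℤ`. -/
lemma eq_zero_of_hom_int [ConnectedSpace U] (hπ : Continuous π) (hs : Function.Surjective π)
    (ho : IsOpenMap π)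
    (hd : DiscreteTopology π.ker) (hz : π.ker ≤ Subgroup.center U) {W : Set K} {σ : K → U}
    (hW : IsOpen W) (h1 : (1 : K) ∈ W) (hσ : ContinuousOn σ W) (hσπ : ∀ w ∈ W, π (σ w) = w)
    (hθ : ∀ θ : K →* ℂ, Continuous θ → ∀ k, θ k = 1)
    (χ : π.ker →* Multiplicative ℤ) : χ = 1 := by
  classical
  let χ' : U → ℝ := fun u => if hu : u ∈ π.ker then ((χ ⟨u, hu⟩).toAdd : ℝ) else 0
  have hχ' : ∀ z (hz : z ∈ π.ker), χ' z = ((χ ⟨z, hz⟩).toAdd : ℝ) := fun z hz => dif_pos hz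
  obtain ⟨φ, hφ, hφm, hφz⟩ := exists_hom_extension hπ hs ho hd hz hW h1 hσ hσπ (χ := χ')
    (fun a ha b hb => by
      rw [hχ' a ha, hχ' b hb, hχ' _ (mul_mem ha hb), ← Int.cast_add, ← toAdd_mul, ← map_mul]
      rfl)
  have hφ1 : φ 1 = 0 := by simpa using hφm 1 1
  let E : U → ℂ := fun u => Complex.exp (φ u * (2 * Real.pi * Complex.I))
  have hE : ∀ u v, E (u * v) = E u * E v := fun u v => by
    simp only [E]
    rw [hφm, ← Complex.exp_add]
    push_cast
    ring_nf
  have hEz : ∀ z ∈ π.ker, E z = 1 := fun z hz => by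
    simp only [E]
    rw [hφz z hz, hχ' z hz]
    exact_mod_cast Complex.exp_int_mul_two_pi_mul_I _
  let r : K → U := Function.surjInv hs
  have hr : ∀ k, π (r k) = k := Function.surjInv_eq hs
  have hEr : ∀ u, E (r (π u)) = E u := fun u => by
    have h2 : r (π u) * u⁻¹ ∈ π.ker := by simp [MonoidHom.mem_ker, hr]
    have h3 := hE (r (π u) * u⁻¹) u
    rwa [hEz _ h2, one_mul, inv_mul_cancel_right] at h3
  let θ : K →* ℂ :=
    { toFun := fun k => E (r k)
      map_one' := by rw [← map_one π, hEr, hEz _ (one_mem _)]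
      map_mul' := fun a b => by
        obtain ⟨u, rfl⟩ := hs a
        obtain ⟨v, rfl⟩ := hs b
        rw [← map_mul, hEr, hEr, hEr, hE] }
  have hθc : Continuous θ := by
    rw [(ho.isQuotientMap hπ hs).continuous_iff]
    have : θ ∘ π = E := funext hEr
    rw [this]
    fun_prop
  have hE1 : ∀ u, E u = 1 := fun u => by
    rw [← hEr]
    exact hθ θ hθc (π u)
  have hval : ∀ u, ∃ n : ℤ, (n : ℝ) = φ u := fun u => by
    obtain ⟨n, hn⟩ := Complex.exp_eq_one_iff.1 (hE1 u)
    refine ⟨n, ?_⟩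
    have h2 := mul_right_cancel₀ Complex.two_pi_I_ne_zero hn
    exact_mod_cast h2.symm
  choose n hn using hval
  have hnc : Continuous n := by
    rw [Int.isClosedEmbedding_coe_real.isInducing.continuous_iff]
    exact hφ.congr fun u => (hn u).symm
  ext z
  have h2 : φ z = 0 := by
    rw [← hn, PreconnectedSpace.constant (inferInstance : PreconnectedSpace U) hnc (y := 1), hn, hφ1]
  rw [hφz z z.2, hχ' z z.2] at h2
  exact_mod_cast h2
end Weyl

section Weyl
set_option linter.unusedSectionVars false
open Topology MeasureTheory

variable {K : Type*} [Group K] [TopologicalSpace K] [IsTopologicalGroup K] [CompactSpace K]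
  [T2Space K] {U : Type*} [Group U] [TopologicalSpace U] [IsTopologicalGroup U] {π : U →* K}

/-- A discrete normal subgroup of a connected group is central. -/
lemma le_center_of_discrete {U : Type*} [Group U] [TopologicalSpace U] [IsTopologicalGroup U]
    [ConnectedSpace U] (N : Subgroup U) [N.Normal] (hd : DiscreteTopology N) :
    N ≤ Subgroup.center U := by
  intro z hz
  rw [Subgroup.mem_center_iff]
  intro g
  let c : U → N := fun g => ⟨g * z * g⁻¹, ‹N.Normal›.conj_mem z hz g⟩
  have hc : Continuous c := Continuous.subtype_mk (by fun_prop) _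
  have h1 := PreconnectedSpace.constant (inferInstance : PreconnectedSpace U) hc (x := g) (y := 1)
  have h2 : g * z * g⁻¹ = 1 * z * 1⁻¹ := congrArg Subtype.val h1
  rw [one_mul, inv_one, mul_one] at h2
  rw [← mul_inv_eq_iff_eq_mul, h2]

/-- A compact set with large interior meeting all fibres. -/
lemma exists_compact_transversal (hs : Function.Surjective π) (ho : IsOpenMap π)
    {C₀ : Set U} (hC₀ : C₀ ∈ 𝓝 1) (hC₀c : IsCompact C₀) :
    ∃ C O : Set U, IsCompact C ∧ IsOpen O ∧ O ⊆ C ∧ 1 ∈ O ∧ ∀ u, ∃ z ∈ π.ker, u * z ∈ O := by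
  classical
  obtain ⟨Q, hQC, hQ, hQ1⟩ := mem_nhds_iff.1 hC₀
  obtain ⟨t, ht⟩ := (isCompact_univ (X := K)).elim_finite_subcover
    (fun u : U => π '' ((fun x => u * x) '' Q))
    (fun u => ho _ ((isOpenMap_mul_left u) _ hQ)) (fun k _ => by
      obtain ⟨u, rfl⟩ := hs k
      exact Set.mem_iUnion.2 ⟨u, u, ⟨1, hQ1, mul_one u⟩, rfl⟩)
  let t' := insert 1 t
  refine ⟨⋃ u ∈ t', (fun x => u * x) '' C₀, ⋃ u ∈ t', (fun x => u * x) '' Q,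
    t'.isCompact_biUnion fun u _ => hC₀c.image (by fun_prop),
    isOpen_biUnion fun u _ => (isOpenMap_mul_left u) _ hQ,
    Set.iUnion₂_mono fun u _ => Set.image_mono hQC, ?_, ?_⟩
  · exact Set.mem_iUnion₂.2 ⟨1, Finset.mem_insert_self _ _, 1, hQ1, mul_one 1⟩
  · intro u
    have h1 := ht (Set.mem_univ (π u))
    simp only [Set.mem_iUnion] at h1
    obtain ⟨v, hv, x, hx, hxu⟩ := h1
    refine ⟨u⁻¹ * x, by rw [MonoidHom.mem_ker, map_mul, map_inv, hxu, inv_mul_cancel], ?_⟩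
    rw [mul_inv_cancel_left]
    exact Set.mem_iUnion₂.2 ⟨v, Finset.mem_insert_of_mem hv, hx⟩

/-- The kernel of a covering of a compact group by a connected locally compact group is
finitely generated. -/
lemma fg_ker [ConnectedSpace U] (hπ : Continuous π) (hd : DiscreteTopology π.ker)
    (hz : π.ker ≤ Subgroup.center U) {C O : Set U} (hC : IsCompact C) (hO : IsOpen O)
    (hOC : O ⊆ C) (h1 : 1 ∈ O) (hker : ∀ u, ∃ z ∈ π.ker, u * z ∈ O) : π.ker.FG := by
  classical
  obtain ⟨F, hF⟩ := (hC.mul hC).elim_finite_subcover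
    (fun z : π.ker => {x | x * z ∈ O}) (fun z => hO.preimage (by fun_prop)) (fun x _ => by
      obtain ⟨z, hz, hx⟩ := hker x
      exact Set.mem_iUnion.2 ⟨⟨z, hz⟩, hx⟩)
  have hkc : IsClosed (π.ker : Set U) := isClosed_singleton.preimage hπ
  have hfin : (C ∩ π.ker).Finite := by
    have h2 : IsCompact (C ∩ π.ker) := hC.inter_right hkc
    exact h2.finite ⟨DiscreteTopology.of_subset (s := (π.ker : Set U)) hd Set.inter_subset_right⟩
  let S : Set U := (fun z : π.ker => (z : U)) '' F ∪ (C ∩ π.ker)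
  have hSfin : S.Finite := (F.finite_toSet.image _).union hfin
  have hSk : Subgroup.closure S ≤ π.ker := by
    rw [Subgroup.closure_le]
    rintro x (⟨z, -, rfl⟩ | hx)
    exacts [z.2, hx.2]
  have hmul : ∀ x ∈ C, ∀ y ∈ C, ∃ c ∈ C, ∃ γ ∈ Subgroup.closure S, x * y = c * γ := by
    intro x hx y hy
    have h2 := hF (Set.mul_mem_mul hx hy)
    simp only [Set.mem_iUnion] at h2
    obtain ⟨z, hzF, hxz⟩ := h2
    refine ⟨x * y * z, hOC hxz, (z : U)⁻¹, inv_mem (Subgroup.subset_closure (Or.inl ⟨z, hzF, rfl⟩)),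
      ?_⟩
    rw [mul_inv_cancel_right]
  have htop : ∀ u : U, ∃ c ∈ C, ∃ γ ∈ Subgroup.closure S, u = c * γ := by
    have hQ : IsOpen (O ∩ O⁻¹) := hO.inter hO.inv
    have hcl : Subgroup.closure (O ∩ O⁻¹) = ⊤ := by
      have h2 : IsOpen (Subgroup.closure (O ∩ O⁻¹) : Set U) :=
        Subgroup.isOpen_of_mem_nhds _ (g := 1) (Filter.mem_of_superset
          (hQ.mem_nhds ⟨h1, by simpa using h1⟩) Subgroup.subset_closure)
      have h3 := IsClopen.eq_univ (s := (Subgroup.closure (O ∩ O⁻¹) : Set U))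
        ⟨Subgroup.isClosed_of_isOpen _ h2, h2⟩ ⟨1, (Subgroup.closure (O ∩ O⁻¹)).one_mem⟩
      exact SetLike.coe_injective h3
    have key : ∀ x y, y ∈ C → (∃ c ∈ C, ∃ γ ∈ Subgroup.closure S, x = c * γ) →
        ∃ c ∈ C, ∃ γ ∈ Subgroup.closure S, x * y = c * γ := by
      rintro x y hy ⟨c, hc, γ, hγ, rfl⟩
      obtain ⟨c', hc', γ', hγ', h2⟩ := hmul c hc y hy
      refine ⟨c', hc', γ' * γ, mul_mem hγ' hγ, ?_⟩
      rw [mul_assoc, ← Subgroup.mem_center_iff.1 (hz (hSk hγ)) y, ← mul_assoc, h2, mul_assoc]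
    intro u
    have hu : u ∈ Subgroup.closure (O ∩ O⁻¹) := hcl ▸ Subgroup.mem_top u
    induction hu using Subgroup.closure_induction_right with
    | one => exact ⟨1, hOC h1, 1, one_mem _, (mul_one 1).symm⟩
    | mul_right x hx y hy ih => exact key x y (hOC hy.1) ih
    | mul_inv_cancel x hx y hy ih => exact key x y⁻¹ (hOC hy.2) ih
  refine (Subgroup.fg_iff _).2 ⟨S, le_antisymm hSk fun z hz => ?_, hSfin⟩
  obtain ⟨c, hc, γ, hγ, rfl⟩ := htop z
  refine mul_mem (Subgroup.subset_closure (Or.inr ⟨hc, ?_⟩)) hγ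
  have := mul_mem hz (inv_mem (hSk hγ))
  rwa [mul_inv_cancel_right] at this

/-- Weyl's theorem: a covering of a compact group without characters by a connected locally
compact group is compact and has finite kernel. -/
lemma compactSpace_and_finite_ker [ConnectedSpace U] (hπ : Continuous π)
    (hs : Function.Surjective π)
    (ho : IsOpenMap π) (hd : DiscreteTopology π.ker) {W : Set K} {σ : K → U}
    (hW : IsOpen W) (h1 : (1 : K) ∈ W) (hσ : ContinuousOn σ W) (hσπ : ∀ w ∈ W, π (σ w) = w)
    (hθ : ∀ θ : K →* ℂ, Continuous θ → ∀ k, θ k = 1) {C₀ : Set U} (hC₀ : C₀ ∈ 𝓝 1)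
    (hC₀c : IsCompact C₀) : CompactSpace U ∧ Finite π.ker := by
  have hz := le_center_of_discrete π.ker hd
  obtain ⟨C, O, hC, hO, hOC, hO1, hker⟩ := exists_compact_transversal hs ho hC₀ hC₀c
  have hfg : Group.FG π.ker :=
    (Group.fg_iff_subgroup_fg _).2 (fg_ker hπ hd hz hC hO hOC hO1 hker)
  let : CommGroup π.ker :=
    { (inferInstance : Group π.ker) with
      mul_comm := fun a b => Subtype.ext (Subgroup.mem_center_iff.1 (hz b.2) a) }
  have hfin : Finite π.ker := by
    obtain ⟨ι, j, _, _, p, hp, e, ⟨E⟩⟩ := CommGroup.equiv_free_prod_prod_multiplicative_zmod π.ker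
    have : IsEmpty j := by
      refine ⟨fun i => ?_⟩
      have h2 := eq_zero_of_hom_int hπ hs ho hd hz hW h1 hσ hσπ hθ
        (((Pi.evalMonoidHom (fun _ : j => Multiplicative ℤ) i).comp (MonoidHom.fst _ _)).comp
          E.toMonoidHom)
      have h3 := DFunLike.congr_fun h2
        (E.symm (fun _ => Multiplicative.ofAdd 1, 1))
      simp at h3
    have : ∀ i, Finite (Multiplicative (ZMod (p i ^ e i))) := fun i => by
      have : NeZero (p i ^ e i) := ⟨pow_ne_zero _ (hp i).ne_zero⟩
      exact inferInstanceAs (Finite (ZMod (p i ^ e i)))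
    exact Finite.of_equiv _ E.symm.toEquiv
  refine ⟨⟨?_⟩, hfin⟩
  have h2 : IsCompact (⋃ z : π.ker, (fun x : U => x * z) '' C) :=
    isCompact_iUnion fun z => hC.image (by fun_prop)
  convert h2
  refine (Set.eq_univ_of_forall fun u => ?_).symm
  obtain ⟨z, hz, hu⟩ := hker u
  exact Set.mem_iUnion.2 ⟨⟨z, hz⟩⁻¹, u * z, hOC hu, by simp⟩
end Weyl

section Torus
set_option linter.unusedSectionVars false
open Topology

namespace AlgRep
variable {G : Type*} [Group G] [TopologicalSpace G] [IsTopologicalGroup G] [CompactSpace G]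
  [T2Space G]

lemma commute_of_mem_lie (R : AlgRep G) (hab : ∀ a b : G, a * b = b * a) {X Y : R.A}
    (hX : X ∈ R.lie) (hY : Y ∈ R.lie) : Commute X Y := by
  refine commute_of_commute_exp fun t => Commute.symm (commute_of_commute_exp fun r => ?_)
  obtain ⟨g, hg⟩ := hX t
  obtain ⟨k, hk⟩ := hY r
  rw [← hg, ← hk]
  exact (map_mul R.ρ k g).symm.trans ((congrArg R.ρ (hab k g)).trans (map_mul R.ρ g k))

/-- The exponential map of an abelian group as a homomorphism. -/
noncomputable def exHom (R : AlgRep G) (hR : Function.Injective R.ρ)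
    (hab : ∀ a b : G, a * b = b * a) : Multiplicative R.lie →* G :=
  MonoidHom.mk' (fun X => R.ex X.toAdd) fun X Y => hR (by
    have h1 := nexp_add (R.commute_of_mem_lie hab X.toAdd.2 Y.toAdd.2)
    rw [← R.ρ_ex, ← R.ρ_ex, ← map_mul] at h1
    exact (R.ρ_ex _).trans h1)

lemma exHom_surjective [ConnectedSpace G] (R : AlgRep G) (hR : Function.Injective R.ρ)
    (hab : ∀ a b : G, a * b = b * a) : Function.Surjective (R.exHom hR hab) := by
  rw [← MonoidHom.range_eq_top]
  exact R.eq_top_of_lie hR _ fun X hX =>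
    ⟨_, ⟨Multiplicative.ofAdd ⟨X, hX⟩, rfl⟩, R.ρ_ex ⟨X, hX⟩⟩

lemma exHom_isOpenMap [ConnectedSpace G] (R : AlgRep G) (hR : Function.Injective R.ρ)
    (hab : ∀ a b : G, a * b = b * a) : IsOpenMap (R.exHom hR hab) := by
  have : SigmaCompactSpace (Multiplicative R.lie) := inferInstanceAs (SigmaCompactSpace R.lie)
  exact MonoidHom.isOpenMap_of_sigmaCompact _ (R.exHom_surjective hR hab) (R.continuous_ex hR)

/-- The kernel of the exponential map of an abelian group. -/
noncomputable def exLattice (R : AlgRep G) (hR : Function.Injective R.ρ)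
    (hab : ∀ a b : G, a * b = b * a) : Submodule ℤ R.lie :=
  AddSubgroup.toIntSubmodule (MonoidHom.ker (R.exHom hR hab)).toAddSubgroup'

lemma mem_exLattice (R : AlgRep G) (hR : Function.Injective R.ρ)
    (hab : ∀ a b : G, a * b = b * a) {X : R.lie} : X ∈ R.exLattice hR hab ↔ R.ex X = 1 := Iff.rfl

lemma exLattice_discrete (R : AlgRep G) (hR : Function.Injective R.ρ)
    (hab : ∀ a b : G, a * b = b * a) : DiscreteTopology (R.exLattice hR hab) := by
  obtain ⟨L, W, h, hl⟩ := R.exists_hasLocalLog hR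
  obtain ⟨O, hOl, hO, hO0⟩ := mem_nhds_iff.1 hl
  rw [discreteTopology_iff_isOpen_singleton_zero]
  convert hO.preimage (continuous_subtype_val (p := (· ∈ R.exLattice hR hab)))
  ext X
  simp only [Set.mem_singleton_iff, Set.mem_preimage]
  refine ⟨?_, fun hX => ?_⟩
  · rintro rfl
    exact hO0
  · have h1 := hOl hX
    have h2 := (R.mem_exLattice hR hab).1 X.2
    ext1
    rw [← (show L (R.ex X) = X from h1), h2, h.log_one]
    rfl

lemma exLattice_span [ConnectedSpace G] (R : AlgRep G) (hR : Function.Injective R.ρ)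
    (hab : ∀ a b : G, a * b = b * a) :
    Submodule.span ℝ (R.exLattice hR hab : Set R.lie) = ⊤ := by
  by_contra hne
  obtain ⟨f, hf0, hf⟩ := Submodule.exists_le_ker_of_lt_top _ (lt_top_iff_ne_top.2 hne)
  let F : Multiplicative R.lie →* Multiplicative ℝ := AddMonoidHom.toMultiplicative f.toAddMonoidHom
  have hs := R.exHom_surjective hR hab
  let θ : G →* Multiplicative ℝ := (R.exHom hR hab).liftOfSurjective hs
    ⟨F, fun X hX => hf (Submodule.subset_span hX)⟩
  have hθ : ∀ X, θ (R.exHom hR hab X) = F X :=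
    fun X => MonoidHom.liftOfRightInverse_comp_apply _ _ _ _ X
  have hq : IsQuotientMap (R.exHom hR hab) :=
    (R.exHom_isOpenMap hR hab).isQuotientMap (R.continuous_ex hR) hs
  have hc : Continuous θ := by
    rw [hq.continuous_iff]
    exact (LinearMap.continuous_of_finiteDimensional f).congr fun X => (hθ X).symm
  obtain ⟨C, hC⟩ :=
    (isCompact_range (show Continuous (fun g => (θ g).toAdd) from hc)).isBounded.exists_norm_le
  refine hf0 (LinearMap.ext fun X => ?_)
  by_contra hX
  have hX' : 0 < |f X| := abs_pos.2 hX
  obtain ⟨n, hn⟩ := exists_nat_gt (C / |f X|)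
  have h1 := hC _ ⟨R.exHom hR hab (Multiplicative.ofAdd ((n : ℝ) • X)), rfl⟩
  have h2 : ‖f ((n : ℝ) • X)‖ ≤ C := by
    have h3 := congrArg Multiplicative.toAdd (hθ (Multiplicative.ofAdd ((n : ℝ) • X)))
    simp only [h3] at h1
    exact h1
  rw [map_smul, norm_smul, Real.norm_eq_abs, Real.norm_eq_abs, Nat.abs_cast] at h2
  rw [div_lt_iff₀ hX'] at hn
  linarith

/-- A compact connected abelian group with a faithful representation is a torus. -/
theorem exists_torus [ConnectedSpace G] (R : AlgRep G) (hR : Function.Injective R.ρ)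
    (hab : ∀ a b : G, a * b = b * a) : ∃ (m : ℕ) (p : (Fin m → Circle) →* G), Continuous p ∧
      Function.Surjective p ∧ Finite p.ker := by
  have := R.exLattice_discrete hR hab
  have : IsZLattice ℝ (R.exLattice hR hab) := ⟨R.exLattice_span hR hab⟩
  have : Module.Finite ℤ (R.exLattice hR hab) := ZLattice.module_finite ℝ _
  have : Module.Free ℤ (R.exLattice hR hab) := ZLattice.module_free ℝ _
  let b₀ := Module.finBasis ℤ (R.exLattice hR hab)
  let m := Module.finrank ℤ (R.exLattice hR hab)
  let b : Module.Basis (Fin m) ℝ R.lie := b₀.ofZLatticeBasis ℝ _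
  let ψ : Multiplicative R.lie →* (Fin m → Circle) :=
    { toFun := fun X i => Circle.exp (2 * Real.pi * b.repr X.toAdd i)
      map_one' := by
        ext i
        simp
      map_mul' := fun X Y => by
        funext i
        rw [toAdd_mul, map_add, Finsupp.add_apply, mul_add, Circle.exp_add, Pi.mul_apply] }
  have hψc : Continuous ψ := by
    refine continuous_pi fun i => Circle.exp.continuous.comp (continuous_const.mul ?_)
    exact LinearMap.continuous_of_finiteDimensional (b.coord i)
  have hψs : Function.Surjective ψ := by
    intro z
    refine ⟨Multiplicative.ofAdd (b.equivFun.symm fun i => (z i : ℂ).arg / (2 * Real.pi)), ?_⟩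
    funext i
    have h1 : b.repr (b.equivFun.symm fun i => (z i : ℂ).arg / (2 * Real.pi)) i =
        (z i : ℂ).arg / (2 * Real.pi) := by
      rw [← b.equivFun_apply, LinearEquiv.apply_symm_apply]
    have h2 : 2 * Real.pi * ((z i : ℂ).arg / (2 * Real.pi)) = (z i : ℂ).arg :=
      mul_div_cancel₀ _ Real.two_pi_pos.ne'
    exact (congrArg (fun r => Circle.exp (2 * Real.pi * r)) h1).trans
      ((congrArg Circle.exp h2).trans (Circle.exp_arg (z i)))
  have : SigmaCompactSpace (Multiplicative R.lie) := inferInstanceAs (SigmaCompactSpace R.lie)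
  have hψo : IsOpenMap ψ := MonoidHom.isOpenMap_of_sigmaCompact _ hψs hψc
  have hker : ∀ X, ψ X = 1 ↔ R.exHom hR hab X = 1 := by
    refine fun X => ⟨fun h => ?_, fun h => ?_⟩
    · choose n hn using fun i => Circle.exp_eq_one.1 (congrFun h i)
      have h1 : X.toAdd = b₀.equivFun.symm n := by
        refine b.repr.injective (Finsupp.ext fun i => ?_)
        rw [b₀.ofZLatticeBasis_repr_apply ℝ, ← b₀.equivFun_apply, LinearEquiv.apply_symm_apply]
        have h2 := hn i
        rw [mul_comm] at h2
        exact mul_right_cancel₀ Real.two_pi_pos.ne' h2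
      exact (R.mem_exLattice hR hab).1 (h1 ▸ (b₀.equivFun.symm n).2)
    · funext i
      have h1 : b.repr X.toAdd i = b₀.repr ⟨X.toAdd, h⟩ i :=
        b₀.ofZLatticeBasis_repr_apply ℝ _ ⟨X.toAdd, h⟩ i
      exact (congrArg (fun r => Circle.exp (2 * Real.pi * r)) h1).trans
        (Circle.exp_two_pi_mul_int _)
  let p : (Fin m → Circle) →* G := ψ.liftOfSurjective hψs
    ⟨R.exHom hR hab, fun X hX => (hker X).1 hX⟩
  have hp : ∀ X, p (ψ X) = R.exHom hR hab X :=
    fun X => MonoidHom.liftOfRightInverse_comp_apply _ _ _ _ X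
  refine ⟨m, p, ?_, ?_, ?_⟩
  · rw [(hψo.isQuotientMap hψc hψs).continuous_iff]
    exact (R.continuous_ex hR).congr fun X => (hp X).symm
  · intro g
    obtain ⟨X, rfl⟩ := R.exHom_surjective hR hab g
    exact ⟨_, hp X⟩
  · have : p.ker = ⊥ := by
      rw [eq_bot_iff]
      intro z hz
      obtain ⟨X, rfl⟩ := hψs z
      rw [MonoidHom.mem_ker, hp] at hz
      exact (hker X).2 hz
    rw [this]
    infer_instance

end AlgRep
end Torus

section SimpleFactor
set_option linter.unusedSectionVars false
open Topology

namespace AlgRep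
variable {K : Type*} [Group K] [TopologicalSpace K] [IsTopologicalGroup K] [CompactSpace K]
  [T2Space K]

lemma commute_of_sub_conj_eq_zero (R : AlgRep K) {g : K} {X : R.A}
    (h : X - R.ρ g * X * R.ρ g⁻¹ = 0) : Commute (R.ρ g) X := by
  have h1 := congrArg (· * R.ρ g) (sub_eq_zero.1 h)
  simp only [mul_assoc, ρ_inv_mul, mul_one] at h1
  exact h1.symm

lemma IsSimpleLie.not_forall_commute {R : AlgRep K} (hS : R.IsSimpleLie) :
    ¬ ∀ X ∈ R.lie, ∀ g, Commute (R.ρ g) X := fun h =>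
  hS.1 ((Submodule.eq_bot_iff _).2 fun X hX => hS.2.1 X hX (h X hX))

lemma IsSimpleLie.exists_not_commute {R : AlgRep K} (hS : R.IsSimpleLie) :
    ∃ a b : K, a * b ≠ b * a := by
  by_contra! h
  refine hS.not_forall_commute fun X hX g => (commute_of_commute_exp fun t => ?_).symm
  obtain ⟨k, hk⟩ := hX t
  rw [← hk]
  exact (map_mul R.ρ k g).symm.trans ((congrArg R.ρ (h k g)).trans (map_mul R.ρ g k))

lemma IsSimpleLie.finite_or_eq_top [ConnectedSpace K] {R : AlgRep K} (hR : Function.Injective R.ρ)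
    (hS : R.IsSimpleLie) (N : Subgroup K) [N.Normal] (hN : IsClosed (N : Set K)) :
    Finite N ∨ N = ⊤ := by
  have : CompactSpace N := isCompact_iff_compactSpace.1 hN.isCompact
  rcases hS.2.2 _ (R.lie_restrict_le N) (R.isInv_lie_restrict N) with h | h
  · exact .inl ((R.restrict N).finite_of_lie_eq_bot (hR.comp Subtype.val_injective) h)
  · refine .inr (R.eq_top_of_lie hR N fun X hX => ?_)
    rw [← h, mem_lie_restrict] at hX
    simpa using hX 1

lemma IsSimpleLie.charKer_eq_top [ConnectedSpace K] {R : AlgRep K} (hR : Function.Injective R.ρ)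
    (hS : R.IsSimpleLie) : charKer K = ⊤ := by
  have : CompactSpace (charKer K) := isCompact_iff_compactSpace.1 isClosed_charKer.isCompact
  have h0 : ∀ X ∈ R.lie, ∀ g, X - R.ρ g * X * R.ρ g⁻¹ ∈ (R.restrict (charKer K)).lie :=
    fun X hX g => R.sub_conj_mem_lie _ g (fun t k _ => mem_charKer.2 fun θ _ => by
      have h1 : θ k * θ k⁻¹ = 1 := by rw [← map_mul, mul_inv_cancel, map_one]
      have h2 : θ g * θ g⁻¹ = 1 := by rw [← map_mul, mul_inv_cancel, map_one]
      rw [map_mul, map_mul, map_mul, mul_right_comm (θ k), h1, one_mul, h2]) hX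
  rcases hS.2.2 _ (R.lie_restrict_le (charKer K)) (R.isInv_lie_restrict (charKer K)) with h | h
  · refine absurd (fun X hX g => R.commute_of_sub_conj_eq_zero ?_) hS.not_forall_commute
    exact (Submodule.mem_bot ℝ).1 (h ▸ h0 X hX g)
  · refine R.eq_top_of_lie hR _ fun X hX => ?_
    rw [← h, mem_lie_restrict] at hX
    simpa using hX 1

end AlgRep

lemma MonoidHom.finite_preimage_of_finite_ker {A B : Type*} [Group A] [Group B] (f : A →* B)
    [Finite f.ker] {S : Set B} (hS : S.Finite) : (f ⁻¹' S).Finite := by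
  refine hS.preimage' fun b _ => ?_
  rcases (f ⁻¹' {b}).eq_empty_or_nonempty with h | ⟨a, ha⟩
  · rw [h]
    exact Set.finite_empty
  · refine ((Set.toFinite (f.ker : Set A)).image (a * ·)).subset fun x hx => ?_
    refine ⟨a⁻¹ * x, ?_, mul_inv_cancel_left a x⟩
    rw [SetLike.mem_coe, MonoidHom.mem_ker, map_mul, map_inv,
      show f a = b from ha, show f x = b from hx, inv_mul_cancel]

lemma Subgroup.finite_or_eq_top_of_map {A B : Type*} [Group A] [TopologicalSpace A]
    [IsTopologicalGroup A] [ConnectedSpace A] [Group B] (f : A →* B)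
    [Finite f.ker] (N : Subgroup A) (hN : IsClosed (N : Set A))
    (h : Finite (N.map f) ∨ N.map f = ⊤) : Finite N ∨ N = ⊤ := by
  rcases h with h | h
  · have h1 := f.finite_preimage_of_finite_ker (S := (N.map f : Set B)) (Set.toFinite _)
    exact .inl (h1.subset fun a ha => ⟨a, ha, rfl⟩).to_subtype
  · right
    have : Finite (A ⧸ N) := by
      refine Finite.of_surjective (fun γ : f.ker => ((γ : A) : A ⧸ N)) fun x => ?_
      obtain ⟨a, rfl⟩ := QuotientGroup.mk_surjective x
      obtain ⟨n, hn, hna⟩ : f a ∈ N.map f := h ▸ Subgroup.mem_top _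
      refine ⟨⟨a * n⁻¹, ?_⟩, QuotientGroup.eq.2 ?_⟩
      · rw [MonoidHom.mem_ker, map_mul, map_inv, hna, mul_inv_cancel]
      · simpa using hn
    have : N.FiniteIndex := Subgroup.finiteIndex_of_finite_quotient
    have ho := N.isOpen_of_isClosed_of_finiteIndex hN
    exact SetLike.coe_injective (IsClopen.eq_univ (s := (N : Set A)) ⟨hN, ho⟩ ⟨1, N.one_mem⟩)

/-- A compact connected group with simple Lie algebra is finitely covered by a simple simply
connected compact Lie group. -/
theorem AlgRep.IsSimpleLie.exists_cover {K : Type u} [Group K] [TopologicalSpace K]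
    [IsTopologicalGroup K] [CompactSpace K] [T2Space K] [ConnectedSpace K] {R : AlgRep K}
    (hR : Function.Injective R.ρ) (hS : R.IsSimpleLie) :
    ∃ L : CompactGroupPkg.{u}, IsSimpleSCSCLieGroup L ∧
      ∃ π : L.carrier →* K, Continuous π ∧ Function.Surjective π ∧ Finite π.ker := by
  obtain ⟨L, W, h, hl⟩ := R.exists_hasLocalLog hR
  have hsc : SimplyConnectedSpace (UnivCover K) := h.simplyConnectedSpace
  have hcn : ConnectedSpace (UnivCover K) := inferInstance
  have ht2 : T2Space (UnivCover K) := h.t2Space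
  have hm : IsTopManifold (UnivCover K) := h.univ.isTopManifold (by
    filter_upwards [hl] with X hX
    rw [h.univProj_ray, hX])
  obtain ⟨C, hC, hCc⟩ := h.univ.exists_compact_nhds
  obtain ⟨hcp, hfk⟩ := compactSpace_and_finite_ker (π := univProj K)
    (σ := fun w => (h.ray (L w) : UnivCover K)) (W := W) continuous_univProj h.univProj_surjective
    h.isOpenMap_univProj h.discrete_ker h.isOpen h.one_mem
    (h.univ.cont.comp_continuousOn h.contOn)
    (fun w hw => by rw [h.univProj_ray, h.right_inv w hw])
    (fun θ hθ k => mem_charKer.1 (hS.charKer_eq_top hR ▸ Subgroup.mem_top k) θ hθ) hC hCc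
  refine ⟨⟨UnivCover K⟩, ⟨hm, hcn, hsc, ?_, fun N hN hNc hNt => ?_⟩, univProj K,
    continuous_univProj, h.univProj_surjective, hfk⟩
  · obtain ⟨a, b, hab⟩ := hS.exists_not_commute
    obtain ⟨u, rfl⟩ := h.univProj_surjective a
    obtain ⟨v, rfl⟩ := h.univProj_surjective b
    refine ⟨u, v, fun huv => hab ?_⟩
    rw [← map_mul, ← map_mul]
    exact congrArg _ huv
  · have : (N.map (univProj K)).Normal := hN.map _ h.univProj_surjective
    refine (N.finite_or_eq_top_of_map (univProj K) hNc
      (hS.finite_or_eq_top hR _ ?_)).resolve_right hNt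
    exact (hNc.isCompact.image continuous_univProj).isClosed

end SimpleFactor

section Structure
open Topology

/-- Two commuting subgroups generating `G` with finite intersection, covered by `A` and `B`. -/
lemma exists_product_cover {G : Type*} [Group G] [TopologicalSpace G] [IsTopologicalGroup G]
    {K₁ K₂ : Subgroup G} (hc : ∀ a ∈ K₁, ∀ b ∈ K₂, a * b = b * a)
    (hg : ∀ g, ∃ a ∈ K₁, ∃ b ∈ K₂, a * b = g) [Finite (K₁ ⊓ K₂ : Subgroup G)]
    {A B : Type*} [Group A] [TopologicalSpace A] [Group B] [TopologicalSpace B]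
    {f₁ : A →* K₁} {f₂ : B →* K₂} (h₁ : Continuous f₁) (h₂ : Continuous f₂)
    (hs₁ : Function.Surjective f₁) (hs₂ : Function.Surjective f₂) [Finite f₁.ker]
    [Finite f₂.ker] :
    ∃ f : A × B →* G, Continuous f ∧ Function.Surjective f ∧ Finite f.ker := by
  let f : A × B →* G := (K₁.subtype.comp f₁).noncommCoprod (K₂.subtype.comp f₂)
    fun a b => hc _ (f₁ a).2 _ (f₂ b).2
  have hf : ∀ x, f x = f₁ x.1 * f₂ x.2 := fun _ => rfl
  refine ⟨f, ?_, fun g => ?_, ?_⟩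
  · exact (continuous_subtype_val.comp (h₁.comp continuous_fst)).mul
      (continuous_subtype_val.comp (h₂.comp continuous_snd))
  · obtain ⟨a, ha, b, hb, rfl⟩ := hg g
    obtain ⟨x, hx⟩ := hs₁ ⟨a, ha⟩
    obtain ⟨y, hy⟩ := hs₂ ⟨b, hb⟩
    exact ⟨(x, y), by rw [hf, hx, hy]⟩
  · have hS : ((K₁ ⊓ K₂ : Subgroup G) : Set G).Finite := Set.toFinite _
    have e₁ := f₁.finite_preimage_of_finite_ker
      (hS.preimage (f := ((↑) : K₁ → G)) Subtype.val_injective.injOn)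
    have e₂ := f₂.finite_preimage_of_finite_ker
      (hS.preimage (f := ((↑) : K₂ → G)) Subtype.val_injective.injOn)
    refine ((e₁.prod e₂).subset fun x hx => ?_).to_subtype
    have h : (f₁ x.1 : G) * f₂ x.2 = 1 := hx
    refine ⟨⟨(f₁ x.1).2, ?_⟩, ⟨?_, (f₂ x.2).2⟩⟩
    · rw [eq_inv_of_mul_eq_one_left h]
      exact K₂.inv_mem (f₂ x.2).2
    · rw [eq_inv_of_mul_eq_one_right h]
      exact K₁.inv_mem (f₁ x.1).2

/-- A compact connected group with a faithful representation is finitely covered by a product of a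
torus and simple simply connected compact Lie groups. -/
theorem AlgRep.exists_finite_cover (n : ℕ) : ∀ (G : Type u) [Group G] [TopologicalSpace G]
    [IsTopologicalGroup G] [CompactSpace G] [T2Space G] [ConnectedSpace G] (R : AlgRep G),
    Function.Injective R.ρ → Module.finrank ℝ R.lie = n →
    ∃ (m k : ℕ) (L : Fin k → CompactGroupPkg.{u}), (∀ i, IsSimpleSCSCLieGroup (L i)) ∧
      ∃ p : ((Fin m → Circle) × ∀ i, (L i).carrier) →* G,
        Continuous p ∧ Function.Surjective p ∧ Finite p.ker := by
  induction n using Nat.strong_induction_on with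
  | _ n ih =>
  intro G _ _ _ _ _ _ R hR hn
  by_cases hab : ∀ a b : G, a * b = b * a
  · obtain ⟨m, p, hp, hs, hk⟩ := R.exists_torus hR hab
    refine ⟨m, 0, Fin.elim0, fun i => i.elim0, p.comp (MonoidHom.fst _ _), hp.comp continuous_fst,
      hs.comp Prod.fst_surjective, ?_⟩
    have h := (Set.toFinite (p.ker : Set (Fin m → Circle))).prod
      (Set.finite_univ (α := ∀ i : Fin 0, (Fin.elim0 i : CompactGroupPkg.{u}).carrier))
    exact (h.subset fun x hx => ⟨hx, trivial⟩).to_subtype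
  · push Not at hab
    obtain ⟨K₁, K₂, _, _, _, _, hc, hg, _, hlt, hS⟩ := R.exists_splitting hR hab
    obtain ⟨L₀, hL₀, π, hπ, hπs, hπk⟩ := AlgRep.IsSimpleLie.exists_cover (K := K₁)
      (fun a b hab => Subtype.ext (hR hab)) hS
    obtain ⟨m, k, L, hL, p, hp, hps, hpk⟩ :=
      ih _ (hn ▸ hlt) K₂ (R.restrict K₂)
        (fun a b hab => Subtype.ext (hR hab)) rfl
    obtain ⟨f, hf, hfs, hfk⟩ := exists_product_cover (f₁ := π) (f₂ := p) hc hg hπ hp hπs hps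
    let L' : Fin (k + 1) → CompactGroupPkg.{u} := Fin.cons L₀ L
    let r : ((Fin m → Circle) × ∀ i, (L' i).carrier) →*
        L₀.carrier × ((Fin m → Circle) × ∀ i, (L i).carrier) :=
      { toFun := fun x => (x.2 0, x.1, fun i => x.2 i.succ)
        map_one' := rfl
        map_mul' := fun _ _ => rfl }
    have hrc : Continuous r := by
      refine ((continuous_apply (0 : Fin (k + 1))).comp continuous_snd).prodMk
        (continuous_fst.prodMk (continuous_pi fun i => ?_))
      exact (continuous_apply i.succ).comp continuous_snd
    have hrs : Function.Surjective r := fun x =>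
      ⟨(x.2.1, Fin.cons (α := fun i => (L' i).carrier) x.1 x.2.2), rfl⟩
    have hri : Function.Injective r := by
      intro x y hxy
      refine Prod.ext (congrArg (fun z => z.2.1) hxy) (funext fun i => ?_)
      refine Fin.cases ?_ (fun j => ?_) i
      · exact congrArg (fun z => z.1) hxy
      · exact congrFun (congrArg (fun z => z.2.2) hxy) j
    refine ⟨m, k + 1, L', fun i => ?_, f.comp r, hf.comp hrc, hfs.comp hrs, ?_⟩
    · refine Fin.cases hL₀ (fun j => ?_) i
      exact hL j
    · exact ((Set.toFinite (f.ker : Set _)).preimage hri.injOn).to_subtype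

end Structure

/-- **Structure Theorem for Compact Connected Lie Groups.** If `G` is a compact
connected Lie group, then there are `m k : ℕ`, simple, connected and simply
connected compact Lie groups `L 1, …, L k`, and a continuous surjective
homomorphism `p : 𝕋^m × L 1 × ⋯ × L k → G` with finite kernel. -/
theorem structure_theorem_compact_connected_Lie_groups
    (G : Type u) [Group G] [TopologicalSpace G] [IsTopologicalGroup G]
    [CompactSpace G] [T2Space G] [ConnectedSpace G] (hG : IsTopManifold G) :
    ∃ (m k : ℕ) (L : Fin k → CompactGroupPkg.{u}),
      (∀ i, IsSimpleSCSCLieGroup (L i)) ∧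
      ∃ p : ((Fin m → Circle) × ∀ i, (L i).carrier) →* G,
        Continuous p ∧ Function.Surjective p ∧ Finite p.ker := by
  obtain ⟨R, hR⟩ := AlgRep.exists_injective hG
  exact R.exists_finite_cover _ G hR rfl
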